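/- arXiv:1012.2681 — 3 statements merged into one kernel-verified Lean document; each statement's English description precedes it below -/
import Mathlib

section
/- For every natural number t and every real c with −1/3 < c < 0, the function y ↦ h(c+iy) is integrable over ℝ and (1/(2π)) ∫_{−∞}^{∞} h(c+iy) dy = (3√3/π) · 2^{−6t} · (1)_t^2 / ((1/4)_t (3/4)_t), where h(s) = [(1/2)_s (1/2+2t)_s (1/3+t)_s (2/3+t)_s / ((1/2+t/2)_s (1+t/2)_s (1+t)_s)] · [((15s+4)(2s+1) + t(33s+16)) / (2s+t+1)] · Γ(−s) · 2^{2s}. -/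
open Complex MeasureTheory Real

/-- Rising factorial `(a)ₙ` for real `a` and natural `n`. -/
noncomputable def pochR (a : ℝ) (n : ℕ) : ℝ := ∏ i ∈ Finset.range n, (a + i)

/-- Complex rising factorial `(a)ₛ = Γ(a+s)/Γ(a)`. -/
noncomputable def cpoch (a s : ℂ) : ℂ := Complex.Gamma (a + s) / Complex.Gamma a

/-- Complex power of a positive real base: `b^s = exp(s · log b)` with the real logarithm. -/
noncomputable def cpowR (b : ℝ) (s : ℂ) : ℂ := Complex.exp (s * (Real.log b : ℂ))

/-- The integrand `h` (depending on the natural parameter `t`). -/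
noncomputable def h8 (t : ℕ) (s : ℂ) : ℂ :=
  (cpoch (1/2) s * cpoch (1/2 + 2*(t : ℂ)) s * cpoch (1/3 + (t : ℂ)) s *
      cpoch (2/3 + (t : ℂ)) s /
      (cpoch (1/2 + (t : ℂ)/2) s * cpoch (1 + (t : ℂ)/2) s * cpoch (1 + (t : ℂ)) s)) *
    (((15*s + 4) * (2*s + 1) + (t : ℂ) * (33*s + 16)) / (2*s + (t : ℂ) + 1)) *
    Complex.Gamma (-s) * cpowR 2 (2*s)

/-! ### Gamma bounds -/

theorem norm_betaIntegral_le {u v : ℂ} (hu : 0 < u.re) (hv : 0 < v.re) :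
    ‖Complex.betaIntegral u v‖ ≤ ‖Complex.betaIntegral (u.re : ℂ) (v.re : ℂ)‖ := by
  have hnorm : ∀ (a b : ℂ) (x : ℝ), x ∈ Set.Ioo (0:ℝ) 1 →
      ‖(x : ℂ) ^ (a - 1) * (1 - (x : ℂ)) ^ (b - 1)‖ = x ^ (a.re - 1) * (1 - x) ^ (b.re - 1) := by
    intro a b x hx
    rw [norm_mul, Complex.norm_cpow_eq_rpow_re_of_pos hx.1]
    have : (1 - (x:ℂ)) = ((1 - x : ℝ) : ℂ) := by push_cast; rfl
    rw [this, Complex.norm_cpow_eq_rpow_re_of_pos (by linarith [hx.2])]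
    simp
  have key : Complex.betaIntegral (u.re : ℂ) (v.re : ℂ) =
      ((∫ x in (0:ℝ)..1, x ^ (u.re - 1) * (1 - x) ^ (v.re - 1) : ℝ) : ℂ) := by
    rw [Complex.betaIntegral, ← intervalIntegral.integral_ofReal]
    rw [intervalIntegral.integral_of_le zero_le_one, intervalIntegral.integral_of_le zero_le_one,
      MeasureTheory.integral_Ioc_eq_integral_Ioo, MeasureTheory.integral_Ioc_eq_integral_Ioo]
    refine setIntegral_congr_fun measurableSet_Ioo fun x hx => ?_
    push_cast
    rw [Complex.ofReal_cpow hx.1.le, Complex.ofReal_cpow (by linarith [hx.2])]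
    push_cast; rfl
  rw [key, Complex.norm_real]
  refine le_trans ?_ (le_abs_self _)
  rw [Complex.betaIntegral]
  refine (intervalIntegral.norm_integral_le_integral_norm zero_le_one).trans (le_of_eq ?_)
  rw [intervalIntegral.integral_of_le zero_le_one, intervalIntegral.integral_of_le zero_le_one,
      MeasureTheory.integral_Ioc_eq_integral_Ioo, MeasureTheory.integral_Ioc_eq_integral_Ioo]
  exact setIntegral_congr_fun measurableSet_Ioo fun x hx => hnorm u v x hx

/-- `|Γ(x+iy)|/Γ(x)` is monotone in `x`. -/
theorem gamma_mono {z : ℂ} {x : ℝ} (hz : 0 < z.re) (hx : z.re < x) :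
    ‖Complex.Gamma z‖ * Real.Gamma x ≤
      Real.Gamma z.re * ‖Complex.Gamma (x + z.im * Complex.I)‖ := by
  set w : ℂ := ((x - z.re : ℝ) : ℂ)
  have hw : 0 < w.re := by simp [w]; linarith
  have e1 := Complex.Gamma_mul_Gamma_eq_betaIntegral hz hw
  have hz' : 0 < ((z.re : ℂ)).re := by simpa using hz
  have e2 := Complex.Gamma_mul_Gamma_eq_betaIntegral hz' hw
  have s1 : z + w = x + z.im * Complex.I := by
    apply Complex.ext <;> simp [w]
  have s2 : (z.re : ℂ) + w = x := by
    apply Complex.ext <;> simp [w]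
  rw [s1] at e1
  rw [s2] at e2
  have hb := norm_betaIntegral_le hz hw
  have hwr : ((w.re : ℝ) : ℂ) = w := by simp [w]
  rw [hwr] at hb
  have n1 := congrArg norm e1
  have n2 := congrArg norm e2
  rw [norm_mul, norm_mul] at n1 n2
  have g1 : 0 < ‖Complex.Gamma w‖ := norm_pos_iff.2 (Complex.Gamma_ne_zero_of_re_pos hw)
  have gx : ‖Complex.Gamma (x:ℂ)‖ = Real.Gamma x := by
    rw [Complex.Gamma_ofReal, Complex.norm_real, Real.norm_of_nonneg
      (Real.Gamma_pos_of_pos (by linarith)).le]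
  have gz : ‖Complex.Gamma (z.re:ℂ)‖ = Real.Gamma z.re := by
    rw [Complex.Gamma_ofReal, Complex.norm_real, Real.norm_of_nonneg
      (Real.Gamma_pos_of_pos (by linarith)).le]
  rw [gx, gz] at n2
  refine le_of_mul_le_mul_right ?_ g1
  calc _ = (‖Complex.Gamma z‖ * ‖Complex.Gamma w‖) * Real.Gamma x := by ring
    _ = ‖Complex.Gamma (x + z.im * Complex.I)‖ * (Real.Gamma x * ‖Complex.betaIntegral z w‖) := by
      rw [n1]; ring
    _ ≤ ‖Complex.Gamma (x + z.im * Complex.I)‖ *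
          (Real.Gamma x * ‖Complex.betaIntegral z.re w‖) := by
      have := (Real.Gamma_pos_of_pos (by linarith : 0 < x)).le
      gcongr
    _ = _ := by rw [← n2]; ring

theorem gamma_half_sq (y : ℝ) :
    ‖Complex.Gamma (1/2 + y * Complex.I)‖ ^ 2 = π / Real.cosh (π * y) := by
  have h := Complex.Gamma_mul_Gamma_one_sub (1/2 + y * Complex.I)
  have e : (1 : ℂ) - (1/2 + y * Complex.I) = (starRingEnd ℂ) (1/2 + y * Complex.I) := by
    apply Complex.ext <;> simp; norm_num
  rw [e, Complex.Gamma_conj, Complex.mul_conj, Complex.normSq_eq_norm_sq] at h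
  have e2 : Complex.sin (π * (1/2 + y * Complex.I)) = ((Real.cosh (π * y) : ℝ) : ℂ) := by
    have : (π : ℂ) * (1/2 + y * Complex.I) = (π * y : ℂ) * Complex.I + π / 2 := by ring
    rw [this, Complex.sin_add_pi_div_two, Complex.cos_mul_I]
    push_cast; rfl
  rw [e2] at h
  exact_mod_cast h

theorem gamma_half_upper (y : ℝ) :
    ‖Complex.Gamma (1/2 + y * Complex.I)‖ ≤ 3 * Real.exp (-(π/2) * |y|) := by
  have h := gamma_half_sq y
  have hc : Real.exp (π * |y|) / 2 ≤ Real.cosh (π * y) := by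
    rw [← Real.cosh_abs, abs_mul, abs_of_pos Real.pi_pos, Real.cosh_eq]
    have := Real.exp_pos (-(π * |y|)); linarith
  have h2 : ‖Complex.Gamma (1/2 + y * Complex.I)‖ ^ 2 ≤ (3 * Real.exp (-(π/2) * |y|)) ^ 2 := by
    rw [h, div_le_iff₀ (Real.cosh_pos _), mul_pow, ← Real.exp_nat_mul]
    have e : Real.exp (((2:ℕ):ℝ) * (-(π/2) * |y|)) * Real.exp (π * |y|) = 1 := by
      rw [← Real.exp_add, ← Real.exp_zero]; congr 1; push_cast; ring
    have := Real.exp_pos (((2:ℕ):ℝ) * (-(π/2) * |y|))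
    have h4 := Real.pi_lt_four
    nlinarith [mul_le_mul_of_nonneg_left hc this.le]
  exact le_of_sq_le_sq h2 (by positivity)

theorem gamma_half_lower (y : ℝ) :
    Real.exp (-(π/2) * |y|) ≤ ‖Complex.Gamma (1/2 + y * Complex.I)‖ := by
  have h := gamma_half_sq y
  have hc : Real.cosh (π * y) ≤ Real.exp (π * |y|) := by
    rw [← Real.cosh_abs, abs_mul, abs_of_pos Real.pi_pos, Real.cosh_eq]
    have : Real.exp (-(π * |y|)) ≤ Real.exp (π * |y|) := by
      apply Real.exp_le_exp.2; have := mul_nonneg Real.pi_pos.le (abs_nonneg y); linarith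
    linarith
  have h2 : (Real.exp (-(π/2) * |y|)) ^ 2 ≤ ‖Complex.Gamma (1/2 + y * Complex.I)‖ ^ 2 := by
    rw [h, le_div_iff₀ (Real.cosh_pos _), ← Real.exp_nat_mul]
    have e : Real.exp (((2:ℕ):ℝ) * (-(π/2) * |y|)) * Real.exp (π * |y|) = 1 := by
      rw [← Real.exp_add, ← Real.exp_zero]; congr 1; push_cast; ring
    have := Real.exp_pos (((2:ℕ):ℝ) * (-(π/2) * |y|))
    have h4 := Real.pi_gt_three
    nlinarith [mul_le_mul_of_nonneg_left hc this.le]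
  exact le_of_sq_le_sq h2 (by positivity)

theorem lin_le_exp {ε : ℝ} (hε : 0 < ε) (y : ℝ) : |y| ≤ ε⁻¹ * Real.exp (ε * |y|) := by
  have := Real.add_one_le_exp (ε * |y|)
  rw [inv_mul_eq_div, le_div_iff₀ hε]; linarith

theorem norm_le_exp {ε M : ℝ} (hε : 0 < ε) {z : ℂ} (hz : |z.re| ≤ M) :
    ‖z‖ ≤ (M + ε⁻¹) * Real.exp (ε * |z.im|) := by
  have h1 := Complex.norm_le_abs_re_add_abs_im z
  have h2 := lin_le_exp hε z.im
  have h3 : 1 ≤ Real.exp (ε * |z.im|) := Real.one_le_exp (by positivity)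
  have hM : 0 ≤ M := (abs_nonneg _).trans hz
  nlinarith

theorem gamma_half_nat_upper (n : ℕ) : ∀ ε : ℝ, 0 < ε → ∃ C : ℝ, 0 ≤ C ∧ ∀ y : ℝ,
    ‖Complex.Gamma ((n + 1/2 : ℝ) + y * Complex.I)‖ ≤
      C * Real.exp (ε * |y| - (π/2) * |y|) := by
  induction n with
  | zero =>
    intro ε hε
    refine ⟨3, by norm_num, fun y => ?_⟩
    have h := gamma_half_upper y
    have : (((((0:ℕ):ℝ) + 1/2 : ℝ) : ℂ)) = 1/2 := by push_cast; ring
    rw [this]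
    refine h.trans ?_
    gcongr
    have := mul_nonneg hε.le (abs_nonneg y); linarith
  | succ n ih =>
    intro ε hε
    obtain ⟨C, hC, h⟩ := ih (ε/2) (by linarith)
    refine ⟨(n + 1/2 + (ε/2)⁻¹) * C, by positivity, fun y => ?_⟩
    set z : ℂ := ((n + 1/2 : ℝ) : ℂ) + y * Complex.I with hzdef
    have hre : z.re = n + 1/2 := by simp [z]
    have him : z.im = y := by simp [z]
    have hz0 : z ≠ 0 := by
      intro h0; have := congrArg Complex.re h0; rw [hre] at this; simp at this
      have : (0:ℝ) ≤ n := Nat.cast_nonneg n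
      linarith
    have e : ((((n + 1 : ℕ) : ℝ) + 1/2 : ℝ) : ℂ) + y * Complex.I = z + 1 := by
      rw [hzdef]; push_cast; ring
    rw [e, Complex.Gamma_add_one z hz0, norm_mul]
    have h1 := norm_le_exp (M := n + 1/2) (half_pos hε) (z := z)
      (by rw [hre, abs_of_nonneg (by positivity)])
    rw [him] at h1
    calc _ ≤ ((n + 1/2 + (ε/2)⁻¹) * Real.exp (ε/2 * |y|)) *
          (C * Real.exp (ε/2 * |y| - (π/2) * |y|)) := by
          gcongr; exact h y
      _ = (n + 1/2 + (ε/2)⁻¹) * C * (Real.exp (ε/2 * |y|) * Real.exp (ε/2 * |y| - (π/2) * |y|)) := by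
        ring
      _ = _ := by rw [← Real.exp_add]; congr 2; ring

theorem gamma_upper {a b ε : ℝ} (ha : 0 < a) (hε : 0 < ε) : ∃ C : ℝ, 0 ≤ C ∧ ∀ z : ℂ,
    a ≤ z.re → z.re ≤ b → ‖Complex.Gamma z‖ ≤ C * Real.exp (ε * |z.im| - (π/2) * |z.im|) := by
  obtain ⟨n, hn⟩ := exists_nat_gt b
  obtain ⟨C, hC, h⟩ := gamma_half_nat_upper n ε hε
  have hcont : ContinuousOn Real.Gamma (Set.Icc a b) := by
    intro x hx
    refine (Real.differentiableAt_Gamma fun m => ?_).continuousAt.continuousWithinAt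
    have : (0:ℝ) ≤ m := Nat.cast_nonneg m
    have := hx.1
    intro h; linarith
  obtain ⟨B, hB⟩ := isCompact_Icc.exists_bound_of_continuousOn hcont
  have gn : 0 < Real.Gamma (n + 1/2) := Real.Gamma_pos_of_pos (by positivity)
  refine ⟨|B| * C / Real.Gamma (n + 1/2), by positivity, fun z h1 h2 => ?_⟩
  have hm := gamma_mono (z := z) (x := n + 1/2) (by linarith) (by linarith)
  have hb := (le_abs_self _).trans ((hB z.re ⟨h1, h2⟩).trans (le_abs_self B))
  rw [← mul_div_right_comm, le_div_iff₀ gn]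
  refine hm.trans ?_
  rw [mul_assoc]
  gcongr
  exact h _

theorem gamma_inv_upper {a b ε : ℝ} (ha : 0 < a) (hε : 0 < ε) : ∃ C : ℝ, 0 ≤ C ∧ ∀ z : ℂ,
    a ≤ z.re → z.re ≤ b →
      ‖(Complex.Gamma z)⁻¹‖ ≤ C * Real.exp (ε * |z.im| + (π/2) * |z.im|) := by
  have hcont : ContinuousOn (fun x => (Real.Gamma x)⁻¹) (Set.Icc (a+1) (b+1)) := by
    intro x hx
    refine ((Real.differentiableAt_Gamma fun m => ?_).continuousAt.inv₀ ?_).continuousWithinAt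
    · have : (0:ℝ) ≤ m := Nat.cast_nonneg m
      have := hx.1
      intro h; linarith
    · exact (Real.Gamma_pos_of_pos (by linarith [hx.1])).ne'
  obtain ⟨B, hB⟩ := isCompact_Icc.exists_bound_of_continuousOn hcont
  have gh : 0 < Real.Gamma (1/2) := Real.Gamma_pos_of_pos (by positivity)
  refine ⟨(|b| + ε⁻¹) * (Real.Gamma (1/2) * |B|), by positivity, fun z h1 h2 => ?_⟩
  have hz0 : z ≠ 0 := by rintro rfl; simp at h1; linarith
  have gx : 0 < Real.Gamma (z.re + 1) := Real.Gamma_pos_of_pos (by linarith)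
  have hb := (le_abs_self _).trans ((hB (z.re+1) ⟨by linarith, by linarith⟩).trans (le_abs_self B))
  have hm := gamma_mono (z := 1/2 + z.im * Complex.I) (x := z.re + 1) (by simp) (by simp; linarith)
  have r1 : ((1:ℂ)/2 + z.im * Complex.I).re = 1/2 := by simp
  have r2 : ((1:ℂ)/2 + z.im * Complex.I).im = z.im := by simp
  have r3 : ((z.re + 1 : ℝ) : ℂ) + z.im * Complex.I = z + 1 := by
    apply Complex.ext <;> simp
  rw [r1, r2, r3] at hm
  have hl := gamma_half_lower z.im
  have g1 : 0 < ‖Complex.Gamma (z + 1)‖ :=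
    norm_pos_iff.2 (Complex.Gamma_ne_zero_of_re_pos (by simp; linarith))
  have key : ‖(Complex.Gamma (z+1))⁻¹‖ ≤ Real.Gamma (1/2) * |B| * Real.exp ((π/2) * |z.im|) := by
    rw [norm_inv, inv_le_iff_one_le_mul₀ g1]
    have hb' : 1 ≤ |B| * Real.Gamma (z.re + 1) := by
      rw [← div_le_iff₀ gx, one_div]; exact hb
    have e1 : Real.exp (-(π/2) * |z.im|) * Real.exp ((π/2) * |z.im|) = 1 := by
      rw [← Real.exp_add, ← Real.exp_zero]; congr 1; ring
    have h3 : Real.exp (-(π/2) * |z.im|) * Real.Gamma (z.re + 1) ≤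
        Real.Gamma (1/2) * ‖Complex.Gamma (z + 1)‖ := le_trans (by gcongr) hm
    calc (1:ℝ) ≤ |B| * Real.Gamma (z.re + 1) := hb'
      _ = |B| * (Real.exp (-(π/2) * |z.im|) * Real.Gamma (z.re + 1)) * Real.exp ((π/2) * |z.im|) := by
        linear_combination (- |B| * Real.Gamma (z.re + 1)) * e1
      _ ≤ |B| * (Real.Gamma (1/2) * ‖Complex.Gamma (z + 1)‖) * Real.exp ((π/2) * |z.im|) := by
        gcongr
      _ = _ := by ring
  have e2 : (Complex.Gamma z)⁻¹ = z * (Complex.Gamma (z+1))⁻¹ := by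
    rw [Complex.Gamma_add_one z hz0]; field_simp
  rw [e2, norm_mul]
  have h4 := norm_le_exp (M := |b|) hε (z := z)
    (by rw [abs_of_pos (by linarith)]; exact h2.trans (le_abs_self b))
  calc _ ≤ ((|b| + ε⁻¹) * Real.exp (ε * |z.im|)) *
        (Real.Gamma (1/2) * |B| * Real.exp ((π/2) * |z.im|)) := by gcongr
    _ = (|b| + ε⁻¹) * (Real.Gamma (1/2) * |B|) *
        (Real.exp (ε * |z.im|) * Real.exp ((π/2) * |z.im|)) := by ring
    _ = _ := by rw [← Real.exp_add]

/-! ### Residue lemma for vertical lines -/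

theorem poisson_int {d : ℝ} (hd : 0 < d) :
    Integrable (fun y : ℝ => d / (d^2 + y^2)) ∧ ∫ y : ℝ, d / (d^2 + y^2) = π := by
  have e : (fun y : ℝ => d / (d^2 + y^2)) = fun y : ℝ => d⁻¹ * (1 + (d⁻¹ * y)^2)⁻¹ := by
    funext y
    have : d^2 + y^2 ≠ 0 := by positivity
    field_simp
  rw [e]
  constructor
  · exact (integrable_inv_one_add_sq.comp_mul_left' (inv_ne_zero hd.ne')).const_mul _
  · rw [integral_const_mul, Measure.integral_comp_mul_left (fun x : ℝ => (1 + x^2)⁻¹) d⁻¹,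
      integral_univ_inv_one_add_sq, inv_inv, abs_of_pos hd, smul_eq_mul]
    field_simp

theorem exp_abs_int : Integrable (fun y : ℝ => Real.exp (-|y|/2)) := by
  have h1 : IntegrableOn (fun y : ℝ => Real.exp (-|y|/2)) (Set.Ioi 0) := by
    have := integrableOn_exp_mul_Ioi (a := -(1/2 : ℝ)) (by norm_num) 0
    refine this.congr_fun (fun x hx => ?_) measurableSet_Ioi
    simp only
    rw [abs_of_pos hx]; congr 1; ring
  have h2 : IntegrableOn (fun y : ℝ => Real.exp (-|y|/2)) (Set.Iic 0) := by
    have := integrableOn_exp_mul_Iic (a := (1/2 : ℝ)) (by norm_num) 0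
    refine this.congr_fun (fun x hx => ?_) measurableSet_Iic
    simp only
    rw [abs_of_nonpos hx]; congr 1; ring
  rw [← integrableOn_univ, ← Set.Iic_union_Ioi (a := (0:ℝ))]
  exact h2.union h1

theorem kern_den {d m : ℝ} (h0 : 0 < m) (hd1 : d ≤ 1 - m) (hd2 : m - 1 ≤ d) (y : ℝ) :
    m^2 + y^2 ≤ ‖(1 : ℂ) - (d + y * Complex.I)^2‖ := by
  have e : (1 : ℂ) - (d + y * Complex.I)^2 =
    (1 - (d + y * Complex.I)) * (1 + (d + y * Complex.I)) := by ring
  rw [e, norm_mul]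
  have a1 : √(m^2 + y^2) ≤ ‖(1 : ℂ) - (d + y * Complex.I)‖ := by
    rw [Complex.norm_eq_sqrt_sq_add_sq]
    apply Real.sqrt_le_sqrt
    simp; nlinarith
  have a2 : √(m^2 + y^2) ≤ ‖(1 : ℂ) + (d + y * Complex.I)‖ := by
    rw [Complex.norm_eq_sqrt_sq_add_sq]
    apply Real.sqrt_le_sqrt
    simp; nlinarith
  calc m^2 + y^2 = √(m^2 + y^2) * √(m^2 + y^2) := (Real.mul_self_sqrt (by positivity)).symm
    _ ≤ _ := by gcongr

theorem kern_int_pos {d : ℝ} (h0 : 0 < d) (h1 : d < 1) :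
    Integrable (fun y : ℝ => (1 - ((d:ℂ) + y * Complex.I)^2)⁻¹ / ((d:ℂ) + y * Complex.I)) ∧
    ∫ y : ℝ, (1 - ((d:ℂ) + y * Complex.I)^2)⁻¹ / ((d:ℂ) + y * Complex.I) = π := by
  set g : ℝ → ℂ := fun y => (1 - ((d:ℂ) + y * Complex.I)^2)⁻¹ / ((d:ℂ) + y * Complex.I) with hg
  have hm : 0 < 1 - d := by linarith
  have den0 : ∀ y : ℝ, (1 : ℂ) - ((d:ℂ) + y * Complex.I)^2 ≠ 0 := fun y => by
    rw [← norm_pos_iff]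
    refine lt_of_lt_of_le ?_ (kern_den hm (d := d) (by linarith) (by linarith) y)
    positivity
  have z0 : ∀ y : ℝ, (d:ℂ) + y * Complex.I ≠ 0 := fun y h => by
    have := congrArg Complex.re h; simp at this; linarith
  have hcont : Continuous g := by
    refine Continuous.div (Continuous.inv₀ (by fun_prop) den0) (by fun_prop) z0
  have hInt : Integrable g := by
    refine Integrable.mono' ((poisson_int hm).1.const_mul (d⁻¹ * (1-d)⁻¹))
      hcont.aestronglyMeasurable (Filter.Eventually.of_forall fun y => ?_)
    have b1 := kern_den hm (d := d) (by linarith) (by linarith) y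
    have b2 : d ≤ ‖(d:ℂ) + y * Complex.I‖ := by
      refine le_trans ?_ (Complex.abs_re_le_norm _)
      simp [le_abs_self]
    have p1 : 0 < (1-d)^2 + y^2 := by positivity
    rw [hg]
    simp only [norm_div, norm_inv]
    calc _ ≤ ((1-d)^2 + y^2)⁻¹ / d := by gcongr
      _ = _ := by field_simp
  refine ⟨hInt, ?_⟩
  have hsym : ∀ y : ℝ, g y + g (-y) = ((2 * (d / (d^2 + y^2)) + (1-d) / ((1-d)^2 + y^2)
      - (1+d) / ((1+d)^2 + y^2) : ℝ) : ℂ) := by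
    intro y
    have q : ∀ x : ℝ, 0 < x → (x:ℂ)^2 + (y:ℂ)^2 ≠ 0 := fun x hx => by
      have : (0:ℝ) < x^2 + y^2 := by positivity
      exact_mod_cast this.ne'
    have q1 := q d h0
    have q2 := q (1-d) hm
    have q3 := q (1+d) (by linarith)
    push_cast at q2 q3
    have a1 := den0 y
    have a2 := den0 (-y)
    have a3 := z0 y
    have a4 := z0 (-y)
    have I2 := Complex.I_sq
    have f1 : (d:ℂ)^2 + (y:ℂ)^2 = (d + y * Complex.I) * (d + (-y) * Complex.I) := by
      linear_combination ((y:ℂ)^2) * I2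
    have f2 : (1-(d:ℂ))^2 + (y:ℂ)^2 = (1 - (d + y * Complex.I)) * (1 - (d + (-y) * Complex.I)) := by
      linear_combination ((y:ℂ)^2) * I2
    have f3 : (1+(d:ℂ))^2 + (y:ℂ)^2 = (1 + (d + y * Complex.I)) * (1 + (d + (-y) * Complex.I)) := by
      linear_combination ((y:ℂ)^2) * I2
    rw [hg]
    push_cast at a2 a4 ⊢
    rw [f1, f2, f3]
    rw [f2] at q2
    rw [f3] at q3
    have hd : (2:ℂ) * d = (d + y * Complex.I) + (d + (-y) * Complex.I) := by ring
    generalize (d + y * Complex.I : ℂ) = z at *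
    generalize (d + (-y) * Complex.I : ℂ) = w at *
    have hd' : (d:ℂ) = (z + w)/2 := by linear_combination hd/2
    rw [hd']
    have b1 := left_ne_zero_of_mul q2
    have b2 := right_ne_zero_of_mul q2
    have b3 := left_ne_zero_of_mul q3
    have b4 := right_ne_zero_of_mul q3
    have c1 : (1:ℂ) - z^2 = (1-z)*(1+z) := by ring
    have c2 : (1:ℂ) - w^2 = (1-w)*(1+w) := by ring
    rw [c1, c2]
    field_simp
    ring
  have i1 := poisson_int h0
  have i2 := poisson_int hm
  have i3 := poisson_int (show 0 < 1 + d by linarith)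
  have e1 : ∫ y : ℝ, (g y + g (-y)) = (∫ y, g y) + ∫ y, g y := by
    rw [integral_add hInt hInt.comp_neg, integral_neg_eq_self]
  have e2 : ∫ y : ℝ, (g y + g (-y)) = ((2 * π : ℝ) : ℂ) := by
    simp_rw [hsym]
    have j : Integrable (fun x : ℝ => 2 * (d / (d ^ 2 + x ^ 2)) + (1 - d) / ((1 - d) ^ 2 + x ^ 2)) :=
      (i1.1.const_mul 2).add i2.1
    rw [integral_complex_ofReal, integral_sub j i3.1,
      integral_add (i1.1.const_mul 2) i2.1, integral_const_mul, i1.2, i2.2, i3.2]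
    congr 1; ring
  have : (2:ℂ) * ∫ y, g y = 2 * π := by rw [two_mul, ← e1, e2]; push_cast; rfl
  exact mul_left_cancel₀ two_ne_zero this

theorem kern_int_neg {d : ℝ} (h0 : d < 0) (h1 : -1 < d) :
    Integrable (fun y : ℝ => (1 - ((d:ℂ) + y * Complex.I)^2)⁻¹ / ((d:ℂ) + y * Complex.I)) ∧
    ∫ y : ℝ, (1 - ((d:ℂ) + y * Complex.I)^2)⁻¹ / ((d:ℂ) + y * Complex.I) = -π := by
  obtain ⟨hi, he⟩ := kern_int_pos (d := -d) (by linarith) (by linarith)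
  have e : (fun y : ℝ => (1 - ((d:ℂ) + y * Complex.I)^2)⁻¹ / ((d:ℂ) + y * Complex.I)) =
    fun y : ℝ => -((fun x : ℝ => (1 - (((-d : ℝ):ℂ) + x * Complex.I)^2)⁻¹ /
      (((-d : ℝ):ℂ) + x * Complex.I)) (-y)) := by
    funext y
    simp only
    have : (((-d : ℝ):ℂ) + ((-y : ℝ):ℂ) * Complex.I) = -((d:ℂ) + y * Complex.I) := by
      push_cast; ring
    rw [this, neg_sq, div_neg, neg_neg]
  rw [e]
  refine ⟨hi.comp_neg.neg, ?_⟩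
  rw [integral_neg, integral_neg_eq_self (fun x : ℝ => (1 - (((-d : ℝ):ℂ) + x * Complex.I)^2)⁻¹ /
      (((-d : ℝ):ℂ) + x * Complex.I)), he]

theorem line_int {k : ℂ → ℂ} {c p C : ℝ} (hcp : c ≠ p)
    (hk : ∀ s : ℂ, s.re = c → DifferentiableAt ℂ k s)
    (hb : ∀ s : ℂ, s.re = c → ‖k s‖ ≤ C * Real.exp (-|s.im|/2)) :
    Integrable (fun y : ℝ => k (c + y * Complex.I) / (c + y * Complex.I - p)) := by
  have z0 : ∀ y : ℝ, (c:ℂ) + y * Complex.I - p ≠ 0 := fun y h => by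
    have := congrArg Complex.re h; simp at this; exact hcp (by linarith)
  have hcont : Continuous (fun y : ℝ => k (c + y * Complex.I) / (c + y * Complex.I - p)) := by
    refine Continuous.div ?_ (by fun_prop) z0
    rw [continuous_iff_continuousAt]
    intro y
    have h1 : ContinuousAt k ((c:ℂ) + y * Complex.I) := (hk _ (by simp)).continuousAt
    exact ContinuousAt.comp (f := fun y : ℝ => (c:ℂ) + y * Complex.I) h1 (by fun_prop)
  refine Integrable.mono' (exp_abs_int.const_mul (C * |c - p|⁻¹)) hcont.aestronglyMeasurable
    (Filter.Eventually.of_forall fun y => ?_)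
  have b1 := hb (c + y * Complex.I) (by simp)
  have b2 : |c - p| ≤ ‖(c:ℂ) + y * Complex.I - p‖ := by
    refine le_trans ?_ (Complex.abs_re_le_norm _)
    simp
  have p1 : 0 < |c - p| := abs_pos.2 (sub_ne_zero.2 hcp)
  have him : ((c:ℂ) + y * Complex.I).im = y := by simp
  rw [him] at b1
  rw [norm_div, div_eq_mul_inv]
  have hC : 0 ≤ C * Real.exp (-|y|/2) := (norm_nonneg _).trans b1
  calc _ ≤ (C * Real.exp (-|y|/2)) * |c-p|⁻¹ := by gcongr
    _ = _ := by ring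

theorem residue_lemma {k : ℂ → ℂ} {c1 c2 p C : ℝ} (h1 : c1 < p) (h2 : p < c2)
    (h1' : p - 1 < c1) (h2' : c2 < p + 1)
    (hk : ∀ s : ℂ, c1 ≤ s.re → s.re ≤ c2 → DifferentiableAt ℂ k s)
    (hb : ∀ s : ℂ, c1 ≤ s.re → s.re ≤ c2 → ‖k s‖ ≤ C * Real.exp (-|s.im|/2)) :
    (∫ y : ℝ, k (c2 + y * Complex.I) / (c2 + y * Complex.I - p)) -
      ∫ y : ℝ, k (c1 + y * Complex.I) / (c1 + y * Complex.I - p) = 2 * π * k p := by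
  have I1 := line_int (k := k) (C := C) h1.ne (fun s hs => hk s hs.ge (by linarith))
    (fun s hs => hb s hs.ge (by linarith))
  have I2 := line_int (k := k) (C := C) h2.ne' (fun s hs => hk s (by linarith) hs.le)
    (fun s hs => hb s (by linarith) hs.le)
  obtain ⟨J1, E1⟩ := kern_int_neg (d := c1 - p) (by linarith) (by linarith)
  obtain ⟨J2, E2⟩ := kern_int_pos (d := c2 - p) (by linarith) (by linarith)
  have hK0 : ∀ c y : ℝ, (((c - p : ℝ) : ℂ)) + y * Complex.I = c + y * Complex.I - p := by
    intro c y; push_cast; ring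
  simp only [hK0] at J1 J2 E1 E2
  set K : ℂ → ℂ := fun s => k s - k p * (1 - (s - p)^2)⁻¹ with hK
  set f := dslope K p with hf
  set m := min (c1 - (p-1)) (p + 1 - c2) with hm
  have m0 : 0 < m := lt_min (by linarith) (by linarith)
  have mm1 : m ≤ c1 - (p-1) := min_le_left _ _
  have mm2 : m ≤ p + 1 - c2 := min_le_right _ _
  have hden : ∀ s : ℂ, c1 ≤ s.re → s.re ≤ c2 → m^2 + s.im^2 ≤ ‖(1:ℂ) - (s - p)^2‖ := by
    intro s a b
    have := kern_den m0 (d := s.re - p) (by linarith) (by linarith) s.im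
    have e : (((s.re - p : ℝ) : ℂ)) + s.im * Complex.I = s - p := by
      apply Complex.ext <;> simp
    rwa [e] at this
  have hden0 : ∀ s : ℂ, c1 ≤ s.re → s.re ≤ c2 → (1:ℂ) - (s - p)^2 ≠ 0 := by
    intro s a b
    rw [← norm_pos_iff]
    refine lt_of_lt_of_le ?_ (hden s a b); positivity
  have hKd : DifferentiableOn ℂ K {s | c1 ≤ s.re ∧ s.re ≤ c2} := by
    intro s hs
    refine DifferentiableAt.differentiableWithinAt ?_
    refine (hk s hs.1 hs.2).sub ((differentiableAt_const _).mul
      (DifferentiableAt.inv (by fun_prop) (hden0 s hs.1 hs.2)))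
  have hU : {s : ℂ | c1 ≤ s.re ∧ s.re ≤ c2} ∈ nhds (p : ℂ) := by
    have o : IsOpen {s : ℂ | c1 < s.re ∧ s.re < c2} :=
      (isOpen_lt continuous_const Complex.continuous_re).inter
        (isOpen_lt Complex.continuous_re continuous_const)
    refine Filter.mem_of_superset (o.mem_nhds (by simp [h1, h2])) ?_
    rintro s ⟨a, b⟩; exact ⟨a.le, b.le⟩
  have hfd : DifferentiableOn ℂ f {s | c1 ≤ s.re ∧ s.re ≤ c2} :=
    (Complex.differentiableOn_dslope hU).2 hKd
  have hKp : K p = 0 := by simp [hK]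
  have hfv : ∀ s : ℂ, s ≠ p → f s = k s / (s - p) - k p * ((1 - (s-p)^2)⁻¹ / (s - p)) := by
    intro s hs
    rw [hf, dslope_of_ne _ hs, slope_def_field, hKp, hK]
    ring
  have hfl : ∀ c : ℝ, c ≠ p → (fun y : ℝ => f (c + y * Complex.I)) = fun y : ℝ =>
      k (c + y * Complex.I) / (c + y * Complex.I - p) -
        k p * ((1 - (c + y * Complex.I-p)^2)⁻¹ / (c + y * Complex.I - p)) := by
    intro c hc
    funext y
    refine hfv _ fun h => hc ?_
    have := congrArg Complex.re h; simpa using this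
  have F1 : Integrable (fun y : ℝ => f (c1 + y * Complex.I)) := by
    rw [hfl c1 h1.ne]; exact I1.sub (J1.const_mul _)
  have F2 : Integrable (fun y : ℝ => f (c2 + y * Complex.I)) := by
    rw [hfl c2 h2.ne']; exact I2.sub (J2.const_mul _)
  have V1 : ∫ y : ℝ, f (c1 + y * Complex.I) =
      (∫ y : ℝ, k (c1 + y * Complex.I) / (c1 + y * Complex.I - p)) - k p * (-π) := by
    rw [hfl c1 h1.ne, integral_sub I1 (J1.const_mul _), integral_const_mul, E1]
  have V2 : ∫ y : ℝ, f (c2 + y * Complex.I) =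
      (∫ y : ℝ, k (c2 + y * Complex.I) / (c2 + y * Complex.I - p)) - k p * π := by
    rw [hfl c2 h2.ne', integral_sub I2 (J2.const_mul _), integral_const_mul, E2]
  -- horizontal bound
  have hC : 0 ≤ C := by
    have := (norm_nonneg _).trans (hb p (by simp [h1.le]) (by simp [h2.le]))
    simpa using this
  set bd : ℝ → ℝ := fun T => (C * Real.exp (-T/2) + ‖k p‖ * (T^2)⁻¹) / T with hbd
  have hfb : ∀ s : ℂ, c1 ≤ s.re → s.re ≤ c2 → ∀ T : ℝ, 0 < T → |s.im| = T → ‖f s‖ ≤ bd T := by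
    intro s a b T hT him
    have hsp : s ≠ p := by
      rintro rfl; simp at him; linarith
    have hsm : T ≤ ‖s - p‖ := by
      refine le_trans ?_ (Complex.abs_im_le_norm _)
      simp [him]
    rw [hf, dslope_of_ne _ hsp, slope_def_field, hKp, sub_zero, norm_div, hbd]
    simp only
    have q : T^2 ≤ ‖(1:ℂ) - (s-p)^2‖ := by
      refine le_trans ?_ (hden s a b)
      rw [← him, sq_abs]; nlinarith
    have q2 : ‖K s‖ ≤ C * Real.exp (-T/2) + ‖k p‖ * (T^2)⁻¹ := by
      rw [hK]
      refine (norm_sub_le _ _).trans ?_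
      rw [norm_mul, norm_inv]
      have := hb s a b
      rw [him] at this
      gcongr
    gcongr
  have hrect : ∀ T : ℝ, 0 < T →
      ‖(∫ y in (-T)..T, f (c2 + y * Complex.I)) - ∫ y in (-T)..T, f (c1 + y * Complex.I)‖
        ≤ 2 * (bd T * (c2 - c1)) := by
    intro T hT
    have hr := Complex.integral_boundary_rect_eq_zero_of_differentiableOn f
      (c1 + (-T : ℝ) * Complex.I) (c2 + T * Complex.I) (by
        refine hfd.mono ?_
        rintro s ⟨hs, -⟩
        simp only [Set.mem_preimage, Complex.add_re, Complex.ofReal_re, Complex.mul_re,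
          Complex.I_re, Complex.ofReal_im, Complex.I_im, mul_zero, zero_mul, sub_zero, add_zero,
          mul_one] at hs
        rw [Set.uIcc_of_le (by linarith)] at hs
        exact hs)
    simp only [Complex.add_re, Complex.ofReal_re, Complex.mul_re, Complex.add_im, Complex.mul_im,
      Complex.I_re, Complex.ofReal_im, Complex.I_im, mul_zero, zero_mul, sub_zero, add_zero,
      mul_one, zero_add, smul_eq_mul] at hr
    have hh : ∀ v : ℝ, |v| = T → ‖∫ x in c1..c2, f (x + v * Complex.I)‖ ≤ bd T * (c2 - c1) := by
      intro v hv
      have := intervalIntegral.norm_integral_le_of_norm_le_const (a := c1) (b := c2)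
        (f := fun x : ℝ => f (x + v * Complex.I)) (C := bd T) (by
          intro x hx
          rw [Set.uIoc_of_le (by linarith)] at hx
          exact hfb _ (by simp [hx.1.le]) (by simp [hx.2]) T hT (by simp [hv]))
      rwa [abs_of_pos (by linarith)] at this
    have n1 := hh (-T) (by rw [abs_neg, abs_of_pos hT])
    have n2 := hh T (abs_of_pos hT)
    set A1 := ∫ x in c1..c2, f (x + (-T : ℝ) * Complex.I)
    set A2 := ∫ x in c1..c2, f (x + T * Complex.I)
    set B1 := ∫ y in (-T)..T, f (c1 + y * Complex.I)
    set B2 := ∫ y in (-T)..T, f (c2 + y * Complex.I)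
    have : B2 - B1 = Complex.I * (A1 - A2) := by
      linear_combination (-Complex.I) * hr + (B2 - B1) * Complex.I_sq
    rw [this, norm_mul, Complex.norm_I, one_mul]
    refine (norm_sub_le _ _).trans ?_
    linarith
  have hbd0 : Filter.Tendsto bd Filter.atTop (nhds 0) := by
    have t1 : Filter.Tendsto (fun T : ℝ => Real.exp (-T/2)) Filter.atTop (nhds 0) := by
      have : (fun T : ℝ => Real.exp (-T/2)) = fun T : ℝ => Real.exp (-(T/2)) := by
        funext T; congr 1; ring
      rw [this]
      exact Real.tendsto_exp_neg_atTop_nhds_zero.comp (Filter.tendsto_id.atTop_div_const two_pos)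
    have t2 : Filter.Tendsto (fun T : ℝ => (T^2)⁻¹) Filter.atTop (nhds 0) :=
      (Filter.tendsto_pow_atTop two_ne_zero).inv_tendsto_atTop
    have t3 : Filter.Tendsto (fun T : ℝ => T⁻¹) Filter.atTop (nhds 0) := tendsto_inv_atTop_zero
    have := ((t1.const_mul C).add (t2.const_mul ‖k p‖)).mul t3
    simpa [hbd, div_eq_mul_inv] using this
  have L1 := intervalIntegral_tendsto_integral F1 Filter.tendsto_neg_atTop_atBot
    (Filter.tendsto_id (α := ℝ))
  have L2 := intervalIntegral_tendsto_integral F2 Filter.tendsto_neg_atTop_atBot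
    (Filter.tendsto_id (α := ℝ))
  have L3 := L2.sub L1
  have L4 : Filter.Tendsto (fun T : ℝ => (∫ y in (-T)..(id T), f (c2 + y * Complex.I)) -
      ∫ y in (-T)..(id T), f (c1 + y * Complex.I)) Filter.atTop (nhds 0) := by
    refine squeeze_zero_norm' (a := fun T => 2 * (bd T * (c2 - c1))) ?_ ?_
    · filter_upwards [Filter.eventually_gt_atTop 0] with T hT
      exact hrect T hT
    · simpa using (hbd0.mul_const (c2 - c1)).const_mul 2
  have := tendsto_nhds_unique L3 L4
  rw [V1, V2] at this
  linear_combination this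

/-! ### Periodic functions of small exponential type are constant -/

theorem sin_lower (t : ℂ) : Real.sinh (π * |t.im|) ≤ ‖Complex.sin (π * t)‖ := by
  have h : ‖Complex.sin (π * t)‖^2 = Real.sin (π * t.re)^2 + Real.sinh (π * t.im)^2 := by
    have e : (π : ℂ) * t = ((π * t.re : ℝ) : ℂ) + ((π * t.im : ℝ) : ℂ) * Complex.I := by
      apply Complex.ext <;> simp
    rw [e, Complex.sin_add_mul_I, ← Complex.ofReal_sin, ← Complex.ofReal_cos,
      ← Complex.ofReal_sinh, ← Complex.ofReal_cosh, ← Complex.normSq_eq_norm_sq,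
      ← Complex.ofReal_mul, ← Complex.ofReal_mul, Complex.normSq_add_mul_I]
    have h1 := Real.sin_sq_add_cos_sq (π * t.re)
    have h2 := Real.cosh_sq (π * t.im)
    rw [mul_pow, mul_pow, h2]
    linear_combination (Real.sinh (π * t.im))^2 * h1
  have h2 : Real.sinh (π * |t.im|)^2 = Real.sinh (π * t.im)^2 := by
    rcases abs_choice t.im with h | h <;> rw [h]
    rw [mul_neg, Real.sinh_neg, neg_sq]
  refine le_of_sq_le_sq ?_ (norm_nonneg _)
  rw [h, h2]; nlinarith [sq_nonneg (Real.sin (π * t.re))]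

theorem entire_periodic {f : ℂ → ℂ} {C : ℝ} (hd : Differentiable ℂ f)
    (hp : ∀ t, f (t + 1) = f t)
    (hb : ∀ t : ℂ, 0 ≤ t.re → t.re ≤ 1 → ‖f t‖ ≤ C * Real.exp (2 * |t.im|)) :
    f (-1/3) = f 0 := by
  have hC : 0 ≤ C := by
    have := (norm_nonneg _).trans (hb 0 (by simp) (by simp)); simpa using this
  have hpn : ∀ (n : ℕ) (t : ℂ), f (t + n) = f t := by
    intro n
    induction n with
    | zero => simp
    | succ n ih => intro t; push_cast; rw [← add_assoc, hp, ih]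
  have hpz : ∀ (n : ℤ) (t : ℂ), f (t + n) = f t := by
    intro n t
    obtain ⟨m, rfl | rfl⟩ := n.eq_nat_or_neg
    · simpa using hpn m t
    · have := hpn m (t - m)
      simp at this ⊢
      rw [← sub_eq_add_neg, this]
  set g : ℂ → ℂ := fun t => f t - f 0 with hg
  have hgd : Differentiable ℂ g := hd.sub_const _
  have hgz : ∀ n : ℤ, g n = 0 := by
    intro n; have := hpz n 0; simp at this; simp [hg, this]
  have hgp : ∀ t, g (t + 1) = g t := fun t => by simp [hg, hp]
  set S : ℂ → ℂ := fun t => Complex.sin (π * t) with hS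
  have hSd : Differentiable ℂ S := by
    intro t; exact Complex.differentiableAt_sin.comp t (by fun_prop)
  have hSD : ∀ t, HasDerivAt S (Complex.cos (π * t) * π) t := by
    intro t
    have h1 : HasDerivAt (fun t : ℂ => (π : ℂ) * t) π t := by
      simpa using (hasDerivAt_id t).const_mul (π : ℂ)
    exact h1.csin
  have hSz : ∀ t, S t = 0 → ∃ n : ℤ, t = n := by
    intro t ht
    obtain ⟨n, hn⟩ := Complex.sin_eq_zero_iff.1 ht
    refine ⟨n, ?_⟩
    have hpi : (π : ℂ) ≠ 0 := Complex.ofReal_ne_zero.2 Real.pi_ne_zero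
    have : (π : ℂ) * t = π * n := by rw [hn]; ring
    exact mul_left_cancel₀ hpi this
  have hSp : ∀ t, S (t + 1) = - S t := by
    intro t; simp only [hS]; rw [mul_add, mul_one, Complex.sin_add_pi]
  have hSn : ∀ n : ℤ, S n = 0 := by
    intro n; simp only [hS]; rw [mul_comm]; exact Complex.sin_int_mul_pi n
  classical
  set Q : ℂ → ℂ := fun t => if S t = 0 then deriv g t / deriv S t else g t / S t with hQ
  have hQd : Differentiable ℂ Q := by
    intro t
    by_cases ht : S t = 0
    · obtain ⟨n, rfl⟩ := hSz t ht
      have hdS : deriv S (n:ℂ) ≠ 0 := by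
        rw [(hSD _).deriv]
        refine mul_ne_zero ?_ (Complex.ofReal_ne_zero.2 Real.pi_ne_zero)
        intro hc
        have := Complex.sin_sq_add_cos_sq (π * (n:ℂ))
        have hs : Complex.sin (π * (n:ℂ)) = 0 := ht
        rw [hs, hc] at this
        simp at this
      have d1 : DifferentiableAt ℂ (dslope g n) n :=
        ((Complex.differentiableOn_dslope Filter.univ_mem).2 hgd.differentiableOn).differentiableAt
          Filter.univ_mem
      have d2 : DifferentiableAt ℂ (dslope S n) n :=
        ((Complex.differentiableOn_dslope Filter.univ_mem).2 hSd.differentiableOn).differentiableAt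
          Filter.univ_mem
      have d3 : DifferentiableAt ℂ (fun t => dslope g n t / dslope S n t) n :=
        d1.div d2 (by rw [dslope_same]; exact hdS)
      refine d3.congr_of_eventuallyEq ?_
      filter_upwards [d2.continuousAt.eventually_ne (by rw [dslope_same]; exact hdS)] with w hw
      by_cases hwn : w = n
      · subst hwn
        simp only [hQ, ht, if_true, dslope_same]
      · rw [dslope_of_ne _ hwn, slope_def_field, hSn n, sub_zero] at hw
        have hw0 : w - n ≠ 0 := sub_ne_zero.2 hwn
        have hSw : S w ≠ 0 := fun h => hw (by rw [h, zero_div])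
        simp only [hQ, hSw, if_false]
        rw [dslope_of_ne _ hwn, dslope_of_ne _ hwn, slope_def_field, slope_def_field, hSn, hgz,
          sub_zero, sub_zero]
        field_simp
    · have d3 : DifferentiableAt ℂ (fun t => g t / S t) t := (hgd t).div (hSd t) ht
      refine d3.congr_of_eventuallyEq ?_
      filter_upwards [(hSd t).continuousAt.eventually_ne ht] with w hw
      simp only [hQ, hw, if_false]
  have hQp : ∀ t, Q (t + 1) = - Q t := by
    intro t
    have a1 : deriv g (t+1) = deriv g t := by
      rw [← deriv_comp_add_const]; congr 1; funext x; exact hgp x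
    have a2 : deriv S (t+1) = - deriv S t := by
      rw [← deriv_comp_add_const, ← deriv.fun_neg]; congr 1; funext x; exact hSp x
    by_cases h : S t = 0
    · simp [hQ, hSp, h, a1, a2, div_neg]
    · simp [hQ, hSp, h, hgp, div_neg]
  have hQn : ∀ (n : ℕ) (t : ℂ), ‖Q (t + n)‖ = ‖Q t‖ := by
    intro n
    induction n with
    | zero => simp
    | succ n ih => intro t; push_cast; rw [← add_assoc, hQp, norm_neg, ih]
  have hQz : ∀ (n : ℤ) (t : ℂ), ‖Q (t + n)‖ = ‖Q t‖ := by
    intro n t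
    obtain ⟨m, rfl | rfl⟩ := n.eq_nat_or_neg
    · simpa using hQn m t
    · have := hQn m (t - m)
      simp at this ⊢
      rw [← sub_eq_add_neg, this]
  have hcomp : IsCompact (Set.Icc (0:ℝ) 1 ×ℂ Set.Icc (-1:ℝ) 1) :=
    isCompact_Icc.reProdIm isCompact_Icc
  obtain ⟨B, hB⟩ := hcomp.exists_bound_of_continuousOn hQd.continuous.continuousOn
  have hQb : ∀ t : ℂ, 0 ≤ t.re → t.re ≤ 1 → ‖Q t‖ ≤ max B (4 * (C + ‖f 0‖)) := by
    intro t h0 h1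
    by_cases hi : |t.im| ≤ 1
    · refine le_max_of_le_left (hB t ⟨⟨h0, h1⟩, abs_le.1 hi⟩)
    · push Not at hi
      refine le_max_of_le_right ?_
      have hs := sin_lower t
      have hsinh : Real.exp (2 * |t.im|) / 4 ≤ Real.sinh (π * |t.im|) := by
        rw [Real.sinh_eq]
        have e1 : Real.exp (2 * |t.im|) ≤ Real.exp (π * |t.im|) := by
          apply Real.exp_le_exp.2; have := Real.pi_gt_three; nlinarith
        have e2 : Real.exp (-(π * |t.im|)) ≤ 1 := by
          apply Real.exp_le_one_iff.2; have := Real.pi_gt_three; nlinarith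
        have e3 : 2 ≤ Real.exp (2 * |t.im|) := by
          have := Real.add_one_le_exp (2 * |t.im|); linarith
        linarith
      have hpos := Real.exp_pos (2 * |t.im|)
      have hSt : 0 < ‖S t‖ := lt_of_lt_of_le (by positivity) (hsinh.trans hs)
      have hSt0 : S t ≠ 0 := norm_pos_iff.1 hSt
      simp only [hQ, hSt0, if_false]
      rw [norm_div, div_le_iff₀ hSt]
      have hg1 : ‖g t‖ ≤ (C + ‖f 0‖) * Real.exp (2 * |t.im|) := by
        refine (norm_sub_le _ _).trans ?_
        have := hb t h0 h1
        have h1e : 1 ≤ Real.exp (2 * |t.im|) := Real.one_le_exp (by positivity)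
        nlinarith [norm_nonneg (f 0)]
      have : Real.exp (2 * |t.im|) ≤ 4 * ‖S t‖ := by
        have := hsinh.trans hs; simp only [hS]; linarith
      calc _ ≤ (C + ‖f 0‖) * Real.exp (2 * |t.im|) := hg1
        _ ≤ (C + ‖f 0‖) * (4 * ‖S t‖) := by gcongr
        _ = _ := by ring
  have hbdd : Bornology.IsBounded (Set.range Q) := by
    rw [isBounded_iff_forall_norm_le]
    refine ⟨max B (4 * (C + ‖f 0‖)), ?_⟩
    · rintro _ ⟨t, rfl⟩
      have := hQz (-⌊t.re⌋) t
      rw [← this]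
      refine hQb _ ?_ ?_
      · simp; linarith [Int.floor_le t.re]
      · simp; linarith [Int.lt_floor_add_one t.re]
  have hconst := hQd.apply_eq_apply_of_bounded hbdd (-1/3 + 1) (-1/3)
  rw [hQp] at hconst
  have hQ0 : Q (-1/3) = 0 := by linear_combination (-1/2) * hconst
  have hS0 : S (-1/3) ≠ 0 := by
    intro h
    obtain ⟨n, hn⟩ := hSz _ h
    have : (3 * n : ℂ) = -1 := by rw [← hn]; norm_num
    have : (3 * n : ℤ) = -1 := by exact_mod_cast this
    omega
  simp only [hQ, hS0, if_false] at hQ0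
  have := (div_eq_zero_iff.1 hQ0).resolve_right hS0
  exact sub_eq_zero.1 this

theorem periodic_const {E : ℂ → ℂ} {C : ℝ}
    (hd : ∀ t : ℂ, -1/2 < t.re → DifferentiableAt ℂ E t)
    (hp : ∀ t : ℂ, -1/2 < t.re → E (t + 1) = E t)
    (hb : ∀ t : ℂ, 0 ≤ t.re → t.re ≤ 1 → ‖E t‖ ≤ C * Real.exp (2 * |t.im|)) (n : ℕ) :
    E n = E (-1/3) := by
  have hpn : ∀ (n : ℕ) (t : ℂ), -1/2 < t.re → E (t + n) = E t := by
    intro n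
    induction n with
    | zero => simp
    | succ n ih =>
      intro t ht; push_cast
      have : (0:ℝ) ≤ n := Nat.cast_nonneg n
      rw [← add_assoc, hp _ (by simp; linarith), ih t ht]
  set f : ℂ → ℂ := fun t => E (t + (⌈-t.re⌉₊ : ℕ)) with hf
  have hN : ∀ t : ℂ, -1/2 < (t + (⌈-t.re⌉₊ : ℕ)).re := by
    intro t; have := Nat.le_ceil (-t.re); simp; linarith
  have hfm : ∀ (t : ℂ) (m : ℕ), -1/2 < (t + m).re → f t = E (t + m) := by
    intro t m hm
    simp only [hf]
    rcases le_total m ⌈-t.re⌉₊ with h | h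
    · obtain ⟨j, hj⟩ := Nat.exists_eq_add_of_le h
      rw [hj]; push_cast; rw [← add_assoc, hpn j _ hm]
    · obtain ⟨j, hj⟩ := Nat.exists_eq_add_of_le h
      rw [hj]; push_cast; rw [← add_assoc, hpn j _ (hN t)]
  have hfE : ∀ t : ℂ, -1/2 < t.re → f t = E t := by
    intro t ht; simpa using hfm t 0 (by simpa using ht)
  have key : f (-1/3) = f 0 := by
    refine entire_periodic (C := C) ?_ ?_ ?_
    · intro t
      have h1 := hN t
      have d : DifferentiableAt ℂ (fun w : ℂ => E (w + (⌈-t.re⌉₊ : ℕ))) t :=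
        DifferentiableAt.comp t (f := fun w : ℂ => w + (⌈-t.re⌉₊ : ℕ)) (hd _ h1) (by fun_prop)
      refine d.congr_of_eventuallyEq ?_
      have o : IsOpen {w : ℂ | -1/2 < (w + (⌈-t.re⌉₊ : ℕ)).re} :=
        isOpen_lt continuous_const (by fun_prop)
      filter_upwards [o.mem_nhds h1] with w hw
      exact hfm w _ hw
    · intro t
      have h1 := hN t
      have e : t + ((⌈-t.re⌉₊ + 1 : ℕ) : ℂ) = t + 1 + (⌈-t.re⌉₊ : ℕ) := by push_cast; ring
      rw [hfm t (⌈-t.re⌉₊ + 1) (by rw [e]; simp at h1 ⊢; linarith),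
        hfm (t+1) ⌈-t.re⌉₊ (by simp at h1 ⊢; linarith), e]
    · intro t h0 h1
      rw [hfE t (by linarith)]; exact hb t h0 h1
  rw [hfE _ (by norm_num), hfE _ (by norm_num)] at key
  rw [key]
  simpa using hpn n 0 (by norm_num)

/-! ### Holomorphic parameter integrals -/

theorem param_diff {F : ℂ → ℝ → ℂ} {t0 : ℂ} {r C : ℝ} (hr : 0 < r)
    (hd : ∀ y : ℝ, ∀ t ∈ Metric.ball t0 r, DifferentiableAt ℂ (fun t => F t y) t)
    (hm : ∀ t ∈ Metric.ball t0 r, AEStronglyMeasurable (F t) volume)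
    (hb : ∀ t ∈ Metric.ball t0 r, ∀ y : ℝ, ‖F t y‖ ≤ C * Real.exp (-|y|/2)) :
    DifferentiableAt ℂ (fun t => ∫ y : ℝ, F t y) t0 := by
  have ht0 : t0 ∈ Metric.ball t0 r := Metric.mem_ball_self hr
  have hInt : Integrable (F t0) :=
    Integrable.mono' (exp_abs_int.const_mul C) (hm t0 ht0)
      (Filter.Eventually.of_forall fun y => hb t0 ht0 y)
  have hmeas : AEStronglyMeasurable (fun y => deriv (fun t => F t y) t0) volume := by
    set u : ℕ → ℂ := fun n => t0 + ((r / 2 * (1 / ((n:ℝ) + 1)) : ℝ) : ℂ) with hu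
    have hpos : ∀ n : ℕ, 0 < r / 2 * (1 / ((n:ℝ) + 1)) := fun n => by positivity
    have hlt : ∀ n : ℕ, r / 2 * (1 / ((n:ℝ) + 1)) < r := fun n => by
      have : 1 / ((n:ℝ) + 1) ≤ 1 := by
        rw [div_le_one (by positivity)]
        have : (0:ℝ) ≤ n := Nat.cast_nonneg n
        linarith
      nlinarith
    have hub : ∀ n, u n ∈ Metric.ball t0 r := fun n => by
      rw [Metric.mem_ball, dist_eq_norm, hu]
      simp only [add_sub_cancel_left, Complex.norm_real]
      rw [Real.norm_of_nonneg (hpos n).le]; exact hlt n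
    have hut : Filter.Tendsto u Filter.atTop (nhdsWithin t0 {t0}ᶜ) := by
      refine tendsto_nhdsWithin_iff.2 ⟨?_, Filter.Eventually.of_forall fun n => ?_⟩
      · have h1 : Filter.Tendsto (fun n : ℕ => r / 2 * (1 / ((n:ℝ) + 1))) Filter.atTop (nhds 0) := by
          simpa using (tendsto_one_div_add_atTop_nhds_zero_nat (𝕜 := ℝ)).const_mul (r/2)
        have h2 := (Complex.continuous_ofReal.tendsto 0).comp h1
        simpa [hu] using h2.const_add t0
      · simp only [hu, Set.mem_compl_iff, Set.mem_singleton_iff]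
        intro h
        have : ((r / 2 * (1 / ((n:ℝ) + 1)) : ℝ) : ℂ) = 0 := by linear_combination h
        exact (hpos n).ne' (Complex.ofReal_eq_zero.1 this)
    refine aestronglyMeasurable_of_tendsto_ae Filter.atTop
      (f := fun (n : ℕ) (y : ℝ) => (u n - t0)⁻¹ * (F (u n) y - F t0 y)) ?_ ?_
    · intro n
      exact ((hm _ (hub n)).sub (hm _ ht0)).const_mul _
    · refine Filter.Eventually.of_forall fun y => ?_
      have h3 := (hasDerivAt_iff_tendsto_slope.1 (hd y t0 ht0).hasDerivAt).comp hut
      refine h3.congr fun n => ?_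
      simp [slope_def_field, div_eq_mul_inv, mul_comm]
  have key := hasDerivAt_integral_of_dominated_loc_of_deriv_le (𝕜 := ℂ) (μ := volume) (F := F)
    (F' := fun t y => deriv (fun t => F t y) t) (x₀ := t0) (s := Metric.ball t0 (r/2))
    (bound := fun y => C * Real.exp (-|y|/2) / (r/4))
    (Metric.ball_mem_nhds t0 (by linarith))
    (Filter.eventually_of_mem (Metric.ball_mem_nhds t0 hr) hm) hInt hmeas
    (Filter.Eventually.of_forall fun y t ht => by
      have hsub : ∀ z ∈ Metric.closedBall t (r/4), z ∈ Metric.ball t0 r := by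
        intro z hz
        rw [Metric.mem_closedBall] at hz
        rw [Metric.mem_ball] at ht ⊢
        linarith [dist_triangle z t t0]
      refine Complex.norm_deriv_le_of_forall_mem_sphere_norm_le (by linarith) ?_ ?_
      · refine DifferentiableOn.diffContOnCl fun z hz => ?_
        rw [closure_ball _ (by linarith : r/4 ≠ 0)] at hz
        exact (hd y z (hsub z hz)).differentiableWithinAt
      · intro z hz
        exact hb z (hsub z (Metric.sphere_subset_closedBall hz)) y)
    ((exp_abs_int.const_mul C).div_const _)
    (Filter.Eventually.of_forall fun y t ht => by
      refine (hd y t ?_).hasDerivAt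
      rw [Metric.mem_ball] at ht ⊢
      linarith)
  exact key.2.differentiableAt

/-! ### Growth calculus -/

/-- `f` is bounded by `exp w` up to subexponential factors on the region. -/
def SE (a b c1 c2 : ℝ) (w : ℂ → ℂ → ℝ) (f : ℂ → ℂ → ℂ) : Prop :=
  ∀ ε : ℝ, 0 < ε → ∃ C : ℝ, 0 ≤ C ∧ ∀ s t : ℂ, c1 ≤ s.re → s.re ≤ c2 → a ≤ t.re → t.re ≤ b →
    ‖f s t‖ ≤ C * Real.exp (ε * (|s.im| + |t.im|) + w s t)

theorem SE.mul {a b c1 c2 : ℝ} {w1 w2 : ℂ → ℂ → ℝ} {f g : ℂ → ℂ → ℂ}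
    (hf : SE a b c1 c2 w1 f) (hg : SE a b c1 c2 w2 g) :
    SE a b c1 c2 (fun s t => w1 s t + w2 s t) (fun s t => f s t * g s t) := by
  intro ε hε
  obtain ⟨C, hC, h⟩ := hf (ε/2) (half_pos hε)
  obtain ⟨D, hD, k⟩ := hg (ε/2) (half_pos hε)
  refine ⟨C * D, by positivity, fun s t h1 h2 h3 h4 => ?_⟩
  rw [norm_mul]
  calc _ ≤ (C * Real.exp (ε/2 * (|s.im| + |t.im|) + w1 s t)) *
      (D * Real.exp (ε/2 * (|s.im| + |t.im|) + w2 s t)) :=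
        mul_le_mul (h s t h1 h2 h3 h4) (k s t h1 h2 h3 h4) (norm_nonneg _) (by positivity)
    _ = C * D * (Real.exp (ε/2 * (|s.im| + |t.im|) + w1 s t) *
          Real.exp (ε/2 * (|s.im| + |t.im|) + w2 s t)) := by ring
    _ = _ := by rw [← Real.exp_add]; congr 2; ring

theorem SE.add {a b c1 c2 : ℝ} {w : ℂ → ℂ → ℝ} {f g : ℂ → ℂ → ℂ}
    (hf : SE a b c1 c2 w f) (hg : SE a b c1 c2 w g) :
    SE a b c1 c2 w (fun s t => f s t + g s t) := by
  intro ε hε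
  obtain ⟨C, hC, h⟩ := hf ε hε
  obtain ⟨D, hD, k⟩ := hg ε hε
  refine ⟨C + D, by positivity, fun s t h1 h2 h3 h4 => ?_⟩
  rw [add_mul]
  exact (norm_add_le _ _).trans (add_le_add (h s t h1 h2 h3 h4) (k s t h1 h2 h3 h4))

theorem SE.const {a b c1 c2 : ℝ} (z : ℂ) : SE a b c1 c2 (fun _ _ => 0) (fun _ _ => z) := by
  intro ε hε
  refine ⟨‖z‖, norm_nonneg _, fun s t _ _ _ _ => ?_⟩
  have : 1 ≤ Real.exp (ε * (|s.im| + |t.im|) + 0) := Real.one_le_exp (by positivity)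
  nlinarith [norm_nonneg z]

theorem SE.fst {a b c1 c2 : ℝ} : SE a b c1 c2 (fun _ _ => 0) (fun s _ => s) := by
  intro ε hε
  refine ⟨max |c1| |c2| + ε⁻¹, by positivity, fun s t h1 h2 _ _ => ?_⟩
  have := norm_le_exp (M := max |c1| |c2|) hε (z := s) (abs_le_max_abs_abs h1 h2)
  refine this.trans ?_
  gcongr
  have := mul_nonneg hε.le (abs_nonneg t.im)
  nlinarith

theorem SE.snd {a b c1 c2 : ℝ} : SE a b c1 c2 (fun _ _ => 0) (fun _ t => t) := by
  intro ε hε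
  refine ⟨max |a| |b| + ε⁻¹, by positivity, fun s t _ _ h1 h2 => ?_⟩
  have := norm_le_exp (M := max |a| |b|) hε (z := t) (abs_le_max_abs_abs h1 h2)
  refine this.trans ?_
  gcongr
  have := mul_nonneg hε.le (abs_nonneg s.im)
  nlinarith

theorem SE.mul0 {a b c1 c2 : ℝ} {f g : ℂ → ℂ → ℂ}
    (hf : SE a b c1 c2 (fun _ _ => 0) f) (hg : SE a b c1 c2 (fun _ _ => 0) g) :
    SE a b c1 c2 (fun _ _ => 0) (fun s t => f s t * g s t) := by
  have := hf.mul hg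
  simpa using this

theorem SE.gamma {a b c1 c2 lo hi : ℝ} {z : ℂ → ℂ → ℂ} (hlo : 0 < lo)
    (hz : ∀ s t : ℂ, c1 ≤ s.re → s.re ≤ c2 → a ≤ t.re → t.re ≤ b →
      lo ≤ (z s t).re ∧ (z s t).re ≤ hi)
    (him : ∀ s t : ℂ, |(z s t).im| ≤ 2 * (|s.im| + |t.im|)) :
    SE a b c1 c2 (fun s t => -(π/2) * |(z s t).im|) (fun s t => Complex.Gamma (z s t)) := by
  intro ε hε
  obtain ⟨C, hC, h⟩ := gamma_upper (a := lo) (b := hi) hlo (half_pos hε)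
  refine ⟨C, hC, fun s t h1 h2 h3 h4 => ?_⟩
  obtain ⟨k1, k2⟩ := hz s t h1 h2 h3 h4
  refine (h _ k1 k2).trans ?_
  gcongr
  have := mul_le_mul_of_nonneg_left (him s t) (half_pos hε).le
  linarith

theorem SE.gammaInv {a b c1 c2 lo hi : ℝ} {z : ℂ → ℂ → ℂ} (hlo : 0 < lo)
    (hz : ∀ s t : ℂ, c1 ≤ s.re → s.re ≤ c2 → a ≤ t.re → t.re ≤ b →
      lo ≤ (z s t).re ∧ (z s t).re ≤ hi)
    (him : ∀ s t : ℂ, |(z s t).im| ≤ 2 * (|s.im| + |t.im|)) :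
    SE a b c1 c2 (fun s t => (π/2) * |(z s t).im|) (fun s t => (Complex.Gamma (z s t))⁻¹) := by
  intro ε hε
  obtain ⟨C, hC, h⟩ := gamma_inv_upper (a := lo) (b := hi) hlo (half_pos hε)
  refine ⟨C, hC, fun s t h1 h2 h3 h4 => ?_⟩
  obtain ⟨k1, k2⟩ := hz s t h1 h2 h3 h4
  refine (h _ k1 k2).trans ?_
  refine mul_le_mul_of_nonneg_left (Real.exp_le_exp.2 ?_) hC
  have := mul_le_mul_of_nonneg_left (him s t) (half_pos hε).le
  linarith

theorem SE.final {a b c1 c2 : ℝ} {w : ℂ → ℂ → ℝ} {f : ℂ → ℂ → ℂ} (hf : SE a b c1 c2 w f)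
    (hw : ∀ s t, w s t ≤ -(π/4) * |s.im| + (π/2) * |t.im|) :
    ∃ C : ℝ, 0 ≤ C ∧ ∀ s t : ℂ, c1 ≤ s.re → s.re ≤ c2 → a ≤ t.re → t.re ≤ b →
      ‖f s t‖ ≤ C * Real.exp (2 * |t.im|) * Real.exp (-|s.im|/2) := by
  obtain ⟨C, hC, h⟩ := hf (1/10) (by norm_num)
  refine ⟨C, hC, fun s t h1 h2 h3 h4 => (h s t h1 h2 h3 h4).trans ?_⟩
  rw [mul_assoc, ← Real.exp_add]
  refine mul_le_mul_of_nonneg_left (Real.exp_le_exp.2 ?_) hC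
  have := hw s t
  have p1 := Real.pi_gt_three
  have p2 := Real.pi_lt_d2
  nlinarith [abs_nonneg s.im, abs_nonneg t.im]

/-- `16 ^ z`. -/
noncomputable def e16 (z : ℂ) : ℂ := Complex.exp ((Real.log 16 : ℝ) * z)

theorem e16_add_one (z : ℂ) : e16 (z + 1) = 16 * e16 z := by
  rw [e16, mul_add, Complex.exp_add, mul_one, ← Complex.ofReal_exp, Real.exp_log (by norm_num),
    e16]
  push_cast; ring

theorem SE.pow16 {a b c1 c2 : ℝ} : SE a b c1 c2 (fun _ _ => 0) (fun s t => e16 (s + t)) := by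
  intro ε hε
  refine ⟨Real.exp (Real.log 16 * (c2 + b)), by positivity, fun s t h1 h2 h3 h4 => ?_⟩
  have : 1 ≤ Real.exp (ε * (|s.im| + |t.im|) + 0) := Real.one_le_exp (by positivity)
  show ‖e16 (s + t)‖ ≤ _
  rw [e16, Complex.norm_exp]
  have hl : 0 < Real.log 16 := Real.log_pos (by norm_num)
  have e : (((Real.log 16 : ℝ) : ℂ) * (s + t)).re = Real.log 16 * (s.re + t.re) := by
    simp only [Complex.re_ofReal_mul, Complex.add_re]
  rw [e]
  have : Real.exp (Real.log 16 * (s.re + t.re)) ≤ Real.exp (Real.log 16 * (c2 + b)) := by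
    gcongr
  nlinarith [Real.exp_pos (Real.log 16 * (c2 + b))]

/-- Common Gamma factor. -/
noncomputable def Acore (s t : ℂ) : ℂ :=
  e16 (s + t) * Complex.Gamma (1/2 + s) * Complex.Gamma (1/2 + 2*t + s) *
    Complex.Gamma (1/3 + t + s) * Complex.Gamma (2/3 + t + s) * (Complex.Gamma (1 + t + s))⁻¹

noncomputable def Mk (m r : ℝ) (s t : ℂ) : ℂ :=
  Acore s t * Complex.Gamma (m - s) * (Complex.Gamma (r + t + 2*s))⁻¹ *
    ((Complex.Gamma (4/3 + t))⁻¹ * (Complex.Gamma (5/3 + t))⁻¹)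

noncomputable def Ppol (s t : ℂ) : ℂ := (15*s + 4) * (2*s + 1) + t * (33*s + 16)

noncomputable def Qpol (s t : ℂ) : ℂ := 24 * (s*s) + (28 + 84 * t) * s + (6 + 41 * t + 63 * (t * t))

noncomputable def kH (s t : ℂ) : ℂ := Mk 1 2 s t * (Ppol s t * ((1/3 + t) * (2/3 + t)))

noncomputable def kG (s t : ℂ) : ℂ := Mk 2 1 s t * Qpol s t

theorem phi_ineq (y u : ℝ) :
    (|y| - 2 * |u|) / 2 ≤ |y| + |2*u + y| + |u + y| + |u + y| + |y| - |u + y| - |u + 2*y| - |u| - |u| := by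
  rcases abs_cases y with ⟨h1, _⟩ | ⟨h1, _⟩ <;> rcases abs_cases u with ⟨h2, _⟩ | ⟨h2, _⟩ <;>
  rcases abs_cases (2*u+y) with ⟨h3, _⟩ | ⟨h3, _⟩ <;> rcases abs_cases (u+y) with ⟨h4, _⟩ | ⟨h4, _⟩ <;>
  rcases abs_cases (u+2*y) with ⟨h5, _⟩ | ⟨h5, _⟩ <;> rw [h1, h2, h3, h4, h5] <;> linarith

theorem Mk_SE {m r a b c1 c2 : ℝ} (k1 : 0 < 1/2 + c1) (k2 : 0 < 1/2 + 2*a + c1)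
    (k3 : 0 < 1/3 + a + c1) (k4 : 0 < m - c2) (k5 : 0 < r + a + 2*c1) (k6 : 0 < 4/3 + a)
    {f : ℂ → ℂ → ℂ} (hf : SE a b c1 c2 (fun _ _ => 0) f) :
    ∃ C : ℝ, 0 ≤ C ∧ ∀ s t : ℂ, c1 ≤ s.re → s.re ≤ c2 → a ≤ t.re → t.re ≤ b →
      ‖Mk m r s t * f s t‖ ≤ C * Real.exp (2 * |t.im|) * Real.exp (-|s.im|/2) := by
  have A1 : SE a b c1 c2 _ _ := SE.gamma (z := fun s t => 1/2 + s) (lo := 1/2 + c1) (hi := 1/2 + c2) k1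
    (by intro s t h1 h2 h3 h4; constructor <;> simp <;> linarith)
    (by intro s t; simp; linarith [abs_nonneg s.im, abs_nonneg t.im])
  have A2 : SE a b c1 c2 _ _ := SE.gamma (z := fun s t => 1/2 + 2*t + s) (lo := 1/2 + 2*a + c1)
    (hi := 1/2 + 2*b + c2) k2
    (by intro s t h1 h2 h3 h4; constructor <;> simp <;> linarith)
    (by intro s t; simp; have := abs_add_le (2 * t.im) s.im; rw [abs_mul, abs_two] at this; linarith [abs_nonneg s.im, abs_nonneg t.im])
  have A3 : SE a b c1 c2 _ _ := SE.gamma (z := fun s t => 1/3 + t + s) (lo := 1/3 + a + c1)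
    (hi := 1/3 + b + c2) k3
    (by intro s t h1 h2 h3 h4; constructor <;> norm_num <;> linarith)
    (by intro s t; norm_num; have := abs_add_le (t.im) s.im; linarith [abs_nonneg s.im, abs_nonneg t.im])
  have A4 : SE a b c1 c2 _ _ := SE.gamma (z := fun s t => 2/3 + t + s) (lo := 1/3 + a + c1)
    (hi := 2/3 + b + c2) k3
    (by intro s t h1 h2 h3 h4; constructor <;> norm_num <;> linarith)
    (by intro s t; norm_num; have := abs_add_le (t.im) s.im; linarith [abs_nonneg s.im, abs_nonneg t.im])
  have A5 : SE a b c1 c2 _ _ := SE.gammaInv (z := fun s t => 1 + t + s) (lo := 1/3 + a + c1)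
    (hi := 1 + b + c2) k3
    (by intro s t h1 h2 h3 h4; constructor <;> norm_num <;> linarith)
    (by intro s t; norm_num; have := abs_add_le (t.im) s.im; linarith [abs_nonneg s.im, abs_nonneg t.im])
  have A6 : SE a b c1 c2 _ _ := SE.gamma (z := fun s t => m - s) (lo := m - c2)
    (hi := m - c1) k4
    (by intro s t h1 h2 h3 h4; constructor <;> norm_num <;> linarith)
    (by intro s t; norm_num; linarith [abs_nonneg s.im, abs_nonneg t.im])
  have A7 : SE a b c1 c2 _ _ := SE.gammaInv (z := fun s t => r + t + 2*s) (lo := r + a + 2*c1)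
    (hi := r + b + 2*c2) k5
    (by intro s t h1 h2 h3 h4; constructor <;> norm_num <;> linarith)
    (by intro s t; norm_num; have := abs_add_le (t.im) (2*s.im); rw [abs_mul, abs_two] at this; linarith [abs_nonneg s.im, abs_nonneg t.im])
  have A8 : SE a b c1 c2 _ _ := SE.gammaInv (z := fun s t => 4/3 + t) (lo := 4/3 + a)
    (hi := 4/3 + b) k6
    (by intro s t h1 h2 h3 h4; constructor <;> norm_num <;> linarith)
    (by intro s t; norm_num; linarith [abs_nonneg s.im, abs_nonneg t.im])
  have A9 : SE a b c1 c2 _ _ := SE.gammaInv (z := fun s t => 5/3 + t) (lo := 4/3 + a)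
    (hi := 5/3 + b) k6
    (by intro s t h1 h2 h3 h4; constructor <;> norm_num <;> linarith)
    (by intro s t; norm_num; linarith [abs_nonneg s.im, abs_nonneg t.im])
  have A0 : SE a b c1 c2 _ _ := SE.pow16
  have T := ((((((((A0.mul A1).mul A2).mul A3).mul A4).mul A5).mul A6).mul A7).mul (A8.mul A9)).mul hf
  refine SE.final T ?_
  intro s t
  norm_num
  have := phi_ineq s.im t.im
  have := mul_le_mul_of_nonneg_left this (half_pos Real.pi_pos).le
  linarith

theorem Ppol_SE {a b c1 c2 : ℝ} : SE a b c1 c2 (fun _ _ => 0)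
    (fun s t => Ppol s t * ((1/3 + t) * (2/3 + t))) := by
  unfold Ppol
  exact SE.mul0 (SE.add (SE.mul0 (SE.add (SE.mul0 (SE.const 15) SE.fst) (SE.const 4))
    (SE.add (SE.mul0 (SE.const 2) SE.fst) (SE.const 1)))
    (SE.mul0 SE.snd (SE.add (SE.mul0 (SE.const 33) SE.fst) (SE.const 16))))
    (SE.mul0 (SE.add (SE.const _) SE.snd) (SE.add (SE.const _) SE.snd))

theorem Qpol_SE {a b c1 c2 : ℝ} : SE a b c1 c2 (fun _ _ => 0) Qpol := by
  show SE a b c1 c2 (fun _ _ => 0) (fun s t => Qpol s t)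
  unfold Qpol
  exact SE.add (SE.add (SE.mul0 (SE.const 24) (SE.mul0 SE.fst SE.fst))
    (SE.mul0 (SE.add (SE.const 28) (SE.mul0 (SE.const 84) SE.snd)) SE.fst))
    (SE.add (SE.add (SE.const 6) (SE.mul0 (SE.const 41) SE.snd))
      (SE.mul0 (SE.const 63) (SE.mul0 SE.snd SE.snd)))

/-! ### Differentiability -/

theorem dG {f : ℂ → ℂ} {x : ℂ} (hf : DifferentiableAt ℂ f x) (h : 0 < (f x).re) :
    DifferentiableAt ℂ (fun x => Complex.Gamma (f x)) x := by
  refine DifferentiableAt.comp x (Complex.differentiableAt_Gamma _ fun m hm => ?_) hf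
  rw [hm] at h
  have : (0:ℝ) ≤ m := Nat.cast_nonneg m
  simp at h; linarith

theorem dGi {f : ℂ → ℂ} {x : ℂ} (hf : DifferentiableAt ℂ f x) :
    DifferentiableAt ℂ (fun x => (Complex.Gamma (f x))⁻¹) x :=
  DifferentiableAt.comp (g := fun z => (Complex.Gamma z)⁻¹) x
    (Complex.differentiable_one_div_Gamma _) hf

theorem Mk_diff_s {m r : ℝ} {s t : ℂ} (k1 : 0 < 1/2 + s.re) (k2 : 0 < 1/2 + 2*t.re + s.re)
    (k3 : 0 < 1/3 + t.re + s.re) (k4 : 0 < m - s.re) :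
    DifferentiableAt ℂ (fun s => Mk m r s t) s := by
  unfold Mk Acore e16
  refine DifferentiableAt.mul (DifferentiableAt.mul (DifferentiableAt.mul (DifferentiableAt.mul
    (DifferentiableAt.mul (DifferentiableAt.mul (DifferentiableAt.mul (DifferentiableAt.mul
    (by fun_prop) (dG (by fun_prop) ?_)) (dG (by fun_prop) ?_)) (dG (by fun_prop) ?_))
    (dG (by fun_prop) ?_)) (dGi (by fun_prop))) (dG (by fun_prop) ?_)) (dGi (by fun_prop)))
    (by fun_prop)
  all_goals norm_num
  all_goals linarith

theorem Mk_diff_t {m r : ℝ} {s t : ℂ} (k2 : 0 < 1/2 + 2*t.re + s.re)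
    (k3 : 0 < 1/3 + t.re + s.re) :
    DifferentiableAt ℂ (fun t => Mk m r s t) t := by
  unfold Mk Acore e16
  refine DifferentiableAt.mul (DifferentiableAt.mul (DifferentiableAt.mul (DifferentiableAt.mul
    (DifferentiableAt.mul (DifferentiableAt.mul (DifferentiableAt.mul (DifferentiableAt.mul
    (by fun_prop) (by fun_prop)) (dG (by fun_prop) ?_)) (dG (by fun_prop) ?_))
    (dG (by fun_prop) ?_)) (dGi (by fun_prop))) (by fun_prop)) (dGi (by fun_prop)))
    (DifferentiableAt.mul (dGi (by fun_prop)) (dGi (by fun_prop)))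
  all_goals norm_num
  all_goals linarith

theorem kH_diff_s {s t : ℂ} (k1 : 0 < 1/2 + s.re) (k2 : 0 < 1/2 + 2*t.re + s.re)
    (k3 : 0 < 1/3 + t.re + s.re) (k4 : 0 < 1 - s.re) :
    DifferentiableAt ℂ (fun s => kH s t) s := by
  unfold kH Ppol
  exact (Mk_diff_s k1 k2 k3 k4).mul (by fun_prop)

theorem kG_diff_s {s t : ℂ} (k1 : 0 < 1/2 + s.re) (k2 : 0 < 1/2 + 2*t.re + s.re)
    (k3 : 0 < 1/3 + t.re + s.re) (k4 : 0 < 2 - s.re) :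
    DifferentiableAt ℂ (fun s => kG s t) s := by
  unfold kG Qpol
  exact (Mk_diff_s k1 k2 k3 k4).mul (by fun_prop)

theorem kH_diff_t {s t : ℂ} (k2 : 0 < 1/2 + 2*t.re + s.re)
    (k3 : 0 < 1/3 + t.re + s.re) :
    DifferentiableAt ℂ (fun t => kH s t) t := by
  unfold kH Ppol
  exact (Mk_diff_t k2 k3).mul (by fun_prop)

theorem ne_of_re_pos {z : ℂ} (h : 0 < z.re) : z ≠ 0 := by
  rintro rfl; simp at h

theorem Gs {z w : ℂ} (h : z ≠ 0) (hw : w = z + 1) : Complex.Gamma w = z * Complex.Gamma z := by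
  rw [hw, Complex.Gamma_add_one _ h]

set_option maxHeartbeats 2000000 in
theorem WZ {s t : ℂ} (hs : s.re = 1/2) (ht : -1/2 < t.re) :
    -(kH s (t+1) - kH s t) / s = -kG (s+1) t / s + kG s t / (s - 1) := by
  have n1 : (1/2 + s) ≠ 0 := ne_of_re_pos (by norm_num; linarith)
  have n2 : (1/2 + 2*t + s) ≠ 0 := ne_of_re_pos (by norm_num; linarith)
  have n2' : (3/2 + 2*t + s) ≠ 0 := ne_of_re_pos (by norm_num; linarith)
  have n3 : (1/3 + t + s) ≠ 0 := ne_of_re_pos (by norm_num; linarith)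
  have n4 : (2/3 + t + s) ≠ 0 := ne_of_re_pos (by norm_num; linarith)
  have n5 : (1 + t + s) ≠ 0 := ne_of_re_pos (by norm_num; linarith)
  have n6 : (1 - s) ≠ 0 := ne_of_re_pos (by norm_num; linarith)
  have n7 : (1 + t + 2*s) ≠ 0 := ne_of_re_pos (by norm_num; linarith)
  have n7' : (2 + t + 2*s) ≠ 0 := ne_of_re_pos (by norm_num; linarith)
  have n8 : (4/3 + t) ≠ 0 := ne_of_re_pos (by norm_num; linarith)
  have n9 : (5/3 + t) ≠ 0 := ne_of_re_pos (by norm_num; linarith)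
  have n0 : s ≠ 0 := ne_of_re_pos (by norm_num; linarith)
  have n6' : s - 1 ≠ 0 := by intro h; apply n6; linear_combination -h
  have d7 : Complex.Gamma (2 + t + 2*s) = (1 + t + 2*s) * Complex.Gamma (1 + t + 2*s) :=
    Gs n7 (by ring)
  have d7' : Complex.Gamma (3 + t + 2*s) = (2 + t + 2*s) * ((1 + t + 2*s) * Complex.Gamma (1 + t + 2*s)) := by
    rw [← d7]; exact Gs n7' (by ring)
  have d2 : Complex.Gamma (3/2 + 2*t + s) = (1/2 + 2*t + s) * Complex.Gamma (1/2 + 2*t + s) :=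
    Gs n2 (by ring)
  have e1 : Mk 1 2 s (t+1) = 16 * e16 (s+t) * Complex.Gamma (1/2 + s) *
     ((3/2 + 2*t + s) * ((1/2 + 2*t + s) * Complex.Gamma (1/2 + 2*t + s))) *
     ((1/3 + t + s) * Complex.Gamma (1/3 + t + s)) * ((2/3 + t + s) * Complex.Gamma (2/3 + t + s)) *
     ((1 + t + s) * Complex.Gamma (1 + t + s))⁻¹ * Complex.Gamma (1 - s) *
     ((2 + t + 2*s) * ((1 + t + 2*s) * Complex.Gamma (1 + t + 2*s)))⁻¹ *
     (((4/3 + t) * Complex.Gamma (4/3 + t))⁻¹ * ((5/3 + t) * Complex.Gamma (5/3 + t))⁻¹) := by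
    rw [Mk, Acore, show s + (t+1) = s + t + 1 by ring, e16_add_one,
      ← d2, ← Gs n2' (w := 1/2 + 2*(t+1) + s) (by ring),
      ← Gs n3 (w := 1/3 + (t+1) + s) (by ring), ← Gs n4 (w := 2/3 + (t+1) + s) (by ring),
      ← Gs n5 (w := 1 + (t+1) + s) (by ring), ← d7', ← Gs n8 (w := 4/3 + (t+1)) (by ring),
      ← Gs n9 (w := 5/3 + (t+1)) (by ring)]
    rw [show ((2:ℝ):ℂ) + (t+1) + 2*s = 3 + t + 2*s by push_cast; ring]
    push_cast; ring
  have e2 : Mk 1 2 s t = e16 (s+t) * Complex.Gamma (1/2 + s) *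
     Complex.Gamma (1/2 + 2*t + s) *
     (Complex.Gamma (1/3 + t + s)) * (Complex.Gamma (2/3 + t + s)) *
     (Complex.Gamma (1 + t + s))⁻¹ * Complex.Gamma (1 - s) *
     ((1 + t + 2*s) * Complex.Gamma (1 + t + 2*s))⁻¹ *
     ((Complex.Gamma (4/3 + t))⁻¹ * (Complex.Gamma (5/3 + t))⁻¹) := by
    rw [Mk, Acore, ← d7]; push_cast; ring
  have e3 : Mk 2 1 s t = e16 (s+t) * Complex.Gamma (1/2 + s) *
     Complex.Gamma (1/2 + 2*t + s) *
     (Complex.Gamma (1/3 + t + s)) * (Complex.Gamma (2/3 + t + s)) *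
     (Complex.Gamma (1 + t + s))⁻¹ * ((1 - s) * Complex.Gamma (1 - s)) *
     (Complex.Gamma (1 + t + 2*s))⁻¹ *
     ((Complex.Gamma (4/3 + t))⁻¹ * (Complex.Gamma (5/3 + t))⁻¹) := by
    rw [Mk, Acore, ← Gs n6 (w := 2 - s) (by ring)]; push_cast; ring
  have e4 : Mk 2 1 (s+1) t = 16 * e16 (s+t) * ((1/2 + s) * Complex.Gamma (1/2 + s)) *
     ((1/2 + 2*t + s) * Complex.Gamma (1/2 + 2*t + s)) *
     ((1/3 + t + s) * Complex.Gamma (1/3 + t + s)) * ((2/3 + t + s) * Complex.Gamma (2/3 + t + s)) *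
     ((1 + t + s) * Complex.Gamma (1 + t + s))⁻¹ * Complex.Gamma (1 - s) *
     ((2 + t + 2*s) * ((1 + t + 2*s) * Complex.Gamma (1 + t + 2*s)))⁻¹ *
     ((Complex.Gamma (4/3 + t))⁻¹ * (Complex.Gamma (5/3 + t))⁻¹) := by
    rw [Mk, Acore, show s + 1 + t = s + t + 1 by ring, e16_add_one, ← Gs n1 (w := 1/2 + (s+1)) (by ring),
      ← Gs n2 (w := 1/2 + 2*t + (s+1)) (by ring),
      ← Gs n3 (w := 1/3 + t + (s+1)) (by ring), ← Gs n4 (w := 2/3 + t + (s+1)) (by ring),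
      ← Gs n5 (w := 1 + t + (s+1)) (by ring), ← d7']
    rw [show ((1:ℝ):ℂ) + t + 2*(s+1) = 3 + t + 2*s by push_cast; ring,
      show ((2:ℝ):ℂ) - (s+1) = 1 - s by push_cast; ring]
  rw [kH, kH, kG, kG, e1, e2, e3, e4, Ppol, Ppol, Qpol, Qpol]
  simp only [mul_inv]
  generalize e16 (s+t) = e
  generalize Complex.Gamma (1/2 + s) = g1
  generalize Complex.Gamma (1/2 + 2*t + s) = g2
  generalize Complex.Gamma (1/3 + t + s) = g3
  generalize Complex.Gamma (2/3 + t + s) = g4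
  generalize (Complex.Gamma (1 + t + s))⁻¹ = g5
  generalize Complex.Gamma (1 - s) = g6
  generalize (Complex.Gamma (1 + t + 2*s))⁻¹ = g7
  generalize (Complex.Gamma (4/3 + t))⁻¹ = g8
  generalize (Complex.Gamma (5/3 + t))⁻¹ = g9
  rw [show s - 1 = -(1 - s) by ring] at *
  have hh : (1 + t + s) * (1+t+s)⁻¹ = 1 := mul_inv_cancel₀ n5
  have q8 : 4 + 3*t ≠ 0 := by intro h; apply n8; linear_combination h/3
  have q9 : 5 + 3*t ≠ 0 := by intro h; apply n9; linear_combination h/3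
  rw [show 4/3 + t = (4+3*t)/3 by ring, show 5/3 + t = (5+3*t)/3 by ring]
  field_simp
  ring

/-! ### The contour integral as a function of the parameter -/

noncomputable def resF (t : ℂ) : ℂ :=
  8 * e16 t * Complex.Gamma (1/2) * Complex.Gamma (3/2 + 2*t) * (Complex.Gamma (2 + t))⁻¹ *
    (Complex.Gamma (1 + t))⁻¹

noncomputable def I0 (t : ℂ) : ℂ :=
  ∫ y : ℝ, kH (((1/2:ℝ):ℂ) + y * Complex.I) t / (((1/2:ℝ):ℂ) + y * Complex.I - ((0:ℝ):ℂ))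

theorem kH_bound {a b c1 c2 : ℝ} (k1 : 0 < 1/2 + c1) (k2 : 0 < 1/2 + 2*a + c1)
    (k3 : 0 < 1/3 + a + c1) (k4 : 0 < 1 - c2) (k5 : 0 < 2 + a + 2*c1) (k6 : 0 < 4/3 + a) :
    ∃ C : ℝ, 0 ≤ C ∧ ∀ s t : ℂ, c1 ≤ s.re → s.re ≤ c2 → a ≤ t.re → t.re ≤ b →
      ‖kH s t‖ ≤ C * Real.exp (2 * |t.im|) * Real.exp (-|s.im|/2) :=
  Mk_SE k1 k2 k3 k4 k5 k6 Ppol_SE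

theorem kG_bound {a b c1 c2 : ℝ} (k1 : 0 < 1/2 + c1) (k2 : 0 < 1/2 + 2*a + c1)
    (k3 : 0 < 1/3 + a + c1) (k4 : 0 < 2 - c2) (k5 : 0 < 1 + a + 2*c1) (k6 : 0 < 4/3 + a) :
    ∃ C : ℝ, 0 ≤ C ∧ ∀ s t : ℂ, c1 ≤ s.re → s.re ≤ c2 → a ≤ t.re → t.re ≤ b →
      ‖kG s t‖ ≤ C * Real.exp (2 * |t.im|) * Real.exp (-|s.im|/2) :=
  Mk_SE k1 k2 k3 k4 k5 k6 Qpol_SE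

theorem half_re (y : ℝ) : (((1/2:ℝ):ℂ) + y * Complex.I).re = 1/2 := by simp

theorem half_im (y : ℝ) : (((1/2:ℝ):ℂ) + y * Complex.I).im = y := by simp

theorem half_norm (y : ℝ) : 1/2 ≤ ‖((1/2:ℝ):ℂ) + y * Complex.I - ((0:ℝ):ℂ)‖ := by
  have := Complex.abs_re_le_norm (((1/2:ℝ):ℂ) + y * Complex.I - ((0:ℝ):ℂ))
  have e : (((1/2:ℝ):ℂ) + y * Complex.I - ((0:ℝ):ℂ)).re = 1/2 := by simp
  rw [e, abs_of_pos (by norm_num)] at this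
  exact this

theorem div_half_norm {z : ℂ} {B : ℝ} (y : ℝ) (h : ‖z‖ ≤ B) :
    ‖z / (((1/2:ℝ):ℂ) + y * Complex.I - ((0:ℝ):ℂ))‖ ≤ 2 * B := by
  have := half_norm y
  have hp : 0 < ‖((1/2:ℝ):ℂ) + y * Complex.I - ((0:ℝ):ℂ)‖ := by linarith
  rw [norm_div, div_le_iff₀ hp]
  have : 0 ≤ B := (norm_nonneg z).trans h
  nlinarith

theorem kH_line_int {t : ℂ} (ht : -1/2 < t.re) :
    Integrable (fun y : ℝ => kH (((1/2:ℝ):ℂ) + y * Complex.I) t /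
      (((1/2:ℝ):ℂ) + y * Complex.I - ((0:ℝ):ℂ))) := by
  obtain ⟨C, hC, h⟩ := kH_bound (a := t.re) (b := t.re) (c1 := 1/2) (c2 := 1/2) (by norm_num)
    (by linarith) (by linarith) (by linarith) (by linarith) (by linarith)
  refine line_int (k := fun s => kH s t) (C := C * Real.exp (2 * |t.im|)) (by norm_num) ?_ ?_
  · intro s hs
    exact kH_diff_s (by linarith) (by linarith) (by linarith) (by linarith)
  · intro s hs
    exact h s t hs.ge hs.le le_rfl le_rfl

theorem I0_diff {t0 : ℂ} (ht : -1/2 < t0.re) : DifferentiableAt ℂ I0 t0 := by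
  set r : ℝ := (t0.re + 1/2) / 2 with hr
  have hr0 : 0 < r := by linarith
  obtain ⟨C, hC, h⟩ := kH_bound (a := t0.re - r) (b := t0.re + r) (c1 := 1/2) (c2 := 1/2)
    (by norm_num) (by linarith) (by linarith) (by linarith) (by linarith) (by linarith)
  have hball : ∀ t ∈ Metric.ball t0 r, t0.re - r ≤ t.re ∧ t.re ≤ t0.re + r ∧
      |t.im| ≤ |t0.im| + r := by
    intro t ht
    rw [Metric.mem_ball, dist_eq_norm] at ht
    have h1 := (Complex.abs_re_le_norm (t - t0)).trans ht.le
    have h2 := (Complex.abs_im_le_norm (t - t0)).trans ht.le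
    rw [Complex.sub_re, abs_le] at h1
    rw [Complex.sub_im] at h2
    have := abs_sub_abs_le_abs_sub t.im t0.im
    exact ⟨by linarith, by linarith, by linarith⟩
  refine param_diff (F := fun t y => kH (((1/2:ℝ):ℂ) + y * Complex.I) t /
      (((1/2:ℝ):ℂ) + y * Complex.I - ((0:ℝ):ℂ))) (r := r)
      (C := 2 * (C * Real.exp (2 * (|t0.im| + r)))) hr0 ?_ ?_ ?_
  · intro y t ht
    obtain ⟨h1, h2, h3⟩ := hball t ht
    refine DifferentiableAt.div_const (kH_diff_t ?_ ?_) _ <;> rw [half_re] <;> linarith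
  · intro t ht
    obtain ⟨h1, h2, h3⟩ := hball t ht
    exact (kH_line_int (by linarith)).aestronglyMeasurable
  · intro t ht y
    obtain ⟨h1, h2, h3⟩ := hball t ht
    have := h (((1/2:ℝ):ℂ) + y * Complex.I) t (half_re y).ge (half_re y).le h1 h2
    rw [half_im] at this
    refine (div_half_norm y this).trans ?_
    have : Real.exp (2 * |t.im|) ≤ Real.exp (2 * (|t0.im| + r)) :=
      Real.exp_le_exp.2 (by linarith)
    have := mul_le_mul_of_nonneg_left this hC
    have := mul_le_mul_of_nonneg_right this (Real.exp_pos (-|y|/2)).le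
    linarith

theorem I0_bound : ∃ C : ℝ, ∀ t : ℂ, 0 ≤ t.re → t.re ≤ 1 → ‖I0 t‖ ≤ C * Real.exp (2 * |t.im|) := by
  obtain ⟨C, hC, h⟩ := kH_bound (a := 0) (b := 1) (c1 := 1/2) (c2 := 1/2)
    (by norm_num) (by norm_num) (by norm_num) (by norm_num) (by norm_num) (by norm_num)
  refine ⟨2 * C * ∫ y : ℝ, Real.exp (-|y|/2), fun t h0 h1 => ?_⟩
  have : ‖I0 t‖ ≤ ∫ y : ℝ, (2 * (C * Real.exp (2 * |t.im|))) * Real.exp (-|y|/2) := by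
    refine norm_integral_le_of_norm_le (exp_abs_int.const_mul _) (Filter.Eventually.of_forall ?_)
    intro y
    have := h (((1/2:ℝ):ℂ) + y * Complex.I) t (half_re y).ge (half_re y).le h0 h1
    rw [half_im] at this
    refine (div_half_norm y this).trans (le_of_eq (by ring))
  rw [integral_const_mul] at this
  refine this.trans (le_of_eq (by ring))

theorem resF_diff {t : ℂ} (ht : -1/2 < t.re) : DifferentiableAt ℂ resF t := by
  unfold resF e16
  refine DifferentiableAt.mul (DifferentiableAt.mul (DifferentiableAt.mul (by fun_prop)
    (dG (by fun_prop) ?_)) (dGi (by fun_prop))) (dGi (by fun_prop))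
  norm_num
  linarith

theorem resF_bound : ∃ C : ℝ, ∀ t : ℂ, 0 ≤ t.re → t.re ≤ 1 →
    ‖resF t‖ ≤ C * Real.exp (2 * |t.im|) := by
  have A1 : SE 0 1 0 0 _ _ := SE.gamma (z := fun s t => 3/2 + 2*t) (lo := 3/2)
    (hi := 3/2 + 2) (by norm_num)
    (by intro s t h1 h2 h3 h4; constructor <;> norm_num <;> linarith)
    (by intro s t; norm_num)
  have A2 : SE 0 1 0 0 _ _ := SE.gammaInv (z := fun s t => 2 + t) (lo := 2)
    (hi := 3) (by norm_num)
    (by intro s t h1 h2 h3 h4; constructor <;> norm_num <;> linarith)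
    (by intro s t; norm_num; linarith [abs_nonneg s.im, abs_nonneg t.im])
  have A3 : SE 0 1 0 0 _ _ := SE.gammaInv (z := fun s t => 1 + t) (lo := 1)
    (hi := 2) (by norm_num)
    (by intro s t h1 h2 h3 h4; constructor <;> norm_num <;> linarith)
    (by intro s t; norm_num; linarith [abs_nonneg s.im, abs_nonneg t.im])
  have A0 : SE 0 1 0 0 _ _ := SE.pow16
  have T := (((((SE.const 8).mul A0).mul (SE.const (Complex.Gamma (1/2)))).mul A1).mul A2).mul A3
  obtain ⟨C, hC, h⟩ := T 1 one_pos
  refine ⟨C, fun t h0 h1 => ?_⟩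
  have := h 0 t le_rfl le_rfl h0 h1
  rw [resF]
  simp only [zero_add] at this
  refine this.trans (mul_le_mul_of_nonneg_left (Real.exp_le_exp.2 ?_) hC)
  norm_num
  nlinarith [abs_nonneg t.im, Real.pi_pos]

theorem resF_step {t : ℂ} (ht : -1/2 < t.re) : resF (t+1) - resF t = kG 1 t := by
  have n1 : (1 + t) ≠ 0 := ne_of_re_pos (by norm_num; linarith)
  have n2 : (2 + t) ≠ 0 := ne_of_re_pos (by norm_num; linarith)
  have n3 : (3/2 + 2*t) ≠ 0 := ne_of_re_pos (by norm_num; linarith)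
  have n4 : (5/2 + 2*t) ≠ 0 := ne_of_re_pos (by norm_num; linarith)
  have g1 := Complex.Gamma_ne_zero_of_re_pos (s := 4/3 + t) (by norm_num; linarith)
  have g2 := Complex.Gamma_ne_zero_of_re_pos (s := 5/3 + t) (by norm_num; linarith)
  have d1 : Complex.Gamma (2 + t) = (1 + t) * Complex.Gamma (1 + t) := Gs n1 (by ring)
  have d2 : Complex.Gamma (3 + t) = (2 + t) * ((1 + t) * Complex.Gamma (1 + t)) := by
    rw [← d1]; exact Gs n2 (by ring)
  have d3 : Complex.Gamma (7/2 + 2*t) = (5/2 + 2*t) * ((3/2 + 2*t) * Complex.Gamma (3/2 + 2*t)) := by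
    rw [← Gs n3 (w := 5/2 + 2*t) (by ring)]; exact Gs n4 (by ring)
  have d4 : Complex.Gamma (3/2) = 1/2 * Complex.Gamma (1/2) := Gs (by norm_num) (by norm_num)
  have e1 : resF (t+1) = 8 * (16 * e16 t) * Complex.Gamma (1/2) * ((5/2 + 2*t) * ((3/2 + 2*t) * Complex.Gamma (3/2 + 2*t)))
      * ((2 + t) * ((1 + t) * Complex.Gamma (1 + t)))⁻¹ * ((1 + t) * Complex.Gamma (1 + t))⁻¹ := by
    rw [resF, e16_add_one, ← d3, ← d2, ← d1, show 3/2 + 2*(t+1) = 7/2 + 2*t by ring,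
      show 2 + (t+1) = 3 + t by ring, show 1 + (t+1) = 2 + t by ring]
  have e2 : resF t = 8 * e16 t * Complex.Gamma (1/2) * Complex.Gamma (3/2 + 2*t) *
      ((1 + t) * Complex.Gamma (1 + t))⁻¹ * (Complex.Gamma (1 + t))⁻¹ := by
    rw [resF, ← d1]
  have e3 : kG 1 t = 16 * e16 t * (1/2 * Complex.Gamma (1/2)) * Complex.Gamma (3/2 + 2*t) *
      Complex.Gamma (4/3 + t) * Complex.Gamma (5/3 + t) * ((1 + t) * Complex.Gamma (1 + t))⁻¹ *
      ((2 + t) * ((1 + t) * Complex.Gamma (1 + t)))⁻¹ *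
      ((Complex.Gamma (4/3 + t))⁻¹ * (Complex.Gamma (5/3 + t))⁻¹) * (58 + 125*t + 63*(t*t)) := by
    rw [kG, Mk, Acore, Qpol, ← e16_add_one, ← d2, ← d1, ← d4]
    rw [show ((2:ℝ):ℂ) - 1 = 1 by push_cast; ring, show ((1:ℝ):ℂ) + t + 2*1 = 3 + t by push_cast; ring,
      show 1/2 + (1:ℂ) = 3/2 by norm_num, show 1/2 + 2*t + 1 = 3/2 + 2*t by ring,
      show 1/3 + t + 1 = 4/3 + t by ring, show 2/3 + t + 1 = 5/3 + t by ring,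
      show 1 + t + 1 = 2 + t by ring, show 1 + t = t + 1 by ring, Complex.Gamma_one]
    ring
  rw [e1, e2, e3]
  have g3 := Complex.Gamma_ne_zero_of_re_pos (s := 1 + t) (by norm_num; linarith)
  generalize Complex.Gamma (4/3 + t) = a at *
  generalize Complex.Gamma (5/3 + t) = b at *
  generalize Complex.Gamma (1 + t) = c at *
  generalize Complex.Gamma (3/2 + 2*t) = d
  generalize Complex.Gamma (1/2) = f
  generalize e16 t = e
  clear e1 e2 e3 d1 d2 d3 d4
  field_simp
  ring

theorem I0_step {t : ℂ} (ht : -1/2 < t.re) : I0 (t+1) - I0 t = 2 * π * kG 1 t := by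
  obtain ⟨C, hC, h⟩ := kG_bound (a := t.re) (b := t.re) (c1 := 1/2) (c2 := 3/2) (by norm_num)
    (by linarith) (by linarith) (by linarith) (by linarith) (by linarith)
  have hd : ∀ s : ℂ, 1/2 ≤ s.re → s.re ≤ 3/2 → DifferentiableAt ℂ (fun s => kG s t) s :=
    fun s h1 h2 => kG_diff_s (by linarith) (by linarith) (by linarith) (by linarith)
  have hb : ∀ s : ℂ, 1/2 ≤ s.re → s.re ≤ 3/2 →
      ‖kG s t‖ ≤ (C * Real.exp (2 * |t.im|)) * Real.exp (-|s.im|/2) :=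
    fun s h1 h2 => h s t h1 h2 le_rfl le_rfl
  have R := residue_lemma (c1 := 1/2) (p := 1) (c2 := 3/2) (by norm_num) (by norm_num)
    (by norm_num) (by norm_num) hd hb
  have L1 := line_int (k := fun s => kG s t) (c := 1/2) (p := 1) (by norm_num)
    (fun s hs => hd s hs.ge (by linarith)) (fun s hs => hb s hs.ge (by linarith))
  have L2 := line_int (k := fun s => kG s t) (c := 3/2) (p := 1) (by norm_num)
    (fun s hs => hd s (by linarith) hs.le) (fun s hs => hb s (by linarith) hs.le)
  rw [I0, I0, ← integral_sub (kH_line_int (by simp; linarith)) (kH_line_int ht)]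
  rw [← integral_sub L2 L1] at R
  rw [show kG 1 t = kG ((1:ℝ):ℂ) t by simp]
  rw [← R]
  congr 1
  funext y
  have hw := WZ (half_re y) ht
  have n0 : ((1/2:ℝ):ℂ) + y * Complex.I ≠ 0 := ne_of_re_pos (by rw [half_re]; norm_num)
  have e1 : ((3/2:ℝ):ℂ) + y * Complex.I = ((1/2:ℝ):ℂ) + y * Complex.I + 1 := by push_cast; ring
  rw [e1]
  generalize ((1/2:ℝ):ℂ) + y * Complex.I = s at *
  rw [Complex.ofReal_zero, Complex.ofReal_one, sub_zero, show s + 1 - 1 = s by ring]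
  linear_combination -hw

noncomputable def EF (t : ℂ) : ℂ := 2 * π * resF t - I0 t

theorem kH_third (s : ℂ) : kH s (-1/3) = 0 := by
  rw [kH]
  have : (1/3 + (-1/3) : ℂ) = 0 := by norm_num
  rw [this]; ring

theorem EF_const (n : ℕ) : EF n = 2 * π * resF (-1/3) := by
  obtain ⟨C1, h1⟩ := I0_bound
  obtain ⟨C2, h2⟩ := resF_bound
  have := periodic_const (E := EF) (C := 2 * π * C2 + C1) ?_ ?_ ?_ n
  · rw [this, EF, I0]
    simp [kH_third]
  · intro t ht
    exact ((resF_diff ht).const_mul _).sub (I0_diff ht)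
  · intro t ht
    rw [EF, EF]
    linear_combination (2 * π : ℂ) * resF_step ht - I0_step ht
  · intro t k1 k2
    rw [EF]
    refine (norm_sub_le _ _).trans ?_
    rw [norm_mul, norm_mul, Complex.norm_real, Complex.norm_ofNat, Real.norm_eq_abs,
      abs_of_pos Real.pi_pos]
    have := h1 t k1 k2
    have := mul_le_mul_of_nonneg_left (h2 t k1 k2) Real.two_pi_pos.le
    linarith

/-! ### Evaluation and relation with the integrand -/

theorem resF_third : resF (-1/3) = 3 * ((Real.sqrt 3 : ℝ) : ℂ) := by
  have h1 := Complex.Gamma_mul_Gamma_add_half (1/3)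
  have h2 := Complex.Gamma_mul_Gamma_one_sub (1/3)
  rw [show (1/3 + 1/2 : ℂ) = 5/6 by norm_num, show (2 * (1/3) : ℂ) = 2/3 by norm_num,
    show (1 - 2/3 : ℂ) = 1/3 by norm_num] at h1
  rw [show (1 - 1/3 : ℂ) = 2/3 by norm_num] at h2
  have h3 : Complex.sin (π * (1/3)) = ((Real.sqrt 3 : ℝ) : ℂ) / 2 := by
    rw [show (π * (1/3) : ℂ) = ((π/3 : ℝ) : ℂ) by push_cast; ring, ← Complex.ofReal_sin,
      Real.sin_pi_div_three]
    push_cast; rfl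
  rw [h3] at h2
  have h4 : e16 (-1/3) * (2:ℂ)^(1/3:ℂ) = 1/2 := by
    rw [e16, Complex.cpow_def_of_ne_zero (by norm_num), ← Complex.exp_add]
    have : Real.log 16 = 4 * Real.log 2 := by
      rw [show (16:ℝ) = 2^4 by norm_num, Real.log_pow]; norm_num
    have l2 : Complex.log 2 = ((Real.log 2 : ℝ) : ℂ) := by
      rw [Complex.ofReal_log (by norm_num)]; norm_num
    rw [this, l2]
    have : ((4 * Real.log 2 : ℝ) : ℂ) * (-1/3) + ((Real.log 2 : ℝ) : ℂ) * (1/3) =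
      ((-Real.log 2 : ℝ) : ℂ) := by push_cast; ring
    rw [this, ← Complex.ofReal_exp, Real.exp_neg, Real.exp_log (by norm_num)]
    norm_num
  have h5 : Complex.Gamma (5/3) = 2/3 * Complex.Gamma (2/3) := Gs (by norm_num) (by norm_num)
  have h6 : Complex.Gamma (1/2) = ((Real.sqrt π : ℝ) : ℂ) := by
    have := Complex.Gamma_ofReal (1/2)
    rw [Real.Gamma_one_half_eq] at this
    rw [← this]; norm_num
  have h7 : ((Real.sqrt π : ℝ) : ℂ) * ((Real.sqrt π : ℝ) : ℂ) = (π : ℂ) := by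
    rw [← Complex.ofReal_mul, Real.mul_self_sqrt Real.pi_pos.le]
  have hq8 : ((Real.sqrt 3 : ℝ) : ℂ) * ((Real.sqrt 3 : ℝ) : ℂ) = 3 := by
    rw [← Complex.ofReal_mul, Real.mul_self_sqrt (by norm_num)]; norm_num
  have g1 : Complex.Gamma (1/3) ≠ 0 := Complex.Gamma_ne_zero_of_re_pos (by norm_num)
  have g2 : Complex.Gamma (2/3) ≠ 0 := Complex.Gamma_ne_zero_of_re_pos (by norm_num)
  have hs3 : ((Real.sqrt 3 : ℝ) : ℂ) ≠ 0 := by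
    intro h; rw [h] at hq8; norm_num at hq8
  have hp : (π : ℂ) ≠ 0 := by exact_mod_cast Real.pi_ne_zero
  rw [resF, show (3/2 + 2 * (-1/3) : ℂ) = 5/6 by norm_num, show (2 + -1/3 : ℂ) = 5/3 by norm_num,
    show (1 + -1/3 : ℂ) = 2/3 by norm_num, h5, h6]
  generalize ((Real.sqrt π : ℝ) : ℂ) = r at *
  generalize ((Real.sqrt 3 : ℝ) : ℂ) = q at *
  generalize Complex.Gamma (1/3) = a at *
  generalize Complex.Gamma (2/3) = b at *
  generalize Complex.Gamma (5/6) = d at *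
  generalize e16 (-1/3) = e at *
  generalize (2:ℂ)^(1/3:ℂ) = w at *
  have hd : d = b * w * r / a := by field_simp; linear_combination h1
  have h2' : a * b * q = 2 * π := by
    rw [h2]; field_simp
  subst hd
  have hw : w ≠ 0 := by rintro rfl; norm_num at h4
  have : e * r * (b * w * r / a) = (1/2) * π * b / a := by
    rw [← h4, ← h7]; field_simp
  have : 8 * e * r * (b * w * r / a) * (2/3 * b)⁻¹ * b⁻¹ = 6 * π / (a * b) := by
    calc _ = 8 * (e * r * (b * w * r / a)) * (2/3 * b)⁻¹ * b⁻¹ := by ring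
      _ = _ := by rw [this]; field_simp; ring
  rw [this]
  field_simp
  linear_combination -3 * h2'

theorem kH_zero (n : ℕ) : kH 0 n = resF n := by
  have hn : (0:ℝ) ≤ n := Nat.cast_nonneg n
  have n1 : (1/2 + 2*(n:ℂ)) ≠ 0 := ne_of_re_pos (by norm_num; linarith)
  have n2 : (1/3 + (n:ℂ)) ≠ 0 := ne_of_re_pos (by norm_num; linarith)
  have n3 : (2/3 + (n:ℂ)) ≠ 0 := ne_of_re_pos (by norm_num; linarith)
  have g1 := Complex.Gamma_ne_zero_of_re_pos (s := 1/3 + n) (by norm_num; linarith)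
  have g2 := Complex.Gamma_ne_zero_of_re_pos (s := 2/3 + n) (by norm_num; linarith)
  rw [kH, Mk, Acore, Ppol, resF, Gs n2 (w := 4/3 + (n:ℂ)) (by ring),
    Gs n3 (w := 5/3 + (n:ℂ)) (by ring), Gs n1 (w := 3/2 + 2*(n:ℂ)) (by ring)]
  simp only [add_zero, sub_zero, zero_add, mul_zero, Complex.ofReal_one, Complex.Gamma_one,
    Complex.ofReal_ofNat]
  generalize Complex.Gamma (1/3 + n) = a at *
  generalize Complex.Gamma (2/3 + n) = b at *
  generalize (Complex.Gamma (1 + n))⁻¹ = c at *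
  generalize (Complex.Gamma (2 + n))⁻¹ = d at *
  simp only [mul_inv]
  have e1 : (1/3 + (n:ℂ)) * (1/3 + (n:ℂ))⁻¹ = 1 := mul_inv_cancel₀ n2
  have e2 : (2/3 + (n:ℂ)) * (2/3 + (n:ℂ))⁻¹ = 1 := mul_inv_cancel₀ n3
  have e3 : a * a⁻¹ = 1 := mul_inv_cancel₀ g1
  have e4 : b * b⁻¹ = 1 := mul_inv_cancel₀ g2
  calc _ = e16 n * Complex.Gamma (1/2) * Complex.Gamma (1/2 + 2*n) * c * d * (4 * 1 + n * 16) *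
      (a * a⁻¹) * (b * b⁻¹) * ((1/3 + (n:ℂ)) * (1/3 + (n:ℂ))⁻¹) *
        ((2/3 + (n:ℂ)) * (2/3 + (n:ℂ))⁻¹) := by ring
    _ = _ := by rw [e1, e2, e3, e4]; ring

theorem gamma_poch_one (n : ℕ) : Complex.Gamma (1 + n) = (pochR 1 n : ℂ) := by
  induction n with
  | zero => simp [pochR]
  | succ k ih =>
    have hk : (0:ℝ) ≤ k := Nat.cast_nonneg k
    have : (1 + (k:ℂ)) ≠ 0 := ne_of_re_pos (by norm_num; linarith)
    rw [Gs this (w := 1 + ((k+1:ℕ):ℂ)) (by push_cast; ring), ih, pochR, pochR,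
      Finset.prod_range_succ]
    push_cast; ring

theorem gamma_poch_quarter (n : ℕ) : Complex.Gamma (1/2 + 2*n) =
    ((Real.sqrt π : ℝ) : ℂ) * 4^n * (pochR (1/4) n : ℂ) * (pochR (3/4) n : ℂ) := by
  induction n with
  | zero =>
    have := Complex.Gamma_ofReal (1/2)
    rw [Real.Gamma_one_half_eq] at this
    simp [pochR]
    rw [← this]; norm_num
  | succ k ih =>
    have hk : (0:ℝ) ≤ k := Nat.cast_nonneg k
    have h1 : (1/2 + 2*(k:ℂ)) ≠ 0 := ne_of_re_pos (by norm_num; linarith)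
    have h2 : (3/2 + 2*(k:ℂ)) ≠ 0 := ne_of_re_pos (by norm_num; linarith)
    rw [Gs h2 (w := 1/2 + 2*((k+1:ℕ):ℂ)) (by push_cast; ring),
      Gs h1 (w := 3/2 + 2*(k:ℂ)) (by ring), ih]
    simp only [pochR, Finset.prod_range_succ]
    push_cast; ring

theorem pochR_pos {a : ℝ} (ha : 0 < a) (n : ℕ) : 0 < pochR a n :=
  Finset.prod_pos fun i _ => by positivity

noncomputable def Kc (n : ℕ) : ℝ :=
  (pochR 1 n)^2 / (π * 64^n * pochR (1/4) n * pochR (3/4) n)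

theorem two_cpow (z : ℂ) : (2:ℂ)^z = cpowR 2 z := by
  rw [cpowR, Complex.cpow_def_of_ne_zero (by norm_num), Complex.ofReal_log (by norm_num), mul_comm]
  norm_num

theorem h8_eq (n : ℕ) {s : ℂ} (hs1 : -1/3 < s.re) (hs2 : s.re < 0) :
    h8 n s = -(Kc n : ℂ) * (kH s n / (s - ((0:ℝ):ℂ))) := by
  have hn : (0:ℝ) ≤ n := Nat.cast_nonneg n
  have n0 : s ≠ 0 := by rintro rfl; simp at hs2
  have n2 : (1/3 + (n:ℂ)) ≠ 0 := ne_of_re_pos (by norm_num; linarith)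
  have n3 : (2/3 + (n:ℂ)) ≠ 0 := ne_of_re_pos (by norm_num; linarith)
  have n4 : (1 + (n:ℂ) + 2*s) ≠ 0 := ne_of_re_pos (by norm_num; linarith)
  have g1 := Complex.Gamma_ne_zero_of_re_pos (s := 1/3 + n) (by norm_num; linarith)
  have g2 := Complex.Gamma_ne_zero_of_re_pos (s := 2/3 + n) (by norm_num; linarith)
  have g3 := Complex.Gamma_ne_zero_of_re_pos (s := 1 + n + 2*s) (by norm_num; linarith)
  have g4 := Complex.Gamma_ne_zero_of_re_pos (s := 1 + n + s) (by norm_num; linarith)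
  have hp1 : (pochR 1 n : ℂ) ≠ 0 := by exact_mod_cast (pochR_pos (by norm_num) n).ne'
  have hp2 : (pochR (1/4) n : ℂ) ≠ 0 := by exact_mod_cast (pochR_pos (by norm_num) n).ne'
  have hp3 : (pochR (3/4) n : ℂ) ≠ 0 := by exact_mod_cast (pochR_pos (by norm_num) n).ne'
  have hr : ((Real.sqrt π : ℝ) : ℂ) ≠ 0 := by exact_mod_cast (Real.sqrt_pos.2 Real.pi_pos).ne'
  have h7 : (π : ℂ) = ((Real.sqrt π : ℝ) : ℂ) * ((Real.sqrt π : ℝ) : ℂ) := by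
    rw [← Complex.ofReal_mul, Real.mul_self_sqrt Real.pi_pos.le]
  have h6 : Complex.Gamma (1/2) = ((Real.sqrt π : ℝ) : ℂ) := by
    have := Complex.Gamma_ofReal (1/2)
    rw [Real.Gamma_one_half_eq] at this
    rw [← this]; norm_num
  have D1 := Complex.Gamma_mul_Gamma_add_half (1/2 + n/2 + s)
  have D2 := Complex.Gamma_mul_Gamma_add_half (1/2 + n/2)
  rw [show (1/2 + n/2 + s + 1/2 : ℂ) = 1 + n/2 + s by ring,
    show (2 * (1/2 + n/2 + s) : ℂ) = 1 + n + 2*s by ring,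
    show (1 - (1 + n + 2*s) : ℂ) = -n + -(2*s) by ring, two_cpow] at D1
  rw [show (1/2 + n/2 + 1/2 : ℂ) = 1 + n/2 by ring,
    show (2 * (1/2 + n/2) : ℂ) = 1 + n by ring,
    show (1 - (1 + n) : ℂ) = -n by ring, two_cpow, gamma_poch_one] at D2
  have X1 : cpowR 2 (-n + -(2*s)) = cpowR 2 (-n) * (cpowR 2 (2*s))⁻¹ := by
    simp only [cpowR, ← Complex.exp_add, ← Complex.exp_neg]; congr 1; ring
  have X2 : e16 (s + n) = cpowR 2 (2*s) * cpowR 2 (2*s) * 16^n := by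
    have l : Real.log 16 = 4 * Real.log 2 := by
      rw [show (16:ℝ) = 2^4 by norm_num, Real.log_pow]; norm_num
    have : (16:ℂ)^n = Complex.exp (n * ((Real.log 16 : ℝ) : ℂ)) := by
      rw [Complex.exp_nat_mul, ← Complex.ofReal_exp, Real.exp_log (by norm_num)]; norm_num
    rw [this, e16, l]
    simp only [cpowR, ← Complex.exp_add]; congr 1; push_cast; ring
  have X0 : cpowR 2 (2*s) ≠ 0 := Complex.exp_ne_zero _
  have Y0 : cpowR 2 (-n) ≠ 0 := Complex.exp_ne_zero _
  rw [X1] at D1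
  have gs : Complex.Gamma (-s) = -(Complex.Gamma (1 - s) / s) := by
    rw [Gs (z := -s) (w := 1 - s) (neg_ne_zero.2 n0) (by ring)]; field_simp
  have c1 : cpoch (1/2 + (n:ℂ)/2) s * cpoch (1 + (n:ℂ)/2) s =
      Complex.Gamma (1 + n + 2*s) * (cpowR 2 (2*s))⁻¹ / (pochR 1 n : ℂ) := by
    rw [cpoch, cpoch, div_mul_div_comm, D1, D2]
    generalize cpowR 2 (-n) = y at *
    field_simp
  rw [h8, c1, gs, kH, Mk, Acore, X2, Gs n2 (w := 4/3 + (n:ℂ)) (by ring),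
    Gs n3 (w := 5/3 + (n:ℂ)) (by ring), Complex.ofReal_one, Complex.ofReal_ofNat,
    Gs n4 (w := 2 + (n:ℂ) + 2*s) (by ring), Ppol, Kc]
  simp only [cpoch]
  rw [gamma_poch_one, gamma_poch_quarter, h6]
  rw [show 2 * s + (n:ℂ) + 1 = 1 + n + 2*s by ring]
  push_cast
  rw [h7, show (64:ℂ)^n = 4^n * 16^n by rw [← mul_pow]; norm_num]
  rw [sub_zero]
  generalize ((Real.sqrt π : ℝ) : ℂ) = r at *
  generalize Complex.Gamma (1/3 + n) = a1 at *
  generalize Complex.Gamma (2/3 + n) = a2 at *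
  generalize Complex.Gamma (1 + n + 2*s) = a3 at *
  generalize Complex.Gamma (1 + n + s) = a4 at *
  generalize Complex.Gamma (1/2 + s) = a5 at *
  generalize Complex.Gamma (1/2 + 2*n + s) = a6 at *
  generalize Complex.Gamma (1/3 + n + s) = a7 at *
  generalize Complex.Gamma (2/3 + n + s) = a8 at *
  generalize Complex.Gamma (1 - s) = a9 at *
  generalize cpowR 2 (2*s) = x at *
  generalize (pochR 1 n : ℂ) = p1 at *
  generalize (pochR (1/4) n : ℂ) = p2 at *
  generalize (pochR (3/4) n : ℂ) = p3 at *
  have m4 : (4:ℂ)^n ≠ 0 := pow_ne_zero _ (by norm_num)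
  have m16 : (16:ℂ)^n ≠ 0 := pow_ne_zero _ (by norm_num)
  generalize (4:ℂ)^n = f4 at *
  generalize (16:ℂ)^n = f16 at *
  generalize (15 * s + 4) * (2 * s + 1) + (n:ℂ) * (33 * s + 16) = P at *
  generalize (1 + (n:ℂ) + 2*s) = l at *
  generalize (1/3 + (n:ℂ)) = l1 at *
  generalize (2/3 + (n:ℂ)) = l2 at *
  clear D1 D2 X1 X2 c1 gs h6 h7 Y0
  field_simp

theorem barnes_integral_3sqrt3_over_pi_param (t : ℕ) (c : ℝ) (hc1 : -1/3 < c) (hc2 : c < 0) :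
    Integrable (fun y : ℝ => h8 t ((c : ℂ) + (y : ℂ) * Complex.I)) ∧
    (1 / (2*(π : ℂ))) * ∫ y : ℝ, h8 t ((c : ℂ) + (y : ℂ) * Complex.I) =
      ((3 * Real.sqrt 3 / π) * (1 / 2^(6*t)) * (pochR 1 t)^2 /
        (pochR (1/4) t * pochR (3/4) t) : ℝ) := by
  have ht : (0:ℝ) ≤ t := Nat.cast_nonneg t
  have htr : (t:ℂ).re = t := by simp
  obtain ⟨C, hC, h⟩ := kH_bound (a := (t:ℂ).re) (b := (t:ℂ).re) (c1 := c) (c2 := 1/2)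
    (by linarith) (by linarith) (by linarith) (by linarith) (by linarith) (by linarith)
  have hd : ∀ s : ℂ, c ≤ s.re → s.re ≤ 1/2 → DifferentiableAt ℂ (fun s => kH s t) s :=
    fun s h1 h2 => kH_diff_s (by linarith) (by linarith) (by linarith) (by linarith)
  have hb : ∀ s : ℂ, c ≤ s.re → s.re ≤ 1/2 →
      ‖kH s t‖ ≤ (C * Real.exp (2 * |(t:ℂ).im|)) * Real.exp (-|s.im|/2) :=
    fun s h1 h2 => h s t h1 h2 le_rfl le_rfl
  have R := residue_lemma (c1 := c) (p := 0) (c2 := 1/2) hc2 (by norm_num)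
    (by linarith) (by norm_num) hd hb
  have L := line_int (k := fun s => kH s t) (c := c) (p := 0) hc2.ne
    (fun s hs => hd s hs.ge (by linarith)) (fun s hs => hb s hs.ge (by linarith))
  have e : (fun y : ℝ => h8 t ((c : ℂ) + (y : ℂ) * Complex.I)) = fun y : ℝ =>
      -(Kc t : ℂ) * (kH ((c : ℂ) + (y : ℂ) * Complex.I) t /
        ((c : ℂ) + (y : ℂ) * Complex.I - ((0:ℝ):ℂ))) := by
    funext y
    exact h8_eq t (by simp; linarith) (by simp; linarith)
  rw [e]
  refine ⟨L.const_mul _, ?_⟩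
  rw [integral_const_mul]
  have E := EF_const t
  rw [EF, resF_third, I0] at E
  rw [Complex.ofReal_zero, kH_zero] at R
  rw [Complex.ofReal_zero] at *
  generalize (∫ y : ℝ, kH ((c : ℂ) + (y : ℂ) * Complex.I) t /
        ((c : ℂ) + (y : ℂ) * Complex.I - 0)) = J at *
  have hJ : J = -(2 * π * (3 * ((Real.sqrt 3 : ℝ) : ℂ))) := by linear_combination -R - E
  have hp : (π : ℂ) ≠ 0 := by exact_mod_cast Real.pi_ne_zero
  have hp2 : (pochR (1/4) t : ℂ) ≠ 0 := by exact_mod_cast (pochR_pos (by norm_num) t).ne'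
  have hp3 : (pochR (3/4) t : ℂ) ≠ 0 := by exact_mod_cast (pochR_pos (by norm_num) t).ne'
  rw [hJ, Kc, pow_mul]
  push_cast
  rw [show (2:ℂ)^6 = 64 by norm_num]
  have m64 : (64:ℂ)^t ≠ 0 := pow_ne_zero _ (by norm_num)
  field_simp
end

section
/- For every real c with −1/3 < c < 0, the function y ↦ h(c+iy) is integrable over ℝ and (1/(2π)) ∫_{−∞}^{∞} h(c+iy) dy = 3√3/π, where h(s) = [(1/2)_s (1/3)_s (2/3)_s / ((1)_s)^2] · (15s+4) · Γ(−s) · 2^{2s}. -/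
open Complex MeasureTheory Real

/-- The integrand `h`. -/
noncomputable def h9 (s : ℂ) : ℂ :=
  (cpoch (1/2) s * cpoch (1/3) s * cpoch (2/3) s / (cpoch 1 s)^2) *
    (15*s + 4) * Complex.Gamma (-s) * cpowR 2 (2*s)

/-- The kernel `π / sin (π s)`. -/
noncomputable def kerE (s : ℂ) : ℂ := (π : ℂ) / Complex.sin (π * s)

lemma sin_norm_ge (x y : ℝ) : |Real.sinh y| ≤ ‖Complex.sin ((x : ℂ) + y * I)‖ := by
  rw [Complex.sin_add_mul_I]
  have h : Complex.sin x * Complex.cosh y + Complex.cos x * Complex.sinh y * I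
      = ((Real.sin x * Real.cosh y : ℝ) : ℂ) + ((Real.cos x * Real.sinh y : ℝ) : ℂ) * I := by
    push_cast; ring
  rw [h, Complex.norm_add_mul_I]
  apply Real.le_sqrt_of_sq_le
  rw [sq_abs]
  have h1 := Real.cosh_sq y
  have h2 := Real.sin_sq_add_cos_sq x
  nlinarith [sq_nonneg (Real.sin x), sq_nonneg (Real.sinh y)]

lemma kerE_bound (x y : ℝ) (hy : 1 ≤ |y|) :
    ‖kerE ((x : ℂ) + y * I)‖ * (1 + |y|) ^ 2 ≤ 16 * π / (1 + y ^ 2) := by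
  have h0 : (π : ℂ) * ((x : ℂ) + y * I) = ((π * x : ℝ) : ℂ) + ((π * y : ℝ) : ℂ) * I := by
    push_cast; ring
  have h1 := sin_norm_ge (π * x) (π * y)
  rw [← h0] at h1
  have h2 : |Real.sinh (π * y)| = Real.sinh (π * |y|) := by
    rw [Real.abs_sinh, abs_mul, abs_of_pos Real.pi_pos]
  rw [h2] at h1
  have hpi := Real.pi_gt_three
  set t := |y| with ht
  have h3 : Real.exp (π * t) ≤ 4 * Real.sinh (π * t) := by
    rw [Real.sinh_eq]
    have a1 : 1 ≤ π * t := by nlinarith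
    have a2 : Real.exp (-(π * t)) ≤ 1 := Real.exp_le_one_iff.mpr (by linarith)
    have a3 := Real.add_one_le_exp (π * t)
    linarith
  have h4 : (1 + t) ^ 4 ≤ 4 * Real.exp (π * t) := by
    have a1 := Real.add_one_le_exp (π * t / 4)
    have a2 : Real.exp (π * t) = Real.exp (π * t / 4) ^ 4 := by
      rw [← Real.exp_nat_mul]; congr 1; push_cast; ring
    have a3 : 3 / 4 * (1 + t) ≤ Real.exp (π * t / 4) := by nlinarith
    have a4 : (3 / 4 * (1 + t)) ^ 4 ≤ Real.exp (π * t / 4) ^ 4 := by gcongr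
    rw [a2]
    have a5 : 0 ≤ (1 + t) ^ 4 := by positivity
    have a6 : (3 / 4 * (1 + t)) ^ 4 = 81 / 256 * (1 + t) ^ 4 := by ring
    linarith
  have h5 : y ^ 2 = t ^ 2 := by rw [ht, sq_abs]
  have hs : 0 < ‖Complex.sin (π * ((x : ℂ) + y * I))‖ := by
    have := Real.exp_pos (π * t)
    linarith
  rw [kerE, norm_div, Complex.norm_of_nonneg Real.pi_pos.le, div_mul_eq_mul_div,
    div_le_div_iff₀ hs (by positivity), h5]
  have h6 : (1 + t) ^ 2 * (1 + t ^ 2) ≤ (1 + t) ^ 4 := by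
    have : (1 + t) ^ 4 = (1 + t) ^ 2 * (1 + t) ^ 2 := by ring
    rw [this]; gcongr; nlinarith
  have h7 : (1 + t) ^ 2 * (1 + t ^ 2) ≤ 16 * ‖Complex.sin (π * ((x : ℂ) + y * I))‖ := by linarith
  have := mul_le_mul_of_nonneg_left h7 Real.pi_pos.le
  linarith

lemma line_cont {Ψ : ℂ → ℂ} {a b c : ℝ} (h1 : a < c) (h2 : c < b)
    (hd : DifferentiableOn ℂ Ψ {s | a < s.re ∧ s.re < b}) :
    Continuous (fun y : ℝ => Ψ ((c : ℂ) + y * I)) := by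
  apply hd.continuousOn.comp_continuous (by fun_prop)
  intro y; simp [h1, h2]

lemma line_int_s9 {Ψ : ℂ → ℂ} {a b c : ℝ} (h1 : a < c) (h2 : c < b)
    (hd : DifferentiableOn ℂ Ψ {s | a < s.re ∧ s.re < b}) (B : ℝ)
    (hB : ∀ y : ℝ, 1 ≤ |y| → ‖Ψ ((c : ℂ) + y * I)‖ ≤ B / (1 + y ^ 2)) :
    Integrable (fun y : ℝ => Ψ ((c : ℂ) + y * I)) := by
  have hc := line_cont h1 h2 hd
  obtain ⟨K, hK⟩ := (isCompact_Icc (a := (-1 : ℝ)) (b := 1)).exists_bound_of_continuousOn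
    hc.continuousOn
  have hK0 : 0 ≤ K := (norm_nonneg _).trans (hK 0 (by simp))
  refine Integrable.mono' ((integrable_inv_one_add_sq).const_mul (max (2 * K) B))
    hc.aestronglyMeasurable (Filter.Eventually.of_forall fun y => ?_)
  rw [← div_eq_mul_inv]
  rcases le_total 1 |y| with h | h
  · exact (hB y h).trans (by gcongr; exact le_max_right _ _)
  · refine (hK y (abs_le.mp h)).trans ?_
    rw [le_div_iff₀ (by positivity)]
    have : y ^ 2 ≤ 1 := by rw [← sq_abs]; nlinarith [abs_nonneg y]
    calc K * (1 + y ^ 2) ≤ K * 2 := by gcongr; linarith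
      _ = 2 * K := by ring
      _ ≤ _ := le_max_left _ _

lemma line_shift {Ψ : ℂ → ℂ} {a b c c' : ℝ} (h1 : a < c) (h2 : c ≤ c') (h3 : c' < b)
    (hd : DifferentiableOn ℂ Ψ {s | a < s.re ∧ s.re < b}) (B : ℝ)
    (hB : ∀ x y : ℝ, c ≤ x → x ≤ c' → 1 ≤ |y| → ‖Ψ ((x : ℂ) + y * I)‖ ≤ B / (1 + y ^ 2)) :
    ∫ y : ℝ, Ψ ((c : ℂ) + y * I) = ∫ y : ℝ, Ψ ((c' : ℂ) + y * I) := by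
  have i1 := line_int_s9 h1 (h2.trans_lt h3) hd B (fun y => hB c y le_rfl h2)
  have i2 := line_int_s9 (h1.trans_le h2) h3 hd B (fun y => hB c' y h2 le_rfl)
  have t1 := intervalIntegral_tendsto_integral i1 Filter.tendsto_neg_atTop_atBot Filter.tendsto_id
  have t2 := intervalIntegral_tendsto_integral i2 Filter.tendsto_neg_atTop_atBot Filter.tendsto_id
  have hlim : Filter.Tendsto (fun T : ℝ => B / (1 + T ^ 2) * |c' - c|) Filter.atTop (nhds 0) := by
    have : Filter.Tendsto (fun T : ℝ => 1 + T ^ 2) Filter.atTop Filter.atTop :=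
      Filter.tendsto_atTop_add_const_left _ _ (Filter.tendsto_pow_atTop two_ne_zero)
    simpa using (this.const_div_atTop B).mul_const |c' - c|
  have key (σ : ℝ) (hσ : |σ| = 1) : Filter.Tendsto
      (fun T : ℝ => ∫ x : ℝ in c..c', Ψ ((x : ℂ) + ((σ * T : ℝ) : ℂ) * I)) Filter.atTop (nhds 0) := by
    refine squeeze_zero_norm' ?_ hlim
    filter_upwards [Filter.eventually_ge_atTop 1] with T hT
    apply intervalIntegral.norm_integral_le_of_norm_le_const
    intro x hx
    rw [Set.uIoc_of_le h2] at hx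
    have hs : (σ * T) ^ 2 = T ^ 2 := by
      have : σ ^ 2 = 1 := by rw [← sq_abs, hσ]; norm_num
      rw [mul_pow, this, one_mul]
    have := hB x (σ * T) hx.1.le hx.2 (by rw [abs_mul, hσ, one_mul]; exact hT.trans (le_abs_self T))
    rwa [hs] at this
  have k1 := key 1 (by simp)
  have k2 := key (-1) (by simp)
  have e : ∀ T : ℝ, (∫ y : ℝ in -T..id T, Ψ ((c' : ℂ) + y * I))
      - (∫ y : ℝ in -T..id T, Ψ ((c : ℂ) + y * I))
      = I * ((∫ x : ℝ in c..c', Ψ ((x : ℂ) + ((-1 * T : ℝ) : ℂ) * I))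
        - ∫ x : ℝ in c..c', Ψ ((x : ℂ) + ((1 * T : ℝ) : ℂ) * I)) := by
    intro T
    have := Complex.integral_boundary_rect_eq_zero_of_differentiableOn Ψ
      ((c : ℂ) + ((-T : ℝ) : ℂ) * I) ((c' : ℂ) + (T : ℂ) * I) (hd.mono ?_)
    · simp only [add_re, ofReal_re, mul_re, I_re, mul_zero, ofReal_im, I_im, mul_one, sub_self,
        add_zero, add_im, mul_im, zero_add, smul_eq_mul, zero_mul] at this
      simp only [id, neg_one_mul, one_mul]
      linear_combination (-I) * this + ((∫ y : ℝ in -T..T, Ψ ((c' : ℂ) + y * I))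
      - (∫ y : ℝ in -T..T, Ψ ((c : ℂ) + y * I))) * I_mul_I
    · intro z hz
      have := hz.1
      simp [Set.uIcc_of_le h2] at this
      exact ⟨by linarith [this.1], by linarith [this.2]⟩
  have t3 := (t2.sub t1).congr e
  have t4 := (k2.sub k1).const_mul I
  have := tendsto_nhds_unique t3 t4
  simp at this
  exact (sub_eq_zero.mp this).symm

lemma kerE_eq_Gamma (s : ℂ) : kerE s = Complex.Gamma s * Complex.Gamma (1 - s) := by
  rw [Complex.Gamma_mul_Gamma_one_sub, kerE]

lemma kerE_add_one (s : ℂ) : kerE (s + 1) = - kerE s := by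
  rw [kerE, kerE, mul_add, mul_one, Complex.sin_add_pi, div_neg]

lemma ne_neg_nat_of_re_pos {s : ℂ} (h : 0 < s.re) (m : ℕ) : s ≠ -m := by
  rintro rfl
  simp at h
  have : (0 : ℝ) ≤ m := Nat.cast_nonneg m
  linarith

lemma diff_Gamma_of_re_pos {s : ℂ} (h : 0 < s.re) : DifferentiableAt ℂ Complex.Gamma s :=
  Complex.differentiableAt_Gamma s (ne_neg_nat_of_re_pos h)

lemma kerE_diff_pos : DifferentiableOn ℂ kerE {s | 0 < s.re ∧ s.re < 1} := by
  intro s hs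
  apply DifferentiableAt.differentiableWithinAt
  rw [show kerE = fun s => Complex.Gamma s * Complex.Gamma (1 - s) from funext kerE_eq_Gamma]
  apply (diff_Gamma_of_re_pos hs.1).mul
  have : DifferentiableAt ℂ Complex.Gamma (1 - s) := diff_Gamma_of_re_pos (by simp [hs.2])
  exact this.comp s (by fun_prop)

lemma kerE_diff_neg : DifferentiableOn ℂ kerE {s | -1 < s.re ∧ s.re < 0} := by
  have h : kerE = fun s => - kerE (s + 1) := by funext s; rw [kerE_add_one, neg_neg]
  rw [h]
  apply DifferentiableOn.neg
  apply kerE_diff_pos.comp (by fun_prop)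
  intro s hs
  simp only [Set.mem_ofPred_eq, add_re, one_re] at hs ⊢
  constructor <;> linarith [hs.1, hs.2]

lemma kerE_bound_simple (x y : ℝ) (hy : 1 ≤ |y|) :
    ‖kerE ((x : ℂ) + y * I)‖ ≤ 16 * π / (1 + y ^ 2) := by
  refine le_trans ?_ (kerE_bound x y hy)
  apply le_mul_of_one_le_right (norm_nonneg _)
  nlinarith [abs_nonneg y]

lemma kerE_half_integral : ∫ y : ℝ, kerE (((1 / 2 : ℝ) : ℂ) + y * I) = π := by
  have h : ∀ y : ℝ, kerE (((1 / 2 : ℝ) : ℂ) + y * I) = ((π / Real.cosh (π * y) : ℝ) : ℂ) := by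
    intro y
    rw [kerE]
    have : (π : ℂ) * (((1 / 2 : ℝ) : ℂ) + y * I) = (π * y : ℂ) * I + π / 2 := by push_cast; ring
    rw [this, Complex.sin_add_pi_div_two, Complex.cos_mul_I]
    push_cast; rfl
  have hint : Integrable (fun y : ℝ => π / Real.cosh (π * y)) := by
    have := line_int_s9 (c := 1 / 2) (by norm_num) (by norm_num) kerE_diff_pos (16 * π)
      (fun y hy => kerE_bound_simple _ y hy)
    simp only [h] at this
    exact this.re
  simp only [h]
  rw [integral_complex_ofReal]
  congr 1
  have hd : ∀ y : ℝ, HasDerivAt (fun y => Real.arctan (Real.sinh (π * y)))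
      (π / Real.cosh (π * y)) y := by
    intro y
    have h1 : HasDerivAt (fun y : ℝ => π * y) π y := by
      simpa using (hasDerivAt_id y).const_mul π
    have := (h1.sinh).arctan
    convert! this using 1
    have hc := Real.cosh_pos (π * y)
    have := Real.cosh_sq (π * y)
    rw [show 1 + Real.sinh (π * y) ^ 2 = Real.cosh (π * y) ^ 2 by linarith]
    field_simp
  have hsinh_top : Filter.Tendsto (fun y : ℝ => Real.sinh (π * y)) Filter.atTop Filter.atTop := by
    refine Filter.tendsto_atTop_mono' _ ?_ Filter.tendsto_id
    filter_upwards [Filter.eventually_ge_atTop 0] with y hy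
    have := Real.pi_gt_three
    have h1 : π * y ≤ Real.sinh (π * y) := Real.self_le_sinh_iff.mpr (by positivity)
    simp only [id]
    nlinarith
  have t1 : Filter.Tendsto (fun y => Real.arctan (Real.sinh (π * y))) Filter.atTop
      (nhds (π / 2)) :=
    (Real.tendsto_arctan_atTop.mono_right nhdsWithin_le_nhds).comp hsinh_top
  have t2 : Filter.Tendsto (fun y => Real.arctan (Real.sinh (π * y))) Filter.atBot
      (nhds (-(π / 2))) := by
    have := (t1.comp Filter.tendsto_neg_atBot_atTop).neg
    refine this.congr fun y => ?_
    simp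
  rw [integral_of_hasDerivAt_of_tendsto hd hint t2 t1]
  ring

lemma kerE_integral_pos {c : ℝ} (h0 : 0 < c) (h1 : c < 1) :
    ∫ y : ℝ, kerE ((c : ℂ) + y * I) = π := by
  rw [← kerE_half_integral]
  rcases le_total c (1 / 2) with h | h
  · exact line_shift h0 h (by norm_num) kerE_diff_pos (16 * π)
      (fun x y _ _ hy => kerE_bound_simple x y hy)
  · exact (line_shift (by norm_num) h h1 kerE_diff_pos (16 * π)
      (fun x y _ _ hy => kerE_bound_simple x y hy)).symm

lemma kerE_integral_neg {c : ℝ} (h0 : -1 < c) (h1 : c < 0) :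
    ∫ y : ℝ, kerE ((c : ℂ) + y * I) = -π := by
  rw [← kerE_integral_pos (c := c + 1) (by linarith) (by linarith), ← integral_neg]
  congr 1; funext y
  rw [show (((c + 1 : ℝ) : ℂ) + y * I) = ((c : ℂ) + y * I) + 1 by push_cast; ring,
    kerE_add_one, neg_neg]

lemma kerE_mul_bound {φ : ℂ → ℂ} {B x y : ℝ}
    (hB : ‖φ ((x : ℂ) + y * I)‖ ≤ B * (1 + |y|) ^ 2) (hy : 1 ≤ |y|) :
    ‖kerE ((x : ℂ) + y * I) * φ ((x : ℂ) + y * I)‖ ≤ (16 * π * B) / (1 + y ^ 2) := by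
  have hB0 : 0 ≤ B := by
    have := (norm_nonneg _).trans hB
    by_contra h
    push Not at h
    have : 0 < (1 + |y|) ^ 2 := by positivity
    nlinarith
  rw [norm_mul]
  calc _ ≤ ‖kerE ((x : ℂ) + y * I)‖ * (B * (1 + |y|) ^ 2) := by gcongr
    _ = (‖kerE ((x : ℂ) + y * I)‖ * (1 + |y|) ^ 2) * B := by ring
    _ ≤ (16 * π / (1 + y ^ 2)) * B := by gcongr; exact kerE_bound x y hy
    _ = _ := by ring

lemma int_neg {φ : ℂ → ℂ} {a c : ℝ} (ha : -1 ≤ a) (h1 : a < c) (h2 : c < 0)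
    (hd : DifferentiableOn ℂ φ {s | a < s.re ∧ s.re < 1}) (B : ℝ)
    (hB : ∀ y : ℝ, ‖φ ((c : ℂ) + y * I)‖ ≤ B * (1 + |y|) ^ 2) :
    Integrable (fun y : ℝ => kerE ((c : ℂ) + y * I) * φ ((c : ℂ) + y * I)) := by
  refine line_int_s9 (Ψ := fun s => kerE s * φ s) h1 h2 ?_ (16 * π * B)
    (fun y hy => kerE_mul_bound (hB y) hy)
  apply DifferentiableOn.mul
  · exact kerE_diff_neg.mono fun s hs => ⟨by linarith [hs.1], hs.2⟩
  · exact hd.mono fun s hs => ⟨hs.1, by linarith [hs.2]⟩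

lemma int_pos {φ : ℂ → ℂ} {a c : ℝ} (ha : a < 0) (h1 : 0 < c) (h2 : c < 1)
    (hd : DifferentiableOn ℂ φ {s | a < s.re ∧ s.re < 1}) (B : ℝ)
    (hB : ∀ y : ℝ, ‖φ ((c : ℂ) + y * I)‖ ≤ B * (1 + |y|) ^ 2) :
    Integrable (fun y : ℝ => kerE ((c : ℂ) + y * I) * φ ((c : ℂ) + y * I)) := by
  refine line_int_s9 (Ψ := fun s => kerE s * φ s) h1 h2 ?_ (16 * π * B)
    (fun y hy => kerE_mul_bound (hB y) hy)
  apply kerE_diff_pos.mul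
  exact hd.mono fun s hs => ⟨by linarith [hs.1], hs.2⟩

lemma res_shift {φ : ℂ → ℂ} {a c c' : ℝ} (ha : -1 ≤ a) (h1 : a < c) (h2 : c < 0) (h3 : 0 < c')
    (h4 : c' < 1) (hd : DifferentiableOn ℂ φ {s | a < s.re ∧ s.re < 1}) (B : ℝ)
    (hB : ∀ x y : ℝ, c ≤ x → x ≤ c' → ‖φ ((x : ℂ) + y * I)‖ ≤ B * (1 + |y|) ^ 2) :
    ∫ y : ℝ, kerE ((c' : ℂ) + y * I) * φ ((c' : ℂ) + y * I)
      = (∫ y : ℝ, kerE ((c : ℂ) + y * I) * φ ((c : ℂ) + y * I)) + 2 * π * φ 0 := by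
  have hopen : IsOpen {s : ℂ | a < s.re ∧ s.re < 1} :=
    (isOpen_lt continuous_const continuous_re).inter (isOpen_lt continuous_re continuous_const)
  have hmem : {s : ℂ | a < s.re ∧ s.re < 1} ∈ nhds (0 : ℂ) :=
    hopen.mem_nhds ⟨by simp; linarith, by simp⟩
  set Ψ : ℂ → ℂ := fun s => (Complex.Gamma (1 + s) * Complex.Gamma (1 - s)) * dslope φ 0 s with hΨ
  have hΨd : DifferentiableOn ℂ Ψ {s | a < s.re ∧ s.re < 1} := by
    apply DifferentiableOn.mul
    · intro s hs
      apply DifferentiableAt.differentiableWithinAt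
      have e1 : DifferentiableAt ℂ Complex.Gamma (1 + s) :=
        diff_Gamma_of_re_pos (by simp; linarith [hs.1])
      have e2 : DifferentiableAt ℂ Complex.Gamma (1 - s) :=
        diff_Gamma_of_re_pos (by simp; linarith [hs.2])
      exact (e1.comp s (by fun_prop)).mul (e2.comp s (by fun_prop))
    · exact (Complex.differentiableOn_dslope hmem).mpr hd
  have hΨe : ∀ s : ℂ, s ≠ 0 → Ψ s = kerE s * (φ s - φ 0) := by
    intro s hs
    simp only [hΨ]
    rw [dslope_of_ne _ hs, slope_def_field, sub_zero, kerE_eq_Gamma, add_comm 1 s,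
      Complex.Gamma_add_one s hs]
    field_simp
  have hline : ∀ x : ℝ, x ≠ 0 → ∀ y : ℝ, ((x : ℂ) + y * I) ≠ 0 := by
    intro x hx y h
    have := congrArg re h
    simp at this
    exact hx this
  have hlineim : ∀ x y : ℝ, 1 ≤ |y| → ((x : ℂ) + y * I) ≠ 0 := by
    intro x y hy h
    have := congrArg im h
    simp at this
    rw [this] at hy; norm_num at hy
  have hφ : ∀ x y : ℝ, c ≤ x → x ≤ c' →
      ‖φ ((x : ℂ) + y * I) - φ 0‖ ≤ (B + ‖φ 0‖) * (1 + |y|) ^ 2 := by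
    intro x y hx hx'
    refine (norm_sub_le _ _).trans ?_
    rw [add_mul]
    apply add_le_add (hB x y hx hx')
    apply le_mul_of_one_le_right (norm_nonneg _)
    nlinarith [abs_nonneg y]
  have hs := line_shift (c := c) (c' := c') h1 (by linarith) h4 hΨd
    (16 * π * (B + ‖φ 0‖)) (by
      intro x y hx hx' hy
      rw [hΨe _ (hlineim x y hy)]
      exact kerE_mul_bound (φ := fun s => φ s - φ 0) (hφ x y hx hx') hy)
  have e1 : ∀ x : ℝ, x ≠ 0 → (fun y : ℝ => Ψ ((x : ℂ) + y * I))
      = fun y : ℝ => kerE ((x : ℂ) + y * I) * φ ((x : ℂ) + y * I)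
        - kerE ((x : ℂ) + y * I) * φ 0 := by
    intro x hx; funext y
    rw [hΨe _ (hline x hx y), mul_sub]
  rw [e1 c h2.ne, e1 c' h3.ne', integral_sub, integral_sub, integral_mul_const,
    integral_mul_const, kerE_integral_neg (by linarith) h2, kerE_integral_pos h3 h4] at hs
  · linear_combination -hs
  · exact int_pos (by linarith) h3 h4 hd B (fun y => hB c' y (by linarith) le_rfl)
  · exact (line_int_s9 h3 h4 kerE_diff_pos (16 * π)
      (fun y hy => kerE_bound_simple _ y hy)).mul_const _
  · exact int_neg ha h1 h2 hd B (fun y => hB c y le_rfl (by linarith))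
  · exact (line_int_s9 (by linarith) h2 kerE_diff_neg (16 * π)
      (fun y hy => kerE_bound_simple _ y hy)).mul_const _

lemma Gr_bound {z w : ℂ} {σ d : ℝ} (hσ : 0 < σ) (hz : σ ≤ z.re) (hd : 0 < d) (hw : w = z + d) :
    ‖Complex.Gamma z / Complex.Gamma w‖ ≤ Real.Gamma σ / Real.Gamma (σ + d) := by
  subst hw
  have hdre : 0 < ((d : ℂ)).re := by simpa using hd
  have hσre : 0 < ((σ : ℂ)).re := by simpa using hσ
  have b1 := Complex.betaIntegral_eq_Gamma_mul_div z d (hσ.trans_le hz) hdre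
  have b2 := Complex.betaIntegral_eq_Gamma_mul_div σ d hσre hdre
  have hnorm : ∀ (u : ℂ) (x : ℝ), x ∈ Set.Ioo (0 : ℝ) 1 →
      ‖(x : ℂ) ^ (u - 1) * (1 - (x : ℂ)) ^ ((d : ℂ) - 1)‖ = x ^ (u.re - 1) * (1 - x) ^ (d - 1) := by
    intro u x hx
    rw [norm_mul, Complex.norm_cpow_eq_rpow_re_of_pos hx.1,
      show (1 - (x : ℂ)) = ((1 - x : ℝ) : ℂ) by push_cast; rfl,
      Complex.norm_cpow_eq_rpow_re_of_pos (by linarith [hx.2])]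
    simp
  have hint := (Complex.betaIntegral_convergent hσre hdre).norm
  have hle : ‖Complex.betaIntegral z d‖ ≤
      ∫ x : ℝ in (0 : ℝ)..1, ‖(x : ℂ) ^ ((σ : ℂ) - 1) * (1 - (x : ℂ)) ^ ((d : ℂ) - 1)‖ := by
    apply intervalIntegral.norm_integral_le_of_norm_le zero_le_one _ hint
    have : ∀ᵐ x : ℝ, x ≠ 1 := by simp [ae_iff, measure_singleton]
    filter_upwards [this] with x hx1 hx
    have hx' : x ∈ Set.Ioo (0 : ℝ) 1 := ⟨hx.1, lt_of_le_of_ne hx.2 hx1⟩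
    rw [hnorm z x hx', hnorm σ x hx']
    apply mul_le_mul_of_nonneg_right _ (Real.rpow_nonneg (by linarith [hx'.2]) _)
    apply Real.rpow_le_rpow_of_exponent_ge hx'.1 hx'.2.le
    simp; exact hz
  have heq : Complex.betaIntegral σ d =
      ((∫ x : ℝ in (0 : ℝ)..1,
        ‖(x : ℂ) ^ ((σ : ℂ) - 1) * (1 - (x : ℂ)) ^ ((d : ℂ) - 1)‖ : ℝ) : ℂ) := by
    rw [Complex.betaIntegral, ← intervalIntegral.integral_ofReal]
    apply intervalIntegral.integral_congr_ae
    have : ∀ᵐ x : ℝ, x ≠ 1 := by simp [ae_iff, measure_singleton]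
    filter_upwards [this] with x hx1 hx
    rw [Set.uIoc_of_le zero_le_one] at hx
    have hx' : x ∈ Set.Ioo (0 : ℝ) 1 := ⟨hx.1, lt_of_le_of_ne hx.2 hx1⟩
    rw [hnorm σ x hx', show (1 - (x : ℂ)) = ((1 - x : ℝ) : ℂ) by push_cast; rfl,
      show ((σ : ℂ) - 1) = ((σ - 1 : ℝ) : ℂ) by push_cast; rfl,
      show ((d : ℂ) - 1) = ((d - 1 : ℝ) : ℂ) by push_cast; rfl,
      ← Complex.ofReal_cpow hx'.1.le, ← Complex.ofReal_cpow (by linarith [hx'.2])]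
    push_cast; simp
  have hGd : 0 < Real.Gamma d := Real.Gamma_pos_of_pos hd
  have h3 : (∫ x : ℝ in (0 : ℝ)..1,
        ‖(x : ℂ) ^ ((σ : ℂ) - 1) * (1 - (x : ℂ)) ^ ((d : ℂ) - 1)‖ : ℝ)
        = Real.Gamma σ * Real.Gamma d / Real.Gamma (σ + d) := by
    rw [heq, ← Complex.ofReal_add, Complex.Gamma_ofReal, Complex.Gamma_ofReal,
      Complex.Gamma_ofReal] at b2
    exact_mod_cast b2
  rw [h3, b1, Complex.Gamma_ofReal, norm_div, norm_mul, Complex.norm_of_nonneg hGd.le] at hle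
  rw [norm_div]
  have e1 : ‖Complex.Gamma z‖ * Real.Gamma d / ‖Complex.Gamma (z + d)‖
    = (‖Complex.Gamma z‖ / ‖Complex.Gamma (z + d)‖) * Real.Gamma d := by ring
  have e2 : Real.Gamma σ * Real.Gamma d / Real.Gamma (σ + d)
    = (Real.Gamma σ / Real.Gamma (σ + d)) * Real.Gamma d := by ring
  rw [e1, e2] at hle
  exact le_of_mul_le_mul_right hle hGd

/-- common gamma factor -/
noncomputable def gc (k : ℕ) (m : ℕ) (s : ℂ) : ℂ :=
  (Complex.Gamma (s + 1 / 2 + k) / Complex.Gamma (s + 1 + k))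
    * (Complex.Gamma (s + 2 / 3) / Complex.Gamma (s + 1 + m))
    * (Complex.Gamma (s + 1 / 3) / Complex.Gamma (s + 1)) * (4 : ℂ) ^ s

noncomputable def gW (k : ℕ) (s : ℂ) : ℂ := gc k (2 * k) s * (15 * s + 4 + 6 * k)

noncomputable def fW (k : ℕ) (s : ℂ) : ℂ := gc k (2 * k + 1) s * (s * (3 * s + 5 + 12 * k))

/-- real majorant -/
noncomputable def gM (k m : ℕ) (c : ℝ) : ℝ :=
  (Real.Gamma (c + 1 / 2 + k) / Real.Gamma (c + 1 / 2 + k + 1 / 2))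
    * (Real.Gamma (c + 2 / 3) / Real.Gamma (c + 2 / 3 + (1 / 3 + m)))
    * (Real.Gamma (c + 1 / 3) / Real.Gamma (c + 1 / 3 + 2 / 3)) * 4

lemma gc_bound (k m : ℕ) {c : ℝ} (hc : -1 / 3 < c) {s : ℂ} (h1 : c ≤ s.re) (h2 : s.re ≤ 1) :
    ‖gc k m s‖ ≤ gM k m c := by
  have hk : (0 : ℝ) ≤ k := Nat.cast_nonneg k
  have hm : (0 : ℝ) ≤ m := Nat.cast_nonneg m
  have b1 := Gr_bound (z := s + 1 / 2 + k) (w := s + 1 + k) (σ := c + 1 / 2 + k) (d := 1 / 2)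
    (by linarith) (by simp; linarith) (by norm_num) (by push_cast; ring)
  have b2 := Gr_bound (z := s + 2 / 3) (w := s + 1 + m) (σ := c + 2 / 3) (d := 1 / 3 + m)
    (by linarith) (by simp; linarith) (by linarith) (by push_cast; ring)
  have b3 := Gr_bound (z := s + 1 / 3) (w := s + 1) (σ := c + 1 / 3) (d := 2 / 3)
    (by linarith) (by simp; linarith) (by norm_num) (by push_cast; ring)
  have b4 : ‖(4 : ℂ) ^ s‖ ≤ 4 := by
    have := Complex.norm_cpow_eq_rpow_re_of_pos (x := 4) (by norm_num) s
    rw [show ((4 : ℝ) : ℂ) = 4 by norm_num] at this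
    rw [this]
    calc (4 : ℝ) ^ s.re ≤ 4 ^ (1 : ℝ) := Real.rpow_le_rpow_of_exponent_le (by norm_num) h2
      _ = 4 := by norm_num
  rw [gc, gM, norm_mul, norm_mul, norm_mul]
  have p1 := (norm_nonneg _).trans b1
  have p2 := (norm_nonneg _).trans b2
  have p3 := (norm_nonneg _).trans b3
  exact mul_le_mul (mul_le_mul (mul_le_mul b1 b2 (norm_nonneg _) p1) b3 (norm_nonneg _)
    (mul_nonneg p1 p2)) b4 (norm_nonneg _) (mul_nonneg (mul_nonneg p1 p2) p3)

lemma gM_nonneg (k m : ℕ) {c : ℝ} (hc : -1 / 3 < c) : 0 ≤ gM k m c := by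
  have hk : (0 : ℝ) ≤ k := Nat.cast_nonneg k
  have hm : (0 : ℝ) ≤ m := Nat.cast_nonneg m
  rw [gM]
  have g := fun x (hx : (0:ℝ) < x) => (Real.Gamma_pos_of_pos hx).le
  refine mul_nonneg (mul_nonneg (mul_nonneg (div_nonneg ?_ ?_) (div_nonneg ?_ ?_))
    (div_nonneg ?_ ?_)) (by norm_num) <;> apply g <;> linarith

lemma gc_diff (k m : ℕ) : DifferentiableOn ℂ (gc k m) {s | -1 / 3 < s.re ∧ s.re < 1} := by
  intro s hs
  apply DifferentiableAt.differentiableWithinAt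
  have hk : (0 : ℝ) ≤ k := Nat.cast_nonneg k
  have hm : (0 : ℝ) ≤ m := Nat.cast_nonneg m
  have hs1 : -1 / 3 < s.re := hs.1
  have D : ∀ a : ℂ, 0 < (s + a).re → DifferentiableAt ℂ (fun s => Complex.Gamma (s + a)) s := by
    intro a ha
    exact (diff_Gamma_of_re_pos ha).comp s (f := fun s => s + a) (by fun_prop)
  unfold gc
  simp only [add_assoc]
  refine DifferentiableAt.mul (DifferentiableAt.mul (DifferentiableAt.mul
    (DifferentiableAt.div (D _ ?_) (D _ ?_) ?_) (DifferentiableAt.div (D _ ?_) (D _ ?_) ?_))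
    (DifferentiableAt.div (D _ ?_) (D _ ?_) ?_)) ?_
  on_goal 10 => exact DifferentiableAt.const_cpow (by fun_prop) (Or.inl (by norm_num))
  all_goals try apply Complex.Gamma_ne_zero_of_re_pos
  all_goals simp
  all_goals linarith

lemma wz (k : ℕ) {s : ℂ} (hs : -1 / 3 < s.re) :
    gW k s - 4 * (k + 1 / 3) * (k + 2 / 3) * gW (k + 1) s = fW k (s + 1) + fW k s := by
  have hk : (0 : ℝ) ≤ k := Nat.cast_nonneg k
  have N : ∀ z : ℂ, 0 < z.re → z ≠ 0 := by
    rintro z hz rfl; simp at hz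
  have n1 : s + 1 / 2 + k ≠ 0 := N _ (by simp; linarith)
  have n2 : s + 1 + k ≠ 0 := N _ (by simp; linarith)
  have n3 : s + 1 + 2 * k ≠ 0 := N _ (by simp; linarith)
  have n4 : s + 2 + 2 * k ≠ 0 := N _ (by simp; linarith)
  have n5 : s + 1 / 3 ≠ 0 := N _ (by simp; linarith)
  have n6 : s + 2 / 3 ≠ 0 := N _ (by simp; linarith)
  have n7 : s + 1 ≠ 0 := N _ (by simp; linarith)
  have G1 : Complex.Gamma (s + 1 + k) ≠ 0 :=
    Complex.Gamma_ne_zero_of_re_pos (by simp; linarith)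
  have G2 : Complex.Gamma (s + 1 + 2 * k) ≠ 0 :=
    Complex.Gamma_ne_zero_of_re_pos (by simp; linarith)
  have G3 : Complex.Gamma (s + 1) ≠ 0 :=
    Complex.Gamma_ne_zero_of_re_pos (by simp; linarith)
  have e1 : Complex.Gamma (s + 1 / 2 + (k + 1)) = (s + 1 / 2 + k) * Complex.Gamma (s + 1 / 2 + k) := by
    rw [← Complex.Gamma_add_one _ n1]; congr 1; ring
  have e1' : Complex.Gamma (s + 1 + 1 / 2 + k) = (s + 1 / 2 + k) * Complex.Gamma (s + 1 / 2 + k) := by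
    rw [← Complex.Gamma_add_one _ n1]; congr 1; ring
  have e2 : Complex.Gamma (s + 1 + (k + 1)) = (s + 1 + k) * Complex.Gamma (s + 1 + k) := by
    rw [← Complex.Gamma_add_one _ n2]; congr 1; ring
  have e2' : Complex.Gamma (s + 1 + 1 + k) = (s + 1 + k) * Complex.Gamma (s + 1 + k) := by
    rw [← Complex.Gamma_add_one _ n2]; congr 1; ring
  have e3 : Complex.Gamma (s + 1 + (2 * k + 1))
      = (s + 1 + 2 * k) * Complex.Gamma (s + 1 + 2 * k) := by
    rw [← Complex.Gamma_add_one _ n3]; congr 1; ring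
  have e4 : Complex.Gamma (s + 1 + (2 * (k + 1)))
      = (s + 2 + 2 * k) * ((s + 1 + 2 * k) * Complex.Gamma (s + 1 + 2 * k)) := by
    rw [← Complex.Gamma_add_one _ n3, show s + 1 + 2 * k + 1 = s + 2 + 2 * k by ring,
      ← Complex.Gamma_add_one _ n4]; congr 1; ring
  have e4' : Complex.Gamma (s + 1 + 1 + (2 * k + 1))
      = (s + 2 + 2 * k) * ((s + 1 + 2 * k) * Complex.Gamma (s + 1 + 2 * k)) := by
    rw [← e4]; congr 1; ring
  have e5 : Complex.Gamma (s + 1 + 1 / 3) = (s + 1 / 3) * Complex.Gamma (s + 1 / 3) := by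
    rw [← Complex.Gamma_add_one _ n5]; congr 1; ring
  have e6 : Complex.Gamma (s + 1 + 2 / 3) = (s + 2 / 3) * Complex.Gamma (s + 2 / 3) := by
    rw [← Complex.Gamma_add_one _ n6]; congr 1; ring
  have e7 : Complex.Gamma (s + 1 + 1) = (s + 1) * Complex.Gamma (s + 1) :=
    Complex.Gamma_add_one _ n7
  have e8 : (4 : ℂ) ^ (s + 1) = 4 ^ s * 4 := by
    rw [Complex.cpow_add _ _ (by norm_num), Complex.cpow_one]
  simp only [gW, fW, gc]
  push_cast
  rw [e1, e1', e2, e2', e3, e4, e4', e5, e6, e7, e8]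
  field_simp
  ring

lemma norm_line_le {x y : ℝ} (h1 : -1 ≤ x) (h2 : x ≤ 1) : ‖(x : ℂ) + y * I‖ ≤ 1 + |y| := by
  refine (norm_add_le _ _).trans ?_
  rw [norm_mul, Complex.norm_I, mul_one, Complex.norm_real, Complex.norm_real]
  exact add_le_add (abs_le.mpr ⟨h1, h2⟩) le_rfl

lemma gW_bound (k : ℕ) {c : ℝ} (hc : -1 / 3 < c) {x y : ℝ} (h1 : c ≤ x) (h2 : x ≤ 1) :
    ‖gW k ((x : ℂ) + y * I)‖ ≤ (gM k (2 * k) c * (5 * (4 + 6 * k))) * (1 + |y|) ^ 2 := by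
  have hk : (0 : ℝ) ≤ k := Nat.cast_nonneg k
  have b := gc_bound k (2 * k) hc (s := (x : ℂ) + y * I) (by simpa using h1) (by simpa using h2)
  have n := norm_line_le (x := x) (y := y) (by linarith) h2
  have hy := abs_nonneg y
  rw [gW, norm_mul, mul_assoc]
  refine mul_le_mul b ?_ (norm_nonneg _) (gM_nonneg k _ hc)
  have : ‖15 * ((x : ℂ) + y * I) + 4 + 6 * k‖ ≤ 15 * (1 + |y|) + 4 + 6 * k := by
    refine (norm_add_le _ _).trans (add_le_add ((norm_add_le _ _).trans (add_le_add ?_ ?_)) ?_)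
    · rw [norm_mul]; norm_num; linarith
    · norm_num
    · rw [norm_mul]; norm_num
  refine this.trans ?_
  have hky : 0 ≤ (k : ℝ) * |y| := mul_nonneg hk hy
  nlinarith [mul_nonneg hky hy]

lemma fW_bound (k : ℕ) {c : ℝ} (hc : -1 / 3 < c) {x y : ℝ} (h1 : c ≤ x) (h2 : x ≤ 1) :
    ‖fW k ((x : ℂ) + y * I)‖ ≤ (gM k (2 * k + 1) c * (8 + 12 * k)) * (1 + |y|) ^ 2 := by
  have hk : (0 : ℝ) ≤ k := Nat.cast_nonneg k
  have b := gc_bound k (2 * k + 1) hc (s := (x : ℂ) + y * I) (by simpa using h1) (by simpa using h2)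
  have n := norm_line_le (x := x) (y := y) (by linarith) h2
  have hy := abs_nonneg y
  rw [fW, norm_mul, mul_assoc]
  refine mul_le_mul b ?_ (norm_nonneg _) (gM_nonneg k _ hc)
  have : ‖3 * ((x : ℂ) + y * I) + 5 + 12 * k‖ ≤ (8 + 12 * k) * (1 + |y|) := by
    have : ‖3 * ((x : ℂ) + y * I) + 5 + 12 * k‖ ≤ 3 * (1 + |y|) + 5 + 12 * k := by
      refine (norm_add_le _ _).trans (add_le_add ((norm_add_le _ _).trans (add_le_add ?_ ?_)) ?_)
      · rw [norm_mul]; norm_num; linarith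
      · norm_num
      · rw [norm_mul]; norm_num
    nlinarith [mul_nonneg hk hy]
  rw [norm_mul]
  calc _ ≤ (1 + |y|) * ((8 + 12 * k) * (1 + |y|)) :=
        mul_le_mul n this (norm_nonneg _) (by positivity)
    _ = _ := by ring

lemma gW_diff (k : ℕ) : DifferentiableOn ℂ (gW k) {s | -1 / 3 < s.re ∧ s.re < 1} := by
  unfold gW
  exact (gc_diff k _).mul (by fun_prop)

lemma fW_diff (k : ℕ) : DifferentiableOn ℂ (fW k) {s | -1 / 3 < s.re ∧ s.re < 1} := by
  unfold fW
  exact (gc_diff k _).mul (by fun_prop)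

/-- line integral -/
noncomputable def JW (k : ℕ) (c : ℝ) : ℂ :=
  ∫ y : ℝ, kerE ((c : ℂ) + y * I) * gW k ((c : ℂ) + y * I)

lemma gW_int {c : ℝ} (hc1 : -1 / 3 < c) (hc2 : c < 0) (k : ℕ) :
    Integrable (fun y : ℝ => kerE ((c : ℂ) + y * I) * gW k ((c : ℂ) + y * I)) :=
  int_neg (by norm_num) hc1 hc2 (gW_diff k) _
    (fun y => gW_bound k hc1 le_rfl (by linarith))

lemma JW_rec {c : ℝ} (hc1 : -1 / 3 < c) (hc2 : c < 0) (k : ℕ) :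
    JW k c = 4 * (k + 1 / 3) * (k + 2 / 3) * JW (k + 1) c := by
  have hf := res_shift (φ := fW k) (c := c) (c' := c + 1) (a := -1 / 3) (by norm_num) hc1 hc2
    (by linarith) (by linarith) (fW_diff k) _
    (fun x y hx hx' => fW_bound k hc1 hx (by linarith))
  have hf0 : fW k 0 = 0 := by simp [fW]
  rw [hf0, mul_zero, add_zero] at hf
  have i1 := int_neg (φ := fW k) (c := c) (by norm_num) hc1 hc2 (fW_diff k) _
    (fun y => fW_bound k hc1 le_rfl (by linarith))
  have i2 := int_pos (φ := fW k) (c := c + 1) (a := -1 / 3) (by norm_num) (by linarith)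
    (by linarith) (fW_diff k) _ (fun y => fW_bound k hc1 (by linarith) (by linarith))
  have key : (fun y : ℝ => kerE ((c : ℂ) + y * I) * gW k ((c : ℂ) + y * I)
      - (4 * (k + 1 / 3) * (k + 2 / 3)) * (kerE ((c : ℂ) + y * I) * gW (k + 1) ((c : ℂ) + y * I)))
      = fun y : ℝ => kerE ((c : ℂ) + y * I) * fW k ((c : ℂ) + y * I)
        - kerE (((c + 1 : ℝ) : ℂ) + y * I) * fW k (((c + 1 : ℝ) : ℂ) + y * I) := by
    funext y
    have w := wz k (s := (c : ℂ) + y * I) (by simpa using hc1)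
    rw [show (((c + 1 : ℝ) : ℂ) + y * I) = ((c : ℂ) + y * I) + 1 by push_cast; ring, kerE_add_one]
    linear_combination kerE ((c : ℂ) + y * I) * w
  have := congrArg (fun F : ℝ → ℂ => ∫ y, F y) key
  rw [integral_sub (gW_int hc1 hc2 k) ((gW_int hc1 hc2 (k + 1)).const_mul _), integral_sub i1 i2,
    hf, sub_self, integral_const_mul] at this
  exact sub_eq_zero.mp this

lemma JW_shift {c : ℝ} (hc1 : -1 / 3 < c) (hc2 : c < 0) (k : ℕ) :
    JW k (1 / 2) = JW k c + 2 * π * gW k 0 :=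
  res_shift (φ := gW k) (c := c) (c' := 1 / 2) (a := -1 / 3) (by norm_num) hc1 hc2
    (by norm_num) (by norm_num) (gW_diff k) _
    (fun x y hx hx' => gW_bound k hc1 hx (by linarith))

/-- normalising product -/
noncomputable def NW (k : ℕ) : ℝ := ∏ j ∈ Finset.range k, (4 * (j + 1 / 3) * (j + 2 / 3) : ℝ)

lemma NW_pos (k : ℕ) : 0 < NW k := Finset.prod_pos fun j _ => by positivity

lemma JW_zero {c : ℝ} (hc1 : -1 / 3 < c) (hc2 : c < 0) (k : ℕ) :
    JW 0 c = NW k * JW k c := by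
  induction k with
  | zero => simp [NW]
  | succ k ih =>
    rw [ih, JW_rec hc1 hc2 k, NW, NW, Finset.prod_range_succ]
    push_cast; ring

lemma JW_half_bound : ∃ C : ℝ, 0 ≤ C ∧ ∀ k : ℕ,
    ‖JW k (1 / 2)‖ ≤ C * (gM k (2 * k) (1 / 2) * (4 + 6 * k)) := by
  have hi := int_pos (φ := fun s => 8 * s ^ 2) (c := 1 / 2) (a := -1 / 3) (by norm_num)
    (by norm_num) (by norm_num) (by fun_prop) 8 (by
      intro y
      rw [norm_mul, norm_pow]
      have := norm_line_le (x := 1 / 2) (y := y) (by norm_num) (by norm_num)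
      norm_num at this ⊢
      gcongr)
  refine ⟨5 * ∫ y : ℝ, ‖kerE (((1 / 2 : ℝ) : ℂ) + y * I) * (8 * (((1 / 2 : ℝ) : ℂ) + y * I) ^ 2)‖,
    by positivity, fun k => ?_⟩
  have hM := gM_nonneg k (2 * k) (c := 1 / 2) (by norm_num)
  have hb : ∀ y : ℝ, ‖kerE (((1 / 2 : ℝ) : ℂ) + y * I) * gW k (((1 / 2 : ℝ) : ℂ) + y * I)‖ ≤
      (gM k (2 * k) (1 / 2) * (5 * (4 + 6 * k))) *
      ‖kerE (((1 / 2 : ℝ) : ℂ) + y * I) * (8 * (((1 / 2 : ℝ) : ℂ) + y * I) ^ 2)‖ := by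
    intro y
    have b := gW_bound k (c := 1 / 2) (by norm_num) (x := 1 / 2) (y := y) le_rfl (by norm_num)
    have e : (1 + |y|) ^ 2 ≤ ‖8 * (((1 / 2 : ℝ) : ℂ) + y * I) ^ 2‖ := by
      rw [norm_mul, norm_pow, Complex.sq_norm, Complex.normSq_add_mul_I]
      norm_num
      rw [← sq_abs y]
      nlinarith [sq_nonneg (|y| - 1), sq_nonneg (|y|)]
    rw [norm_mul, norm_mul]
    calc _ ≤ ‖kerE (((1 / 2 : ℝ) : ℂ) + y * I)‖ *
          ((gM k (2 * k) (1 / 2) * (5 * (4 + 6 * k))) * ‖8 * (((1 / 2 : ℝ) : ℂ) + y * I) ^ 2‖) := by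
          gcongr
          exact b.trans (by gcongr)
      _ = _ := by ring
  have := norm_integral_le_of_norm_le (hi.norm.const_mul
    (gM k (2 * k) (1 / 2) * (5 * (4 + 6 * k)))) (Filter.Eventually.of_forall hb)
  rw [integral_const_mul] at this
  refine this.trans (le_of_eq ?_)
  ring

lemma Gamma_logconv {x : ℝ} (hx : 0 < x) :
    Real.Gamma (x + 1 / 2) ^ 2 ≤ Real.Gamma x * Real.Gamma (x + 1) := by
  have h := Real.Gamma_mul_add_mul_le_rpow_Gamma_mul_rpow_Gamma (s := x) (t := x + 1)
    (a := 1 / 2) (b := 1 / 2) hx (by linarith) (by norm_num) (by norm_num) (by norm_num)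
  rw [show 1 / 2 * x + 1 / 2 * (x + 1) = x + 1 / 2 by ring] at h
  have p0 := Real.Gamma_pos_of_pos (show 0 < x + 1 / 2 by linarith)
  have p1 := Real.Gamma_pos_of_pos hx
  have p2 := Real.Gamma_pos_of_pos (show 0 < x + 1 by linarith)
  rw [← Real.sqrt_eq_rpow, ← Real.sqrt_eq_rpow] at h
  calc _ ≤ (√(Real.Gamma x) * √(Real.Gamma (x + 1))) ^ 2 := by gcongr
    _ = _ := by rw [mul_pow, Real.sq_sqrt p1.le, Real.sq_sqrt p2.le]

/-- value of `gW k 0` as a real number -/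
noncomputable def uW (k : ℕ) : ℝ :=
  (Real.Gamma (1 / 2 + k) / Real.Gamma (1 + k)) * (Real.Gamma (2 / 3) / Real.Gamma (1 + 2 * k))
    * Real.Gamma (1 / 3) * (4 + 6 * k)

lemma gW_zero (k : ℕ) : gW k 0 = uW k := by
  simp only [gW, gc, uW, zero_add, mul_zero, Complex.Gamma_one, div_one, Complex.cpow_zero, mul_one]
  push_cast [← Complex.Gamma_ofReal]
  rfl

lemma uW_pos (k : ℕ) : 0 < uW k := by
  have hk : (0 : ℝ) ≤ k := Nat.cast_nonneg k
  have p := fun x (hx : (0 : ℝ) < x) => Real.Gamma_pos_of_pos hx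
  have p1 := p (1 / 2 + k) (by linarith)
  have p2 := p (1 + k) (by linarith)
  have p3 := p (2 / 3) (by norm_num)
  have p4 := p (1 + 2 * k) (by linarith)
  have p5 := p (1 / 3) (by norm_num)
  rw [uW]; positivity

lemma gM_le : ∃ D : ℝ, 0 ≤ D ∧ ∀ k : ℕ, gM k (2 * k) (1 / 2) * (4 + 6 * k)
    ≤ D * uW k * √(1 / (2 * k + 1 / 2)) := by
  have p := fun x (hx : (0 : ℝ) < x) => Real.Gamma_pos_of_pos hx
  have p3 := p (2 / 3) (by norm_num)
  have p5 := p (1 / 3) (by norm_num)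
  have p6 := p (1 / 2 + 2 / 3) (by norm_num)
  have p7 := p (1 / 2 + 1 / 3) (by norm_num)
  have p8 := p (1 / 2 + 1 / 3 + 2 / 3) (by norm_num)
  refine ⟨Real.Gamma (1 / 2 + 2 / 3) * (Real.Gamma (1 / 2 + 1 / 3) /
    Real.Gamma (1 / 2 + 1 / 3 + 2 / 3)) * 4 / (Real.Gamma (2 / 3) * Real.Gamma (1 / 3)),
    by positivity, fun k => ?_⟩
  have hk : (0 : ℝ) ≤ k := Nat.cast_nonneg k
  have p1 := p (1 / 2 + k) (by linarith)
  have p2 := p (1 + k) (by linarith)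
  have p4 := p (1 + 2 * k) (by linarith)
  have p9 := p (1 + k + 1 / 2) (by linarith)
  have p10 := p (1 + 2 * k + 1 / 2) (by linarith)
  have p11 := p (2 * k + 1 / 2) (by linarith)
  have A : Real.Gamma (1 + k) ^ 2 / (Real.Gamma (1 / 2 + k) * Real.Gamma (1 + k + 1 / 2)) ≤ 1 := by
    rw [div_le_one (by positivity)]
    have := Gamma_logconv (x := 1 / 2 + k) (by linarith)
    rw [show (1 / 2 + k + 1 / 2 : ℝ) = 1 + k by ring,
      show (1 / 2 + k + 1 : ℝ) = 1 + k + 1 / 2 by ring] at this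
    exact this
  have Bd : Real.Gamma (1 + 2 * k) / Real.Gamma (1 + 2 * k + 1 / 2) ≤ √(1 / (2 * k + 1 / 2)) := by
    apply Real.le_sqrt_of_sq_le
    have := Gamma_logconv (x := 2 * k + 1 / 2) (by linarith)
    have e := Real.Gamma_add_one (s := 2 * k + 1 / 2) (by linarith)
    rw [show (2 * k + 1 / 2 + 1 / 2 : ℝ) = 1 + 2 * k by ring, e] at this
    rw [show (1 + 2 * k + 1 / 2 : ℝ) = 2 * k + 1 / 2 + 1 by ring, e, div_pow,
      div_le_div_iff₀ (by positivity) (by positivity)]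
    have h0 : (0 : ℝ) ≤ 2 * k + 1 / 2 := by linarith
    nlinarith [mul_le_mul_of_nonneg_right this h0]
  have e : gM k (2 * k) (1 / 2) * (4 + 6 * k) =
      Real.Gamma (1 / 2 + 2 / 3) * (Real.Gamma (1 / 2 + 1 / 3) /
      Real.Gamma (1 / 2 + 1 / 3 + 2 / 3)) * 4 / (Real.Gamma (2 / 3) * Real.Gamma (1 / 3)) * uW k
      * ((Real.Gamma (1 + k) ^ 2 / (Real.Gamma (1 / 2 + k) * Real.Gamma (1 + k + 1 / 2)))
        * (Real.Gamma (1 + 2 * k) / Real.Gamma (1 + 2 * k + 1 / 2))) := by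
    rw [gM, uW]
    push_cast
    rw [show (1 / 2 + 1 / 2 + k : ℝ) = 1 + k by ring,
      show (1 / 2 + 2 / 3 + (1 / 3 + 2 * k) : ℝ) = 1 + 2 * k + 1 / 2 by ring]
    generalize Real.Gamma (1 / 2 + 2 / 3) = z1 at *
    generalize Real.Gamma (1 / 2 + 1 / 3 + 2 / 3) = z2 at *
    generalize Real.Gamma (1 / 2 + 1 / 3) = z3 at *
    field_simp
  rw [e]
  have hu := uW_pos k
  gcongr
  calc _ ≤ 1 * (Real.Gamma (1 + 2 * k) / Real.Gamma (1 + 2 * k + 1 / 2)) := by gcongr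
    _ ≤ _ := by rw [one_mul]; exact Bd

lemma NW_eq (n : ℕ) : NW (n + 1) * (Real.GammaSeq (1 / 3) n * Real.GammaSeq (2 / 3) n)
    = 4 ^ (n + 1) * n * (n.factorial : ℝ) ^ 2 := by
  have e : NW (n + 1) = 4 ^ (n + 1) * (∏ j ∈ Finset.range (n + 1), ((1 / 3 : ℝ) + j)) *
      (∏ j ∈ Finset.range (n + 1), ((2 / 3 : ℝ) + j)) := by
    rw [NW, mul_assoc, ← Finset.prod_mul_distrib]
    conv_rhs => rw [← Finset.card_range (n + 1), ← Finset.prod_const, Finset.card_range]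
    rw [← Finset.prod_mul_distrib]
    apply Finset.prod_congr rfl
    intro j _; ring
  have q1 : (∏ j ∈ Finset.range (n + 1), ((1 / 3 : ℝ) + j)) ≠ 0 :=
    (Finset.prod_pos fun j _ => by positivity).ne'
  have q2 : (∏ j ∈ Finset.range (n + 1), ((2 / 3 : ℝ) + j)) ≠ 0 :=
    (Finset.prod_pos fun j _ => by positivity).ne'
  have hp : (n : ℝ) ^ (1 / 3 : ℝ) * (n : ℝ) ^ (2 / 3 : ℝ) = n := by
    rw [← Real.rpow_add_of_nonneg (Nat.cast_nonneg n) (by norm_num) (by norm_num)]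
    norm_num
  rw [e, Real.GammaSeq, Real.GammaSeq]
  field_simp
  linear_combination hp

lemma uW_eq (n : ℕ) : uW (n + 1) * (4 ^ (n + 1) * ((n + 1) * n.factorial : ℝ) ^ 2)
    = √π * (10 + 6 * n) * (Real.Gamma (1 / 3) * Real.Gamma (2 / 3)) := by
  have h := Real.Gamma_mul_Gamma_add_half ((n : ℝ) + 3 / 2)
  have h2 : Real.Gamma ((n : ℝ) + 2) = (n + 1) * n.factorial := by
    have := Real.Gamma_nat_eq_factorial (n + 1)
    rw [Nat.factorial_succ] at this
    push_cast at this
    rw [← this]; congr 1; ring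
  have h4 : (2 : ℝ) ^ (1 - 2 * ((n : ℝ) + 3 / 2)) * 4 ^ (n + 1) = 1 := by
    rw [show (4 : ℝ) ^ (n + 1) = (2 : ℝ) ^ (((2 * (n + 1) : ℕ)) : ℝ) by
      rw [Real.rpow_natCast, pow_mul]; norm_num, ← Real.rpow_add (by norm_num)]
    push_cast
    rw [show (1 - 2 * ((n : ℝ) + 3 / 2) + 2 * (n + 1)) = 0 by ring, Real.rpow_zero]
  rw [show (n : ℝ) + 3 / 2 + 1 / 2 = n + 2 by ring, show 2 * ((n : ℝ) + 3 / 2) = 2 * n + 3 by ring,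
    h2] at h
  rw [show 2 * ((n : ℝ) + 3 / 2) = 2 * n + 3 by ring] at h4
  rw [uW]
  push_cast
  rw [show (1 / 2 + ((n : ℝ) + 1)) = n + 3 / 2 by ring, show (1 + ((n : ℝ) + 1)) = n + 2 by ring,
    show (1 + 2 * ((n : ℝ) + 1)) = 2 * n + 3 by ring, h2]
  have hn : (0 : ℝ) ≤ n := Nat.cast_nonneg n
  have p1 := Real.Gamma_pos_of_pos (show (0 : ℝ) < 2 * n + 3 by linarith)
  have p2 : (0 : ℝ) < n.factorial := by positivity
  have p3 : (0 : ℝ) < n + 1 := by positivity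
  generalize Real.Gamma (2 * (n : ℝ) + 3) = Z at *
  generalize Real.Gamma ((n : ℝ) + 3 / 2) = Y at *
  generalize (2 : ℝ) ^ (1 - (2 * (n : ℝ) + 3)) = X at *
  have hY : Y * ((n + 1) * n.factorial) * 4 ^ (n + 1) = Z * √π := by
    rw [h]; linear_combination (Z * √π) * h4
  field_simp
  linear_combination (4 + 6 * ((n : ℝ) + 1)) * hY

lemma NuW_tendsto : Filter.Tendsto (fun n : ℕ => NW (n + 1) * uW (n + 1)) Filter.atTop
    (nhds (6 * √π)) := by
  have q1 := Real.Gamma_pos_of_pos (show (0 : ℝ) < 1 / 3 by norm_num)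
  have q2 := Real.Gamma_pos_of_pos (show (0 : ℝ) < 2 / 3 by norm_num)
  have t1 := (Real.GammaSeq_tendsto_Gamma (1 / 3)).mul (Real.GammaSeq_tendsto_Gamma (2 / 3))
  have t2 := (tendsto_const_nhds (x := Real.Gamma (1 / 3) * Real.Gamma (2 / 3))).div t1
    (by positivity)
  rw [div_self (by positivity)] at t2
  have i1 : Filter.Tendsto (fun n : ℕ => 1 / ((n : ℝ) + 1)) Filter.atTop (nhds 0) :=
    tendsto_one_div_add_atTop_nhds_zero_nat
  have t3 : Filter.Tendsto (fun n : ℕ => (1 - 1 / ((n : ℝ) + 1)) * (6 + 4 * (1 / ((n : ℝ) + 1))))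
      Filter.atTop (nhds ((1 - 0) * (6 + 4 * 0))) :=
    (i1.const_sub 1).mul ((i1.const_mul 4).const_add 6)
  have t4 := (t3.mul t2).const_mul (√π)
  rw [show √π * ((1 - 0) * (6 + 4 * 0) * 1) = 6 * √π by ring] at t4
  refine t4.congr' ?_
  filter_upwards [Filter.eventually_ge_atTop 1] with n hn
  have a := NW_eq n
  have b := uW_eq n
  have hn' : (0 : ℝ) < n := by exact_mod_cast hn
  have hG : Real.GammaSeq (1 / 3) n * Real.GammaSeq (2 / 3) n ≠ 0 := by
    intro h0
    rw [h0, mul_zero] at a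
    have : (0 : ℝ) < 4 ^ (n + 1) * n * (n.factorial : ℝ) ^ 2 := by positivity
    linarith
  have p2 : (0 : ℝ) < n.factorial := by positivity
  simp only [Pi.div_apply]
  generalize Real.GammaSeq (1 / 3) n * Real.GammaSeq (2 / 3) n = S at *
  have hN : NW (n + 1) = 4 ^ (n + 1) * n * (n.factorial : ℝ) ^ 2 / S := by
    rw [eq_div_iff hG]; exact a
  have hU : uW (n + 1) = √π * (10 + 6 * n) * (Real.Gamma (1 / 3) * Real.Gamma (2 / 3)) /
      (4 ^ (n + 1) * ((n + 1) * n.factorial : ℝ) ^ 2) := by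
    rw [eq_div_iff (by positivity)]; exact b
  rw [hN, hU]
  field_simp
  ring

lemma JW_value {c : ℝ} (hc1 : -1 / 3 < c) (hc2 : c < 0) :
    JW 0 c = -((12 * π * √π : ℝ) : ℂ) := by
  obtain ⟨C, hC0, hC⟩ := JW_half_bound
  obtain ⟨D, hD0, hD⟩ := gM_le
  have r : Filter.Tendsto (fun n : ℕ => √(1 / (2 * ((n + 1 : ℕ) : ℝ) + 1 / 2))) Filter.atTop
      (nhds 0) := by
    have h1 : Filter.Tendsto (fun n : ℕ => (2 * ((n + 1 : ℕ) : ℝ) + 1 / 2)) Filter.atTop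
        Filter.atTop := by
      apply Filter.tendsto_atTop_add_const_right
      apply Filter.Tendsto.const_mul_atTop (by norm_num)
      exact tendsto_natCast_atTop_atTop.comp (Filter.tendsto_add_atTop_nat 1)
    have h2 := (Real.continuous_sqrt.tendsto 0).comp (h1.const_div_atTop 1)
    rw [Real.sqrt_zero] at h2
    exact h2
  have lim0 : Filter.Tendsto (fun n : ℕ => (NW (n + 1) : ℂ) * JW (n + 1) (1 / 2)) Filter.atTop
      (nhds 0) := by
    have t := ((NuW_tendsto.mul r).const_mul (C * D))
    rw [mul_zero, mul_zero] at t
    refine squeeze_zero_norm (fun n => ?_) t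
    have hN := NW_pos (n + 1)
    rw [norm_mul, Complex.norm_of_nonneg hN.le]
    calc NW (n + 1) * ‖JW (n + 1) (1 / 2)‖
        ≤ NW (n + 1) * (C * (D * uW (n + 1) * √(1 / (2 * ((n + 1 : ℕ) : ℝ) + 1 / 2)))) := by
          gcongr
          exact (hC (n + 1)).trans (mul_le_mul_of_nonneg_left (hD (n + 1)) hC0)
      _ = _ := by ring
  have lim1 : Filter.Tendsto (fun n : ℕ => (NW (n + 1) : ℂ) * JW (n + 1) (1 / 2)
      - 2 * π * ((NW (n + 1) * uW (n + 1) : ℝ) : ℂ)) Filter.atTop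
      (nhds (0 - 2 * π * ((6 * √π : ℝ) : ℂ))) :=
    lim0.sub ((((Complex.continuous_ofReal.tendsto _).comp NuW_tendsto)).const_mul _)
  have hconst : (fun n : ℕ => (NW (n + 1) : ℂ) * JW (n + 1) (1 / 2)
      - 2 * π * ((NW (n + 1) * uW (n + 1) : ℝ) : ℂ)) = fun _ => JW 0 c := by
    funext n
    rw [JW_zero hc1 hc2 (n + 1), JW_shift hc1 hc2 (n + 1), gW_zero]
    push_cast; ring
  rw [hconst] at lim1
  rw [tendsto_nhds_unique tendsto_const_nhds lim1]
  push_cast; ring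

lemma h9_eq (s : ℂ) (hs1 : -1 / 3 < s.re) :
    h9 s = (-(Complex.Gamma (1 / 2) * Complex.Gamma (1 / 3) * Complex.Gamma (2 / 3))⁻¹) *
      (kerE s * gW 0 s) := by
  have hk : -kerE s = Complex.Gamma (-s) * Complex.Gamma (s + 1) := by
    have h := kerE_eq_Gamma (-s)
    rw [sub_neg_eq_add, add_comm 1 s] at h
    rw [← h, kerE, kerE, mul_neg, Complex.sin_neg, div_neg]
  have h4 : cpowR 2 (2 * s) = (4 : ℂ) ^ s := by
    rw [cpowR, Complex.cpow_def_of_ne_zero (by norm_num)]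
    congr 1
    have : Complex.log 4 = ((Real.log 4 : ℝ) : ℂ) := by
      rw [Complex.ofReal_log (by norm_num)]; norm_num
    rw [this, show (4 : ℝ) = 2 ^ 2 by norm_num, Real.log_pow]
    push_cast; ring
  have hG : Complex.Gamma (s + 1) ≠ 0 :=
    Complex.Gamma_ne_zero_of_re_pos (by simp; linarith)
  have hx : kerE s = -(Complex.Gamma (-s) * Complex.Gamma (s + 1)) := by rw [← hk, neg_neg]
  rw [h9, hx, gW, gc, h4]
  simp only [cpoch, Complex.Gamma_one, div_one, Nat.cast_zero, mul_zero, add_zero]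
  rw [add_comm (1 / 2) s, add_comm (1 / 3) s, add_comm (2 / 3) s, add_comm 1 s]
  field_simp

lemma Gamma_consts : Real.Gamma (1 / 3) * Real.Gamma (2 / 3) = 2 * π / √3 := by
  have h := Real.Gamma_mul_Gamma_one_sub (1 / 3)
  rw [show (1 - 1 / 3 : ℝ) = 2 / 3 by norm_num, show π * (1 / 3) = π / 3 by ring,
    Real.sin_pi_div_three] at h
  rw [h]
  field_simp

theorem barnes_integral_3sqrt3_over_pi (c : ℝ) (hc1 : -1/3 < c) (hc2 : c < 0) :
    Integrable (fun y : ℝ => h9 ((c : ℂ) + (y : ℂ) * Complex.I)) ∧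
    (1 / (2*(π : ℂ))) * ∫ y : ℝ, h9 ((c : ℂ) + (y : ℂ) * Complex.I) =
      ((3 * Real.sqrt 3 / π : ℝ) : ℂ) := by
  have e : (fun y : ℝ => h9 ((c : ℂ) + (y : ℂ) * Complex.I)) = fun y : ℝ =>
      (-(Complex.Gamma (1 / 2) * Complex.Gamma (1 / 3) * Complex.Gamma (2 / 3))⁻¹) *
      (kerE ((c : ℂ) + y * I) * gW 0 ((c : ℂ) + y * I)) := by
    funext y
    exact h9_eq _ (by simpa using hc1)
  rw [e]
  refine ⟨(gW_int hc1 hc2 0).const_mul _, ?_⟩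
  rw [integral_const_mul]
  have hJ := JW_value hc1 hc2
  rw [JW] at hJ
  rw [hJ]
  have g1 : Complex.Gamma (1 / 2) = ((√π : ℝ) : ℂ) := by
    rw [← Real.Gamma_one_half_eq, ← Complex.Gamma_ofReal]; push_cast; rfl
  have g2 : Complex.Gamma (1 / 3) * Complex.Gamma (2 / 3) = ((2 * π / √3 : ℝ) : ℂ) := by
    rw [← Gamma_consts, Complex.ofReal_mul, ← Complex.Gamma_ofReal, ← Complex.Gamma_ofReal]
    push_cast; rfl
  rw [mul_assoc (Complex.Gamma (1 / 2)), g1, g2]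
  have hp := Real.pi_pos
  have hsp : √π ≠ 0 := (Real.sqrt_pos.mpr hp).ne'
  have h3 : √(3 : ℝ) ≠ 0 := (Real.sqrt_pos.mpr (by norm_num)).ne'
  have : (1 / (2 * π) * (-(√π * (2 * π / √3))⁻¹ * -(12 * π * √π)) : ℝ) = 3 * √3 / π := by
    field_simp
    ring
  rw [← this]
  push_cast
  ring
end

section
/- For every real w > 0 and every real c with −1/2 < c < 0, the function y ↦ (1/2)_{c+iy} · Γ(−(c+iy)) · w^{c+iy} is integrable over ℝ and (1/(2π)) ∫_{−∞}^{∞} (1/2)_{c+iy} · Γ(−(c+iy)) · w^{c+iy} dy = 1/√(1+w). -/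
open Complex MeasureTheory Real

theorem aux_norm_Gamma_le {z : ℂ} (hz : 0 < z.re) :
    ‖Complex.Gamma z‖ ≤ Real.Gamma z.re := by
  rw [Complex.Gamma_eq_integral hz, Real.Gamma_eq_integral hz, Complex.GammaIntegral]
  refine (norm_integral_le_integral_norm _).trans (le_of_eq ?_)
  refine setIntegral_congr_fun measurableSet_Ioi (fun x hx => ?_)
  have hx' : (0 : ℝ) < x := hx
  simp only [norm_mul]
  rw [Complex.norm_cpow_eq_rpow_re_of_pos hx', Complex.norm_real, Real.norm_eq_abs,
    abs_of_pos (Real.exp_pos _)]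
  simp

theorem aux_norm_Gamma_decay {z : ℂ} (hz : 0 < z.re) (hz1 : z.re ≤ 1) :
    ‖Complex.Gamma z‖ ≤ Real.Gamma (z.re + 1) / z.re * (Real.sqrt (1 + z.im ^ 2))⁻¹ := by
  have hz0 : z ≠ 0 := by
    rintro rfl
    simp at hz
  have h1 := Complex.Gamma_add_one z hz0
  have h2 : ‖Complex.Gamma (z + 1)‖ ≤ Real.Gamma (z.re + 1) := by
    have := aux_norm_Gamma_le (z := z + 1) (by simp; linarith)
    simpa using this
  rw [h1, norm_mul] at h2
  have h3 : z.re * Real.sqrt (1 + z.im ^ 2) ≤ ‖z‖ := by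
    rw [Complex.norm_eq_sqrt_sq_add_sq]
    apply Real.le_sqrt_of_sq_le
    rw [mul_pow, Real.sq_sqrt (by positivity)]
    nlinarith [sq_nonneg z.im, mul_nonneg (sq_nonneg z.im) (by nlinarith : 0 ≤ 1 - z.re ^ 2)]
  have hs : 0 < Real.sqrt (1 + z.im ^ 2) := Real.sqrt_pos.mpr (by positivity)
  rw [← div_eq_mul_inv, div_div, le_div_iff₀ (by positivity)]
  calc _ ≤ ‖Complex.Gamma z‖ * ‖z‖ := by gcongr
    _ ≤ _ := by linarith

theorem aux_integrable (c : ℝ) (hc1 : -1/2 < c) (hc2 : c < 0) :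
    Integrable (fun y : ℝ => Complex.Gamma (1/2 + ((c : ℂ) + (y : ℂ) * Complex.I)) *
        Complex.Gamma (-((c : ℂ) + (y : ℂ) * Complex.I))) := by
  have hne : ∀ z : ℂ, 0 < z.re → ∀ m : ℕ, z ≠ -m := by
    rintro z hz m rfl
    simp at hz
    have : (0 : ℝ) ≤ m := m.cast_nonneg
    linarith
  have hre1 : ∀ y : ℝ, (1/2 + ((c : ℂ) + (y : ℂ) * Complex.I)).re = 1/2 + c := by
    intro y; simp
  have hre2 : ∀ y : ℝ, (-((c : ℂ) + (y : ℂ) * Complex.I)).re = -c := by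
    intro y; simp
  have him1 : ∀ y : ℝ, (1/2 + ((c : ℂ) + (y : ℂ) * Complex.I)).im = y := by
    intro y; simp
  have him2 : ∀ y : ℝ, (-((c : ℂ) + (y : ℂ) * Complex.I)).im = -y := by
    intro y; simp
  have hcont : Continuous (fun y : ℝ => Complex.Gamma (1/2 + ((c : ℂ) + (y : ℂ) * Complex.I)) *
        Complex.Gamma (-((c : ℂ) + (y : ℂ) * Complex.I))) := by
    rw [continuous_iff_continuousAt]
    intro y
    apply ContinuousAt.mul
    · refine ContinuousAt.comp (f := fun y : ℝ => (1/2 + ((c : ℂ) + (y : ℂ) * Complex.I)))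
        (g := Complex.Gamma) ?_ (by fun_prop)
      exact (Complex.differentiableAt_Gamma _ (hne _ (by rw [hre1]; linarith))).continuousAt
    · refine ContinuousAt.comp (f := fun y : ℝ => (-((c : ℂ) + (y : ℂ) * Complex.I)))
        (g := Complex.Gamma) ?_ (by fun_prop)
      exact (Complex.differentiableAt_Gamma _ (hne _ (by rw [hre2]; linarith))).continuousAt
  refine Integrable.mono' (integrable_inv_one_add_sq.const_mul
    ((Real.Gamma (1/2 + c + 1) / (1/2 + c)) * (Real.Gamma (-c + 1) / (-c))))
    hcont.aestronglyMeasurable (Filter.Eventually.of_forall fun y => ?_)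
  have h1 := aux_norm_Gamma_decay (z := 1/2 + ((c : ℂ) + (y : ℂ) * Complex.I))
    (by rw [hre1]; linarith) (by rw [hre1]; linarith)
  have h2 := aux_norm_Gamma_decay (z := -((c : ℂ) + (y : ℂ) * Complex.I))
    (by rw [hre2]; linarith) (by rw [hre2]; linarith)
  rw [hre1, him1] at h1
  rw [hre2, him2, neg_sq] at h2
  rw [norm_mul]
  refine (mul_le_mul h1 h2 (norm_nonneg _) ((norm_nonneg _).trans h1)).trans (le_of_eq ?_)
  have : (Real.sqrt (1 + y^2))⁻¹ * (Real.sqrt (1 + y^2))⁻¹ = (1 + y^2)⁻¹ := by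
    rw [← mul_inv, Real.mul_self_sqrt (by positivity)]
  rw [← this]
  ring

theorem aux_exp_cpow (a : ℝ) (s : ℂ) : ((Real.exp a : ℝ) : ℂ) ^ s = Complex.exp (a * s) := by
  rw [Complex.cpow_def_of_ne_zero (by exact_mod_cast (Real.exp_pos a).ne'),
    ← Complex.ofReal_log (Real.exp_pos a).le, Real.log_exp]

/-- The function whose Mellin transform is computed. -/
noncomputable def auxF (x : ℝ) : ℂ := ((1 + x : ℝ) : ℂ) ^ (-1/2 : ℂ)

theorem aux_pointwise (s : ℂ) (x : ℝ) (hx : 0 < x) :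
    |1 / (1 + x) ^ 2| • (((x / (1 + x) : ℝ) : ℂ) ^ (s - 1) *
      (1 - ((x / (1 + x) : ℝ) : ℂ)) ^ (1/2 - s - 1)) = (x : ℂ) ^ (s - 1) • auxF x := by
  have h1x : 0 < 1 + x := by linarith
  have e1 : (1 - ((x / (1 + x) : ℝ) : ℂ)) = ((Real.exp (- Real.log (1 + x)) : ℝ) : ℂ) := by
    rw [Real.exp_neg, Real.exp_log h1x, ← Complex.ofReal_one, ← Complex.ofReal_sub]
    congr 1
    field_simp
    ring
  have e2 : x / (1 + x) = Real.exp (Real.log x - Real.log (1 + x)) := by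
    rw [Real.exp_sub, Real.exp_log hx, Real.exp_log h1x]
  have e3 : |1 / (1 + x) ^ 2| = Real.exp (- (2 * Real.log (1 + x))) := by
    rw [abs_of_pos (by positivity), Real.exp_neg, two_mul, Real.exp_add, Real.exp_log h1x]
    field_simp
  have e4 : (x : ℂ) ^ (s - 1) = Complex.exp (Real.log x * (s - 1)) := by
    rw [← aux_exp_cpow, Real.exp_log hx]
  have e5 : auxF x = Complex.exp (Real.log (1 + x) * (-1/2)) := by
    rw [← aux_exp_cpow, Real.exp_log h1x, auxF]
  rw [e1, e2, e3, e4, e5, aux_exp_cpow, aux_exp_cpow, Complex.real_smul, smul_eq_mul,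
    Complex.ofReal_exp, ← Complex.exp_add, ← Complex.exp_add, ← Complex.exp_add]
  congr 1
  push_cast
  ring

theorem aux_image : (fun x : ℝ => x / (1 + x)) '' Set.Ioi 0 = Set.Ioo 0 1 := by
  ext t
  constructor
  · rintro ⟨x, hx, rfl⟩
    have hx' : 0 < x := hx
    refine ⟨by positivity, ?_⟩
    change x / (1 + x) < 1
    rw [div_lt_one (by linarith)]
    linarith
  · rintro ⟨h0, h1⟩
    have h2 : 0 < 1 - t := by linarith
    refine ⟨t / (1 - t), div_pos h0 h2, ?_⟩
    have : 1 + t / (1 - t) = 1 / (1 - t) := by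
      field_simp
      ring
    simp only [this]
    field_simp

theorem aux_deriv (x : ℝ) (hx : x ∈ Set.Ioi (0 : ℝ)) :
    HasDerivWithinAt (fun x : ℝ => x / (1 + x)) (1 / (1 + x) ^ 2) (Set.Ioi 0) x := by
  have hx' : 0 < x := hx
  have h := (hasDerivAt_id x).div ((hasDerivAt_id x).const_add 1)
    (by simp only [id]; linarith)
  have h' := h.hasDerivWithinAt (s := Set.Ioi 0)
  have e : (1 : ℝ) / (1 + x) ^ 2 = (1 * (1 + id x) - id x * 1) / (1 + id x) ^ 2 := by
    simp only [id]
    ring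
  rw [e]
  exact h'

theorem aux_inj : Set.InjOn (fun x : ℝ => x / (1 + x)) (Set.Ioi 0) := by
  intro x hx y hy h
  have hx' : 0 < x := hx
  have hy' : 0 < y := hy
  simp only at h
  rw [div_eq_div_iff (by linarith) (by linarith)] at h
  linarith

theorem aux_mellin (s : ℂ) (h0 : 0 < s.re) (h1 : s.re < 1/2) :
    MellinConvergent auxF s ∧
      mellin auxF s = Complex.Gamma s * Complex.Gamma (1/2 - s) / Complex.Gamma (1/2) := by
  have hv : 0 < (1/2 - s).re := by simp; linarith
  have hpt : Set.EqOn (fun x : ℝ => |1 / (1 + x) ^ 2| • (((x / (1 + x) : ℝ) : ℂ) ^ (s - 1) *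
      (1 - ((x / (1 + x) : ℝ) : ℂ)) ^ (1/2 - s - 1))) (fun x : ℝ => (x : ℂ) ^ (s - 1) • auxF x)
      (Set.Ioi 0) := fun x hx => aux_pointwise s x hx
  constructor
  · have h := Complex.betaIntegral_convergent h0 hv
    rw [intervalIntegrable_iff_integrableOn_Ioo_of_le zero_le_one, ← aux_image,
      integrableOn_image_iff_integrableOn_abs_deriv_smul measurableSet_Ioi aux_deriv aux_inj] at h
    exact h.congr_fun hpt measurableSet_Ioi
  · have h := Complex.betaIntegral_eq_Gamma_mul_div s (1/2 - s) h0 hv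
    rw [add_sub_cancel] at h
    rw [← h, Complex.betaIntegral, intervalIntegral.integral_of_le zero_le_one,
      integral_Ioc_eq_integral_Ioo, ← aux_image,
      integral_image_eq_integral_abs_deriv_smul measurableSet_Ioi aux_deriv aux_inj, mellin]
    exact (setIntegral_congr_fun measurableSet_Ioi hpt).symm

theorem barnes_integral_binomial (w : ℝ) (hw : 0 < w) (c : ℝ) (hc1 : -1/2 < c) (hc2 : c < 0) :
    Integrable (fun y : ℝ =>
      cpoch (1/2) ((c : ℂ) + (y : ℂ) * Complex.I) *
        Complex.Gamma (-((c : ℂ) + (y : ℂ) * Complex.I)) *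
        cpowR w ((c : ℂ) + (y : ℂ) * Complex.I)) ∧
    (1 / (2*(π : ℂ))) * ∫ y : ℝ,
        cpoch (1/2) ((c : ℂ) + (y : ℂ) * Complex.I) *
          Complex.Gamma (-((c : ℂ) + (y : ℂ) * Complex.I)) *
          cpowR w ((c : ℂ) + (y : ℂ) * Complex.I) =
      ((1 / Real.sqrt (1 + w) : ℝ) : ℂ) := by
  have hint := aux_integrable c hc1 hc2
  constructor
  · have h2 := (hint.mul_const (1 / Complex.Gamma (1/2))).mul_bdd
      (c := Real.exp (c * Real.log w))
      (g := fun y : ℝ => cpowR w ((c : ℂ) + (y : ℂ) * Complex.I))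
      (by
        apply Continuous.aestronglyMeasurable
        unfold cpowR
        fun_prop)
      (Filter.Eventually.of_forall fun y => by
        simp [cpowR, Complex.norm_exp])
    refine h2.congr (Filter.Eventually.of_forall fun y => ?_)
    simp only [cpoch]
    ring
  · have hm : ∀ y : ℝ, mellin auxF (((-c : ℝ) : ℂ) + ((-y : ℝ) : ℂ) * Complex.I) =
        Complex.Gamma (1/2 + ((c : ℂ) + (y : ℂ) * Complex.I)) *
        Complex.Gamma (-((c : ℂ) + (y : ℂ) * Complex.I)) * (1 / Complex.Gamma (1/2)) := by
      intro y
      rw [(aux_mellin _ (by simp; linarith) (by simp; linarith)).2]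
      have e1 : (((-c : ℝ) : ℂ) + ((-y : ℝ) : ℂ) * Complex.I) =
        -((c : ℂ) + (y : ℂ) * Complex.I) := by push_cast; ring
      rw [e1, sub_neg_eq_add]
      ring
    have hV : VerticalIntegrable (mellin auxF) (-c) := by
      have h2 := (hint.mul_const (1 / Complex.Gamma (1/2))).comp_neg
      refine h2.congr (Filter.Eventually.of_forall fun y => ?_)
      have := hm (-y)
      rw [neg_neg] at this
      exact this.symm
    have hC : ContinuousAt auxF w := by
      unfold auxF
      refine ContinuousAt.cpow (by fun_prop) (by fun_prop) ?_
      left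
      simp
      linarith
    have hinv := mellinInv_mellin_eq (-c) auxF hw
      (aux_mellin _ (by simp; linarith) (by simp; linarith)).1 hV hC
    have hF : auxF w = ((1 / Real.sqrt (1 + w) : ℝ) : ℂ) := by
      have : (-1/2 : ℂ) = ((-(1/2) : ℝ) : ℂ) := by push_cast; ring
      rw [auxF, this, ← Complex.ofReal_cpow (by linarith), Real.rpow_neg (by linarith),
        ← Real.sqrt_eq_rpow, one_div]
    rw [← hF, ← hinv, mellinInv, ← integral_neg_eq_self, Complex.real_smul]
    push_cast
    congr 1
    refine integral_congr_ae (Filter.Eventually.of_forall fun y => ?_)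
    have := hm (-y)
    push_cast at this
    rw [neg_neg] at this
    simp only
    rw [this, cpoch, cpowR, smul_eq_mul, Complex.cpow_def_of_ne_zero (by exact_mod_cast hw.ne'),
      ← Complex.ofReal_log hw.le]
    have e : (Real.log w : ℂ) * -(-(c : ℂ) + (y : ℂ) * Complex.I) =
      ((c : ℂ) + -(y : ℂ) * Complex.I) * (Real.log w : ℂ) := by ring
    rw [e]
    ring
end
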